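/- arXiv:1503.06281 — 3 statements merged into one kernel-verified Lean document; each statement's English description precedes it below -/
import Mathlib

section
/- Let R and B be disjoint finite sets of points in the plane with |R| = n and |B| = n or |B| = n - 1, where n ≥ 1. If neither R nor B is collinear, then the set P = R ∪ B determines at least |P| - 1 bichromatic lines. -/
open scoped Classical

noncomputable section

/-- A line in the plane: the affine span of two distinct points. -/
def IsLine (L : Set (ℝ × ℝ)) : Prop :=
  ∃ p q : ℝ × ℝ, p ≠ q ∧ L = (affineSpan ℝ ({p, q} : Set (ℝ × ℝ)) : Set (ℝ × ℝ))

/-- The points of the finite set `P` lying on `L`. -/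
def ptsOn (P : Finset (ℝ × ℝ)) (L : Set (ℝ × ℝ)) : Finset (ℝ × ℝ) :=
  P.filter (fun x => x ∈ L)

/-- A line determined by `P`: contains at least two points of `P`. -/
def DeterminedLine (P : Finset (ℝ × ℝ)) (L : Set (ℝ × ℝ)) : Prop :=
  IsLine L ∧ 2 ≤ (ptsOn P L).card

/-- A bichromatic line: determined by `R ∪ B`, with at least one red and one blue point. -/
def BichromaticLine (R B : Finset (ℝ × ℝ)) (L : Set (ℝ × ℝ)) : Prop :=
  DeterminedLine (R ∪ B) L ∧ (∃ p ∈ R, p ∈ L) ∧ (∃ p ∈ B, p ∈ L)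

/-- The number of bichromatic lines determined by `R ∪ B`. -/
def nBichromatic (R B : Finset (ℝ × ℝ)) : ℕ :=
  {L : Set (ℝ × ℝ) | BichromaticLine R B L}.ncard

/-- A near-pencil: some line contains all but exactly one of the points of `P`. -/
def NearPencil (P : Finset (ℝ × ℝ)) : Prop :=
  ∃ L : Set (ℝ × ℝ), IsLine L ∧ (ptsOn P L).card = P.card - 1

/-- The planar cross product. -/
def cr (a b : ℝ × ℝ) : ℝ := a.1 * b.2 - a.2 * b.1

/-- The line through `p` and `q` (when `p ≠ q`), given by an equation. -/
def ln (p q : ℝ × ℝ) : Set (ℝ × ℝ) := {z | cr (q - p) (z - p) = 0}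

theorem mem_ln {p q z : ℝ × ℝ} : z ∈ ln p q ↔ cr (q - p) (z - p) = 0 := Iff.rfl

theorem left_mem_ln (p q : ℝ × ℝ) : p ∈ ln p q := by simp [mem_ln, cr]

theorem right_mem_ln (p q : ℝ × ℝ) : q ∈ ln p q := by simp [mem_ln, cr]; ring

theorem exists_smul_of_cr_eq_zero {a b : ℝ × ℝ} (ha : a ≠ 0) (h : cr a b = 0) :
    ∃ t : ℝ, b = t • a := by
  have hn : a.1 ^ 2 + a.2 ^ 2 ≠ 0 := by
    intro h0
    apply ha
    have h1 : a.1 = 0 := by nlinarith [sq_nonneg a.1, sq_nonneg a.2]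
    have h2 : a.2 = 0 := by nlinarith [sq_nonneg a.1, sq_nonneg a.2]
    exact Prod.ext h1 h2
  refine ⟨(a.1 * b.1 + a.2 * b.2) / (a.1 ^ 2 + a.2 ^ 2), ?_⟩
  simp only [cr] at h
  ext
  · simp only [Prod.smul_fst, smul_eq_mul]; field_simp; linear_combination (-a.2) * h
  · simp only [Prod.smul_snd, smul_eq_mul]; field_simp; linear_combination a.1 * h

theorem affineSpan_pair_eq_ln {p q : ℝ × ℝ} (h : p ≠ q) :
    (affineSpan ℝ ({p, q} : Set (ℝ × ℝ)) : Set (ℝ × ℝ)) = ln p q := by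
  ext z
  rw [SetLike.mem_coe, mem_affineSpan_pair_iff_exists_lineMap_eq, mem_ln]
  constructor
  · rintro ⟨t, rfl⟩
    simp [AffineMap.lineMap_apply, cr]; ring
  · intro hz
    obtain ⟨t, ht⟩ := exists_smul_of_cr_eq_zero (sub_ne_zero.2 h.symm) hz
    exact ⟨t, by rw [AffineMap.lineMap_apply, vsub_eq_sub, ← ht]; simp⟩

theorem isLine_iff {L : Set (ℝ × ℝ)} : IsLine L ↔ ∃ p q, p ≠ q ∧ L = ln p q := by
  constructor <;> rintro ⟨p, q, h, rfl⟩ <;> exact ⟨p, q, h, by rw [affineSpan_pair_eq_ln h]⟩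

theorem isLine_ln {p q : ℝ × ℝ} (h : p ≠ q) : IsLine (ln p q) := isLine_iff.2 ⟨p, q, h, rfl⟩

theorem IsLine.eq_ln {L : Set (ℝ × ℝ)} (hL : IsLine L) {a b : ℝ × ℝ} (ha : a ∈ L) (hb : b ∈ L)
    (hab : a ≠ b) : L = ln a b := by
  obtain ⟨p, q, hpq, rfl⟩ := isLine_iff.1 hL
  obtain ⟨s, hs⟩ := exists_smul_of_cr_eq_zero (sub_ne_zero.2 hpq.symm) ha
  obtain ⟨t, ht⟩ := exists_smul_of_cr_eq_zero (sub_ne_zero.2 hpq.symm) hb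
  have hst : t - s ≠ 0 := by
    intro h0
    apply hab
    have : t = s := by linarith
    rw [this, ← hs] at ht
    exact (sub_left_injective ht).symm
  have ha' : a = p + s • (q - p) := by rw [← hs]; abel
  have hb' : b = p + t • (q - p) := by rw [← ht]; abel
  ext z
  rw [mem_ln, mem_ln]
  have : cr (b - a) (z - a) = (t - s) * cr (q - p) (z - p) := by
    rw [ha', hb']; simp [cr]; ring
  rw [this, mul_eq_zero, or_iff_right hst]

theorem IsLine.eq_of_mem {L M : Set (ℝ × ℝ)} (hL : IsLine L) (hM : IsLine M) {a b : ℝ × ℝ}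
    (hab : a ≠ b) (haL : a ∈ L) (hbL : b ∈ L) (haM : a ∈ M) (hbM : b ∈ M) : L = M := by
  rw [hL.eq_ln haL hbL hab, hM.eq_ln haM hbM hab]

/-- No line contains all points of `P`. -/
def NC (P : Finset (ℝ × ℝ)) : Prop := ∀ L, IsLine L → ∃ p ∈ P, p ∉ L

theorem NC.mono {P Q : Finset (ℝ × ℝ)} (h : NC P) (hPQ : P ⊆ Q) : NC Q := fun L hL => by
  obtain ⟨p, hp, h'⟩ := h L hL
  exact ⟨p, hPQ hp, h'⟩

theorem NC.of_not_collinear {P : Finset (ℝ × ℝ)} (h : ¬ Collinear ℝ (P : Set (ℝ × ℝ))) :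
    NC P := by
  intro L hL
  obtain ⟨p, q, hpq, rfl⟩ := isLine_iff.1 hL
  by_contra! hc
  refine h ((collinear_iff_exists_forall_eq_smul_vadd _).2 ⟨p, q - p, fun z hz => ?_⟩)
  obtain ⟨t, ht⟩ := exists_smul_of_cr_eq_zero (sub_ne_zero.2 hpq.symm) (hc z hz)
  exact ⟨t, by rw [← ht]; simp⟩

theorem NC.three_le_card {P : Finset (ℝ × ℝ)} (h : NC P) : 3 ≤ P.card := by
  obtain ⟨a, ha, -⟩ := h (ln (0, 0) (0, 1)) (isLine_ln (by simp))
  obtain ⟨b, hb, hb'⟩ := h (ln a (a + (0, 1))) (isLine_ln (by simp))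
  have hab : a ≠ b := by rintro rfl; exact hb' (left_mem_ln _ _)
  obtain ⟨c, hc, hc'⟩ := h (ln a b) (isLine_ln hab)
  refine (Finset.two_lt_card).2 ⟨a, ha, b, hb, c, hc, hab, ?_, ?_⟩
  · rintro rfl; exact hc' (left_mem_ln _ _)
  · rintro rfl; exact hc' (right_mem_ln _ _)

theorem mem_ptsOn {P : Finset (ℝ × ℝ)} {L : Set (ℝ × ℝ)} {z : ℝ × ℝ} :
    z ∈ ptsOn P L ↔ z ∈ P ∧ z ∈ L := by simp [ptsOn]

/-- Two distinct lines share at most one point of a finite set. -/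
theorem card_ptsOn_ptsOn_le_one (P : Finset (ℝ × ℝ)) {L M : Set (ℝ × ℝ)} (hL : IsLine L)
    (hM : IsLine M) (hLM : L ≠ M) : (ptsOn (ptsOn P L) M).card ≤ 1 := by
  rw [Finset.card_le_one]
  intro a ha b hb
  rw [mem_ptsOn, mem_ptsOn] at ha hb
  by_contra hab
  exact hLM (hL.eq_of_mem hM hab ha.1.2 hb.1.2 ha.2 hb.2)

/-- The finite set of lines joining a point of `R` to a different point of `B`. -/
def joins (R B : Finset (ℝ × ℝ)) : Finset (Set (ℝ × ℝ)) :=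
  ((R ×ˢ B).filter (fun x => x.1 ≠ x.2)).image (fun x => ln x.1 x.2)

theorem mem_joins {R B : Finset (ℝ × ℝ)} {L : Set (ℝ × ℝ)} :
    L ∈ joins R B ↔ IsLine L ∧ ∃ p ∈ R, ∃ q ∈ B, p ≠ q ∧ p ∈ L ∧ q ∈ L := by
  simp only [joins, Finset.mem_image, Finset.mem_filter, Finset.mem_product]
  constructor
  · rintro ⟨⟨p, q⟩, ⟨⟨hp, hq⟩, hpq⟩, rfl⟩
    exact ⟨isLine_ln hpq, p, hp, q, hq, hpq, left_mem_ln _ _, right_mem_ln _ _⟩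
  · rintro ⟨hL, p, hp, q, hq, hpq, hpL, hqL⟩
    exact ⟨(p, q), ⟨⟨hp, hq⟩, hpq⟩, (hL.eq_ln hpL hqL hpq).symm⟩

theorem isLine_of_mem_joins {R B : Finset (ℝ × ℝ)} {L : Set (ℝ × ℝ)} (h : L ∈ joins R B) :
    IsLine L := (mem_joins.1 h).1

theorem ln_mem_joins {R B : Finset (ℝ × ℝ)} {p q : ℝ × ℝ} (hp : p ∈ R) (hq : q ∈ B)
    (hpq : p ≠ q) : ln p q ∈ joins R B :=
  mem_joins.2 ⟨isLine_ln hpq, p, hp, q, hq, hpq, left_mem_ln _ _, right_mem_ln _ _⟩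

theorem joins_comm (R B : Finset (ℝ × ℝ)) : joins R B = joins B R := by
  ext L
  rw [mem_joins, mem_joins]
  constructor <;> rintro ⟨hL, p, hp, q, hq, h, h1, h2⟩ <;> exact ⟨hL, q, hq, p, hp, h.symm, h2, h1⟩

theorem joins_mono {R B R' B' : Finset (ℝ × ℝ)} (hR : R ⊆ R') (hB : B ⊆ B') :
    joins R B ⊆ joins R' B' := fun L hL => by
  obtain ⟨h, p, hp, q, hq, h'⟩ := mem_joins.1 hL
  exact mem_joins.2 ⟨h, p, hR hp, q, hB hq, h'⟩

theorem nBichromatic_eq {R B : Finset (ℝ × ℝ)} (hRB : Disjoint R B) :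
    nBichromatic R B = (joins R B).card := by
  have : {L : Set (ℝ × ℝ) | BichromaticLine R B L} = (joins R B : Set (Set (ℝ × ℝ))) := by
    ext L
    simp only [Set.mem_ofPred_eq, Finset.mem_coe, mem_joins, BichromaticLine, DeterminedLine]
    constructor
    · rintro ⟨⟨hL, -⟩, ⟨p, hp, hpL⟩, q, hq, hqL⟩
      exact ⟨hL, p, hp, q, hq, fun h => Finset.disjoint_left.1 hRB hp (h ▸ hq), hpL, hqL⟩
    · rintro ⟨hL, p, hp, q, hq, hpq, hpL, hqL⟩
      refine ⟨⟨hL, ?_⟩, ⟨p, hp, hpL⟩, q, hq, hqL⟩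
      exact Finset.one_lt_card.2 ⟨p, by simp [mem_ptsOn, hp, hpL], q,
        by simp [mem_ptsOn, hq, hqL], hpq⟩
  rw [nBichromatic, this, Set.ncard_coe_finset]

/-- Double counting of pairs in `X × Y` by the lines joining `R` and `B`. -/
theorem sum_joins {R B X Y : Finset (ℝ × ℝ)} (hX : X ⊆ R) (hY : Y ⊆ B) :
    ∑ L ∈ joins R B, (((ptsOn X L) ×ˢ (ptsOn Y L)).filter (fun x => x.1 ≠ x.2)).card =
      ((X ×ˢ Y).filter (fun x => x.1 ≠ x.2)).card := by
  rw [Finset.card_eq_sum_card_fiberwise (f := fun x => ln x.1 x.2) (t := joins R B)]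
  · refine Finset.sum_congr rfl fun L hL => congrArg _ ?_
    ext ⟨p, q⟩
    simp only [Finset.mem_filter, Finset.mem_product, mem_ptsOn]
    constructor
    · rintro ⟨⟨⟨hp, hpL⟩, hq, hqL⟩, hpq⟩
      exact ⟨⟨⟨hp, hq⟩, hpq⟩, ((isLine_of_mem_joins hL).eq_ln hpL hqL hpq).symm⟩
    · rintro ⟨⟨⟨hp, hq⟩, hpq⟩, rfl⟩
      exact ⟨⟨⟨hp, left_mem_ln _ _⟩, hq, right_mem_ln _ _⟩, hpq⟩
  · rintro ⟨p, q⟩ h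
    simp only [Finset.coe_filter, Finset.mem_product, Set.mem_ofPred_eq] at h
    exact ln_mem_joins (hX h.1.1) (hY h.1.2) h.2

theorem sum_joins_of_disjoint {R B X Y : Finset (ℝ × ℝ)} (hRB : Disjoint R B) (hX : X ⊆ R)
    (hY : Y ⊆ B) :
    ∑ L ∈ joins R B, (ptsOn X L).card * (ptsOn Y L).card = X.card * Y.card := by
  have key : ∀ X' Y' : Finset (ℝ × ℝ), X' ⊆ R → Y' ⊆ B →
      (X' ×ˢ Y').filter (fun x => x.1 ≠ x.2) = X' ×ˢ Y' := by
    intro X' Y' h1 h2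
    refine Finset.filter_true_of_mem ?_
    rintro ⟨p, q⟩ h
    rw [Finset.mem_product] at h
    exact fun e => Finset.disjoint_left.1 hRB (h1 h.1) (by rw [show p = q from e]; exact h2 h.2)
  have h := sum_joins hX hY
  rw [key X Y hX hY, Finset.card_product] at h
  rw [← h]
  refine Finset.sum_congr rfl fun L _ => ?_
  rw [key (ptsOn X L) (ptsOn Y L) ((Finset.filter_subset _ _).trans hX)
    ((Finset.filter_subset _ _).trans hY), Finset.card_product]

theorem sum_joins_self {P X : Finset (ℝ × ℝ)} (hX : X ⊆ P) :
    ∑ L ∈ joins P P, ((ptsOn X L).card * (ptsOn X L).card - (ptsOn X L).card) =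
      X.card * X.card - X.card := by
  have h := sum_joins hX hX
  have key : ∀ X' : Finset (ℝ × ℝ), (X' ×ˢ X').filter (fun x => x.1 ≠ x.2) = X'.offDiag := by
    intro X'; ext; simp [and_assoc]
  simpa only [key, Finset.offDiag_card] using h

/-- The standard dot product on the plane. -/
def dt (a b : ℝ × ℝ) : ℝ := a.1 * b.1 + a.2 * b.2

theorem dt_self_pos {a : ℝ × ℝ} (h : a ≠ 0) : 0 < dt a a := by
  rcases ne_or_eq a.1 0 with h1 | h1
  · have := mul_self_pos.2 h1
    simp only [dt]; nlinarith [mul_self_nonneg a.2]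
  · have := mul_self_pos.2 (fun h2 => h (Prod.ext h1 h2) : a.2 ≠ 0)
    simp only [dt]; nlinarith [mul_self_nonneg a.1]

theorem IsLine.exists_direction {L : Set (ℝ × ℝ)} (hL : IsLine L) :
    ∃ w : ℝ × ℝ, w ≠ 0 ∧ ∀ a ∈ L, ∀ z, z ∈ L ↔ cr w (z - a) = 0 := by
  obtain ⟨p, q, hpq, rfl⟩ := isLine_iff.1 hL
  refine ⟨q - p, sub_ne_zero.2 hpq.symm, fun a ha z => ?_⟩
  rw [mem_ln] at ha ⊢
  have : cr (q - p) (z - a) = cr (q - p) (z - p) - cr (q - p) (a - p) := by simp [cr]; ring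
  rw [this, ha, sub_zero]

/-- A direction vector of a line. -/
def dr (L : Set (ℝ × ℝ)) : ℝ × ℝ :=
  if h : IsLine L then h.exists_direction.choose else 0

theorem IsLine.dr_ne_zero {L : Set (ℝ × ℝ)} (hL : IsLine L) : dr L ≠ 0 := by
  rw [dr, dif_pos hL]; exact hL.exists_direction.choose_spec.1

theorem IsLine.mem_iff {L : Set (ℝ × ℝ)} (hL : IsLine L) {a : ℝ × ℝ} (ha : a ∈ L) (z : ℝ × ℝ) :
    z ∈ L ↔ cr (dr L) (z - a) = 0 := by
  rw [dr, dif_pos hL]; exact hL.exists_direction.choose_spec.2 a ha z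

theorem IsLine.exists_smul {L : Set (ℝ × ℝ)} (hL : IsLine L) {a b : ℝ × ℝ} (ha : a ∈ L)
    (hb : b ∈ L) : ∃ t : ℝ, b - a = t • dr L :=
  exists_smul_of_cr_eq_zero hL.dr_ne_zero ((hL.mem_iff ha b).1 hb)

/-- The direction of a line with a chosen orientation. -/
def sd (x : Set (ℝ × ℝ) × Bool) : ℝ × ℝ := if x.2 then dr x.1 else -dr x.1

theorem exists_sd {L : Set (ℝ × ℝ)} (hL : IsLine L) {a : ℝ × ℝ} (ha : a ∈ L) {w : ℝ × ℝ}
    (hw : w ≠ 0) (hb : a + w ∈ L) : ∃ e : Bool, ∃ c : ℝ, 0 < c ∧ sd (L, e) = c • w := by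
  obtain ⟨t, ht⟩ := hL.exists_smul ha hb
  rw [add_sub_cancel_left] at ht
  have ht0 : t ≠ 0 := by rintro rfl; simp [hw] at ht
  rcases lt_or_gt_of_ne ht0 with h | h
  · refine ⟨false, -t⁻¹, by rw [neg_pos]; exact inv_lt_zero.2 h, ?_⟩
    rw [ht, smul_smul, neg_mul, inv_mul_cancel₀ ht0]; simp [sd]
  · refine ⟨true, t⁻¹, inv_pos.2 h, ?_⟩
    rw [ht, smul_smul, inv_mul_cancel₀ ht0]; simp [sd]

theorem cr_smul_left (c : ℝ) (a b : ℝ × ℝ) : cr (c • a) b = c * cr a b := by simp [cr]; ring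

theorem dt_smul_left (c : ℝ) (a b : ℝ × ℝ) : dt (c • a) b = c * dt a b := by simp [dt]; ring

theorem cr_sub_sub (w a b c : ℝ × ℝ) : cr w (a - b) = cr w (a - c) - cr w (b - c) := by
  simp [cr]; ring

theorem dt_sub_sub (w a b c : ℝ × ℝ) : dt w (a - b) = dt w (a - c) - dt w (b - c) := by
  simp [dt]; ring

theorem eq_of_cr_dt {w a b : ℝ × ℝ} (hw : w ≠ 0) (h1 : cr w (a - b) = 0) (h2 : dt w (a - b) = 0) :
    a = b := by
  obtain ⟨t, ht⟩ := exists_smul_of_cr_eq_zero hw h1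
  have : t = 0 := by
    have h3 : dt w (t • w) = t * dt w w := by simp [dt]; ring
    rw [ht, h3] at h2
    exact (mul_eq_zero.1 h2).resolve_right (dt_self_pos hw).ne'
  rw [this, zero_smul] at ht
  exact sub_eq_zero.1 ht

/-- `x` is the last point of `P` in direction `w` on its parallel to `w`, `y` is the first point
on its parallel, and there is no point of `P` strictly between these two parallels. -/
def Tight (P : Finset (ℝ × ℝ)) (w x y : ℝ × ℝ) : Prop :=
  0 < cr w (y - x) ∧ (∀ z ∈ P, cr w (z - x) = 0 → dt w (z - x) ≤ 0) ∧
    (∀ z ∈ P, cr w (z - y) = 0 → 0 ≤ dt w (z - y)) ∧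
    ∀ z ∈ P, 0 < cr w (z - x) → cr w (y - x) ≤ cr w (z - x)

theorem Tight.smul {P : Finset (ℝ × ℝ)} {w x y : ℝ × ℝ} (h : Tight P w x y) {c : ℝ} (hc : 0 < c) :
    Tight P (c • w) x y := by
  obtain ⟨h1, h2, h3, h4⟩ := h
  simp only [Tight, cr_smul_left, dt_smul_left]
  refine ⟨by positivity, fun z hz h => ?_, fun z hz h => ?_, fun z hz h => ?_⟩
  · exact mul_nonpos_of_nonneg_of_nonpos hc.le
      (h2 z hz ((mul_eq_zero.1 h).resolve_left hc.ne'))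
  · exact mul_nonneg hc.le (h3 z hz ((mul_eq_zero.1 h).resolve_left hc.ne'))
  · exact mul_le_mul_of_nonneg_left (h4 z hz ((mul_pos_iff_of_pos_left hc).1 h)) hc.le

theorem Tight.unique {P : Finset (ℝ × ℝ)} {w x y x' y' : ℝ × ℝ} (hw : w ≠ 0) (hx : x ∈ P)
    (hy : y ∈ P) (hx' : x' ∈ P) (hy' : y' ∈ P) (h : Tight P w x y) (h' : Tight P w x' y')
    (hxx : cr w (x' - x) = 0) : x = x' ∧ y = y' := by
  obtain ⟨h1, h2, h3, h4⟩ := h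
  obtain ⟨h1', h2', h3', h4'⟩ := h'
  have e1 : cr w (x - x') = - cr w (x' - x) := by simp [cr]; ring
  have e2 : dt w (x - x') = - dt w (x' - x) := by simp [dt]; ring
  have hx0 : x' = x := by
    refine eq_of_cr_dt hw hxx ?_
    have a1 := h2 x' hx' hxx
    have a2 := h2' x hx (by rw [e1, hxx, neg_zero])
    linarith
  subst hx0
  refine ⟨rfl, ?_⟩
  have a1 := h4 y' hy' h1'
  have a2 := h4' y hy h1
  have e3 := cr_sub_sub w y' y x'
  have e4 := cr_sub_sub w y y' x'
  have e5 : dt w (y - y') = - dt w (y' - y) := by simp [dt]; ring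
  have a3 := h3 y' hy' (by linarith)
  have a4 := h3' y hy (by linarith)
  exact eq_of_cr_dt hw (by linarith) (by linarith)

theorem Tight.neg {P : Finset (ℝ × ℝ)} {w x y : ℝ × ℝ} (h : Tight P w x y) :
    Tight P (-w) y x := by
  obtain ⟨h1, h2, h3, h4⟩ := h
  have e1 : ∀ v, cr (-w) v = - cr w v := fun v => by simp [cr]; ring
  have e2 : ∀ v, dt (-w) v = - dt w v := fun v => by simp [dt]; ring
  have e3 : cr w (x - y) = - cr w (y - x) := by simp [cr]; ring
  simp only [Tight, e1, e2, e3, neg_neg]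
  refine ⟨h1, fun z hz h => ?_, fun z hz h => ?_, fun z hz h => ?_⟩
  · linarith [h3 z hz (by linarith)]
  · linarith [h2 z hz (by linarith)]
  · by_contra! hc
    have := cr_sub_sub w z y x
    linarith [h4 z hz (by linarith)]

/-- Rotating the direction at two consecutive points of a line until a further point is met. -/
theorem exists_tight {P : Finset (ℝ × ℝ)} (hP : NC P) {x y : ℝ × ℝ} (hx : x ∈ P) (hy : y ∈ P)
    (hxy : x ≠ y)
    (hc : ∀ z ∈ P, cr (y - x) (z - x) = 0 → 0 < dt (y - x) (z - x) →
      dt (y - x) (y - x) ≤ dt (y - x) (z - x)) :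
    ∃ w : ℝ × ℝ, w ≠ 0 ∧ (((∃ z ∈ P, z ≠ x ∧ cr w (z - x) = 0) ∧ Tight P w x y) ∨
      ((∃ z ∈ P, z ≠ y ∧ cr w (z - y) = 0) ∧ Tight P w y x)) := by
  set u := y - x with hu
  have hu0 : u ≠ 0 := sub_ne_zero.2 hxy.symm
  have huu := dt_self_pos hu0
  obtain ⟨z0, hz0, hz0'⟩ := hP _ (isLine_ln hxy)
  rw [mem_ln, ← hu] at hz0'
  obtain ⟨⟨zm, bm⟩, hm, hmax⟩ := Finset.exists_max_image
    ((P.filter (fun z => cr u (z - x) ≠ 0)) ×ˢ ({x, y} : Finset (ℝ × ℝ)))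
    (fun a => dt u (a.1 - a.2) / cr u (a.1 - x)) ⟨(z0, x), by simp [hz0, hz0']⟩
  simp only [Finset.mem_product, Finset.mem_filter, Finset.mem_insert, Finset.mem_singleton] at hm
  obtain ⟨⟨hzm, hcm⟩, hbm⟩ := hm
  set μ := dt u (zm - bm) / cr u (zm - x) with hμ
  have hpos : ∀ z ∈ P, 0 < cr u (z - x) → dt u (z - x) ≤ μ * cr u (z - x) := fun z hz h => by
    have := hmax (z, x) (by simp [hz, h.ne'])
    simpa only using (div_le_iff₀ h).1 this
  have hneg : ∀ z ∈ P, cr u (z - x) < 0 → μ * cr u (z - x) ≤ dt u (z - x) - dt u u :=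
    fun z hz h => by
      have := hmax (z, y) (by simp [hz, h.ne])
      have h2 := (div_le_iff_of_neg h).1 this
      have h3 : dt u (z - y) = dt u (z - x) - dt u u := by rw [dt_sub_sub u z y x]
      simp only at h2
      linarith
  have hzero : ∀ z ∈ P, cr u (z - x) = 0 → dt u (z - x) ≤ 0 ∨ dt u u ≤ dt u (z - x) :=
    fun z hz h => by
      rcases le_or_gt (dt u (z - x)) 0 with h' | h'
      · exact Or.inl h'
      · exact Or.inr (hc z hz h h')
  have hmeq : dt u (zm - bm) = μ * cr u (zm - x) := by rw [hμ, div_mul_cancel₀ _ hcm]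
  have hyx : cr u (y - x) = 0 := by rw [← hu]; simp [cr]; ring
  have hyx' : dt u (y - x) = dt u u := by rw [← hu]
  set w : ℝ × ℝ := (u.2 - μ * u.1, -u.1 - μ * u.2) with hw
  have e1 : ∀ v, cr w v = dt u v - μ * cr u v := fun v => by simp [cr, dt, hw]; ring
  have e2 : ∀ v, dt w v = - μ * dt u v - cr u v := fun v => by simp [cr, dt, hw]; ring
  have hT : Tight P w x y := by
    have e3 : ∀ z, dt u (z - y) = dt u (z - x) - dt u u := fun z => by rw [dt_sub_sub u z y x]
    have e4 : ∀ z, cr u (z - y) = cr u (z - x) := fun z => by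
      rw [cr_sub_sub u z y x, hyx, sub_zero]
    simp only [Tight, e1, e2, e3, e4, hyx, hyx']
    refine ⟨by linarith, fun z hz h => ?_, fun z hz h => ?_, fun z hz h => ?_⟩
    · have hd : dt u (z - x) = μ * cr u (z - x) := by linarith
      rcases lt_trichotomy (cr u (z - x)) 0 with h' | h' | h'
      · linarith [hneg z hz h']
      · rw [hd, h']; simp
      · rw [hd]; nlinarith [mul_nonneg (sq_nonneg μ) h'.le]
    · have hd : dt u (z - x) - dt u u = μ * cr u (z - x) := by linarith
      rcases lt_trichotomy (cr u (z - x)) 0 with h' | h' | h'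
      · rw [hd]; nlinarith [mul_nonneg (sq_nonneg μ) (neg_pos.2 h').le]
      · rw [hd, h']; simp
      · linarith [hpos z hz h']
    · rcases lt_trichotomy (cr u (z - x)) 0 with h' | h' | h'
      · linarith [hneg z hz h']
      · rcases hzero z hz h' with h'' | h'' <;> rw [h'] at h ⊢ <;> linarith
      · linarith [hpos z hz h']
  have hw0 : w ≠ 0 := by
    intro h0
    have := hT.1
    rw [h0] at this
    simp [cr] at this
  rcases hbm with rfl | rfl
  · exact ⟨w, hw0, Or.inl ⟨⟨zm, hzm, by rintro rfl; simp [cr] at hcm, by rw [e1]; linarith⟩, hT⟩⟩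
  · refine ⟨-w, neg_ne_zero.2 hw0, Or.inr ⟨⟨zm, hzm, by rintro rfl; exact hcm hyx, ?_⟩, hT.neg⟩⟩
    have e4 : cr u (zm - bm) = cr u (zm - x) := by rw [cr_sub_sub u zm bm x, hyx, sub_zero]
    have : cr (-w) (zm - bm) = - cr w (zm - bm) := by simp [cr]; ring
    rw [this, e1, e4]; linarith

/-- Points of `P` on `L` that are not the last one in direction `dr L`. -/
def nonlast (P : Finset (ℝ × ℝ)) (L : Set (ℝ × ℝ)) : Finset (ℝ × ℝ) :=
  (ptsOn P L).filter (fun x => ∃ y ∈ ptsOn P L, 0 < dt (dr L) (y - x))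

theorem card_ptsOn_le_nonlast (P : Finset (ℝ × ℝ)) {L : Set (ℝ × ℝ)} (hL : IsLine L) :
    (ptsOn P L).card ≤ (nonlast P L).card + 1 := by
  rw [nonlast, ← Finset.card_filter_add_card_filter_not (s := ptsOn P L)
    (fun x => ∃ y ∈ ptsOn P L, 0 < dt (dr L) (y - x))]
  refine Nat.add_le_add_left (Finset.card_le_one.2 fun a ha b hb => ?_) _
  rw [Finset.mem_filter] at ha hb
  obtain ⟨ha, ha'⟩ := ha
  obtain ⟨hb, hb'⟩ := hb
  push Not at ha' hb'
  have h1 := ha' b hb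
  have h2 := hb' a ha
  rw [mem_ptsOn] at ha hb
  have : dt (dr L) (b - a) = - dt (dr L) (a - b) := by simp [dt]; ring
  exact eq_of_cr_dt hL.dr_ne_zero ((hL.mem_iff hb.2 a).1 ha.2) (by linarith)

/-- The pair formed by `x` and its successor on `L` is attached to the oriented line `S`. -/
def Attached (P : Finset (ℝ × ℝ)) (L : Set (ℝ × ℝ)) (x : ℝ × ℝ) (S : Set (ℝ × ℝ) × Bool) : Prop :=
  ∃ y ∈ P, x ∈ P ∧ x ∈ L ∧ y ∈ L ∧ 0 < dt (dr L) (y - x) ∧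
    ((x ∈ S.1 ∧ Tight P (sd S) x y) ∨ (y ∈ S.1 ∧ Tight P (sd S) y x))

/-- No point of `P` lies strictly to the left of the oriented line. -/
def LeftFree (P : Finset (ℝ × ℝ)) (S : Set (ℝ × ℝ) × Bool) : Prop :=
  ∀ a ∈ S.1, ∀ z ∈ P, cr (sd S) (z - a) ≤ 0

theorem sd_ne_zero {S : Set (ℝ × ℝ) × Bool} (hL : IsLine S.1) : sd S ≠ 0 := by
  rw [sd]; split_ifs
  · exact hL.dr_ne_zero
  · exact neg_ne_zero.2 hL.dr_ne_zero

theorem cr_sd_eq_zero {S : Set (ℝ × ℝ) × Bool} (hL : IsLine S.1) {a b : ℝ × ℝ} (ha : a ∈ S.1)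
    (hb : b ∈ S.1) : cr (sd S) (b - a) = 0 := by
  have h := (hL.mem_iff ha b).1 hb
  rw [sd]; split_ifs
  · exact h
  · have : ∀ v, cr (-dr S.1) v = - cr (dr S.1) v := fun v => by simp [cr]; ring
    rw [this, h, neg_zero]

theorem Attached.unique {P : Finset (ℝ × ℝ)} {L L' : Set (ℝ × ℝ)} {x x' : ℝ × ℝ}
    {S : Set (ℝ × ℝ) × Bool} (hS : IsLine S.1) (hL : IsLine L) (hL' : IsLine L')
    (h : Attached P L x S) (h' : Attached P L' x' S) : L = L' ∧ x = x' := by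
  obtain ⟨y, hy, hx, hxL, hyL, ho, h⟩ := h
  obtain ⟨y', hy', hx', hxL', hyL', ho', h'⟩ := h'
  have hne : x ≠ y := by rintro rfl; simp [dt] at ho
  have key : ∀ L L' : Set (ℝ × ℝ), IsLine L → IsLine L' → x ∈ L → y ∈ L → x ∈ L' → y ∈ L' →
    L = L' := fun L L' a b c d e f => a.eq_of_mem b hne c d e f
  have hw := sd_ne_zero hS
  have hneg : ∀ w, dt w (x - y) = - dt w (y - x) := fun w => by simp [dt]; ring
  rcases h with ⟨hs, h⟩ | ⟨hs, h⟩ <;> rcases h' with ⟨hs', h'⟩ | ⟨hs', h'⟩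
  · obtain ⟨rfl, rfl⟩ := Tight.unique hw hx hy hx' hy' h h' (cr_sd_eq_zero hS hs hs')
    exact ⟨key L L' hL hL' hxL hyL hxL' hyL', rfl⟩
  · obtain ⟨rfl, rfl⟩ := Tight.unique hw hx hy hy' hx' h h' (cr_sd_eq_zero hS hs hs')
    have := key L L' hL hL' hxL hyL hyL' hxL'
    subst this
    rw [hneg] at ho'; linarith
  · obtain ⟨rfl, rfl⟩ := Tight.unique hw hy hx hx' hy' h h' (cr_sd_eq_zero hS hs hs')
    have := key L L' hL hL' hxL hyL hyL' hxL'
    subst this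
    rw [hneg] at ho'; linarith
  · obtain ⟨rfl, rfl⟩ := Tight.unique hw hy hx hy' hx' h h' (cr_sd_eq_zero hS hs hs')
    exact ⟨key L L' hL hL' hxL hyL hxL' hyL', rfl⟩

theorem add_mem_of_cr {a z w : ℝ × ℝ} (h : cr w (z - a) = 0) :
    a + w ∈ ln a z := by
  rw [mem_ln, add_sub_cancel_left]
  simp only [cr] at h ⊢; linarith

theorem exists_attached {P : Finset (ℝ × ℝ)} (hP : NC P) {L : Set (ℝ × ℝ)} (hL : L ∈ joins P P)
    {x : ℝ × ℝ} (hx : x ∈ nonlast P L) :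
    ∃ S ∈ (joins P P) ×ˢ (Finset.univ : Finset Bool), ¬ LeftFree P S ∧ Attached P L x S := by
  have hLl := isLine_of_mem_joins hL
  simp only [nonlast, Finset.mem_filter] at hx
  obtain ⟨hx, y0, hy0, hy0'⟩ := hx
  rw [mem_ptsOn] at hx
  obtain ⟨y, hy, hmin⟩ := Finset.exists_min_image
    ((ptsOn P L).filter (fun y => 0 < dt (dr L) (y - x))) (fun y => dt (dr L) (y - x))
    ⟨y0, by simp [hy0, hy0']⟩
  simp only [Finset.mem_filter, mem_ptsOn] at hy hmin
  obtain ⟨⟨hyP, hyL⟩, hpos⟩ := hy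
  have hxy : x ≠ y := by rintro rfl; simp [dt] at hpos
  obtain ⟨t, ht⟩ := hLl.exists_smul hx.2 hyL
  have hww := dt_self_pos hLl.dr_ne_zero
  have ht0 : 0 < t := by
    rw [ht] at hpos
    have : dt (dr L) (t • dr L) = t * dt (dr L) (dr L) := by simp [dt]; ring
    rw [this] at hpos
    exact (mul_pos_iff_of_pos_right hww).1 hpos
  obtain ⟨w, hw0, hw⟩ := exists_tight hP hx.1 hyP hxy (fun z hz h1 h2 => by
    have hzL : z ∈ L := by
      rw [hLl.mem_iff hx.2]
      rw [ht, cr_smul_left] at h1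
      exact (mul_eq_zero.1 h1).resolve_left ht0.ne'
    have h3 : dt (y - x) (z - x) = t * dt (dr L) (z - x) := by rw [ht, dt_smul_left]
    have h4 : dt (y - x) (y - x) = t * dt (dr L) (y - x) := by
      conv_lhs => rw [ht]
      rw [dt_smul_left, ← ht]
    rw [h3] at h2 ⊢
    rw [h4]
    exact mul_le_mul_of_nonneg_left
      (hmin z ⟨⟨hz, hzL⟩, (mul_pos_iff_of_pos_left ht0).1 h2⟩) ht0.le)
  have main : ∀ a b, a ∈ P → b ∈ P → (∃ z ∈ P, z ≠ a ∧ cr w (z - a) = 0) → Tight P w a b →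
      ∃ S ∈ (joins P P) ×ˢ (Finset.univ : Finset Bool), ¬ LeftFree P S ∧ a ∈ S.1 ∧
        Tight P (sd S) a b := by
    rintro a b ha hb ⟨z, hz, hza, hz0⟩ hT
    obtain ⟨e, c, hc, he⟩ := exists_sd (isLine_ln hza.symm) (left_mem_ln a z) hw0
      (add_mem_of_cr hz0)
    have hT' : Tight P (sd (ln a z, e)) a b := by rw [he]; exact hT.smul hc
    exact ⟨(ln a z, e), by simp [ln_mem_joins ha hz hza.symm],
      fun hv => (hv a (left_mem_ln a z) b hb).not_gt hT'.1, left_mem_ln a z, hT'⟩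
  rcases hw with ⟨hz, hT⟩ | ⟨hz, hT⟩
  · obtain ⟨S, hS, hv, h1, h2⟩ := main x y hx.1 hyP hz hT
    exact ⟨S, hS, hv, y, hyP, hx.1, hx.2, hyL, hpos, Or.inl ⟨h1, h2⟩⟩
  · obtain ⟨S, hS, hv, h1, h2⟩ := main y x hyP hx.1 hz hT
    exact ⟨S, hS, hv, y, hyP, hx.1, hx.2, hyL, hpos, Or.inr ⟨h1, h2⟩⟩

/-- `q` is the last point in direction `u` of the supporting parallel to `u` of `P`. -/
def Support (P : Finset (ℝ × ℝ)) (u q : ℝ × ℝ) : Prop :=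
  q ∈ P ∧ ∀ z ∈ P, 0 < cr u (z - q) ∨ cr u (z - q) = 0 ∧ dt u (z - q) ≤ 0

theorem exists_support {P : Finset (ℝ × ℝ)} (hP : P.Nonempty) (u : ℝ × ℝ) :
    ∃ q, Support P u q := by
  obtain ⟨a, ha, hmin⟩ := Finset.exists_min_image P (fun z => cr u z) hP
  obtain ⟨q, hq, hmax⟩ := Finset.exists_max_image (P.filter (fun z => cr u z = cr u a))
    (fun z => dt u z) ⟨a, by simp [ha]⟩
  simp only [Finset.mem_filter] at hq hmax
  refine ⟨q, hq.1, fun z hz => ?_⟩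
  have e1 : cr u (z - q) = cr u z - cr u q := by simp [cr]; ring
  have e2 : dt u (z - q) = dt u z - dt u q := by simp [dt]; ring
  rw [e1, e2]
  rcases (hmin z hz).lt_or_eq with h | h
  · left; linarith
  · right; exact ⟨by linarith, by linarith [hmax z ⟨hz, h.symm⟩]⟩

theorem Support.next {P : Finset (ℝ × ℝ)} (hP : NC P) {u q : ℝ × ℝ} (hu : u ≠ 0)
    (h : Support P u q) :
    ∃ w q', Support P w q' ∧ 0 < cr u w ∧ q' ≠ q ∧ cr w (q' - q) = 0 ∧
      ∀ z ∈ P, 0 ≤ cr w (z - q) := by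
  obtain ⟨hq, h⟩ := h
  have huu := dt_self_pos hu
  obtain ⟨z0, hz0, hz0'⟩ := hP (ln q (q + u)) (isLine_ln (by simpa using hu))
  rw [mem_ln, add_sub_cancel_left] at hz0'
  have hz0p : 0 < cr u (z0 - q) := (h z0 hz0).resolve_right fun h => hz0' h.1
  obtain ⟨r, hr, hmax⟩ := Finset.exists_max_image (P.filter (fun z => 0 < cr u (z - q)))
    (fun z => dt u (z - q) / cr u (z - q)) ⟨z0, by simp [hz0, hz0p]⟩
  simp only [Finset.mem_filter] at hr hmax
  obtain ⟨hrP, hrp⟩ := hr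
  have key : ∀ z, dt u u * cr (r - q) (z - q) =
      dt u (r - q) * cr u (z - q) - cr u (r - q) * dt u (z - q) := fun z => by
    simp [dt, cr]; ring
  have hnn : ∀ z ∈ P, 0 ≤ cr (r - q) (z - q) := fun z hz => by
    have : 0 ≤ dt u u * cr (r - q) (z - q) := by
      rw [key]
      rcases h z hz with h1 | ⟨h1, h2⟩
      · have := hmax z ⟨hz, h1⟩
        rw [div_le_div_iff₀ h1 hrp] at this
        linarith
      · rw [h1]; nlinarith
    exact (mul_nonneg_iff_of_pos_left huu).1 this
  obtain ⟨q', hq'⟩ := exists_support ⟨q, hq⟩ (r - q)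
  have hrq : r - q ≠ 0 := by intro h0; rw [h0] at hrp; simp [cr] at hrp
  have hr0 := dt_self_pos hrq
  have e1 : cr (r - q) (q - q') = - cr (r - q) (q' - q) := by simp [cr]; ring
  have hz : cr (r - q) (q' - q) = 0 := by
    rcases hq'.2 q hq with h1 | ⟨h1, -⟩ <;> linarith [hnn q' hq'.1]
  refine ⟨r - q, q', hq', hrp, ?_, hz, hnn⟩
  rintro rfl
  rcases hq'.2 r hrP with h1 | ⟨-, h1⟩
  · simp [cr] at h1; linarith
  · linarith

theorem three_le_card_leftFree {P : Finset (ℝ × ℝ)} (hP : NC P) :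
    3 ≤ (((joins P P) ×ˢ (Finset.univ : Finset Bool)).filter (LeftFree P)).card := by
  have hne : P.Nonempty := Finset.card_pos.1 (by have := hP.three_le_card; omega)
  obtain ⟨q0, h0⟩ := exists_support hne (1, 0)
  obtain ⟨w1, q1, h1, c1, n1, e1, s1⟩ := h0.next hP (by simp)
  have hw1 : w1 ≠ 0 := by rintro rfl; simp [cr] at c1
  obtain ⟨w2, q2, h2, c2, n2, e2, s2⟩ := h1.next hP hw1
  have hw2 : w2 ≠ 0 := by rintro rfl; simp [cr] at c2
  obtain ⟨w3, q3, h3, c3, n3, e3, s3⟩ := h2.next hP hw2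
  have hw3 : w3 ≠ 0 := by rintro rfl; simp [cr] at c3
  have main : ∀ w a b, a ∈ P → b ∈ P → w ≠ 0 → b ≠ a → cr w (b - a) = 0 →
      (∀ z ∈ P, 0 ≤ cr w (z - a)) →
      ∃ e, (ln a b, e) ∈ ((joins P P) ×ˢ (Finset.univ : Finset Bool)).filter (LeftFree P) := by
    intro w a b ha hb hw hba hz hs
    have hn : cr (-w) (b - a) = 0 := by rw [← neg_one_smul ℝ w, cr_smul_left, hz, mul_zero]
    obtain ⟨e, c, hc, he⟩ := exists_sd (isLine_ln hba.symm) (left_mem_ln a b) (neg_ne_zero.2 hw)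
      (add_mem_of_cr hn)
    refine ⟨e, ?_⟩
    simp only [Finset.mem_filter, Finset.mem_product, Finset.mem_univ, and_true]
    refine ⟨ln_mem_joins ha hb hba.symm, fun x hx z hzP => ?_⟩
    have h5 := cr_sd_eq_zero (S := (ln a b, e)) (isLine_ln hba.symm) (left_mem_ln a b) hx
    rw [cr_sub_sub _ z x a, h5, sub_zero, he, cr_smul_left, ← neg_one_smul ℝ w, cr_smul_left]
    nlinarith [mul_nonneg hc.le (hs z hzP)]
  obtain ⟨f1, m1⟩ := main w1 q0 q1 h0.1 h1.1 hw1 n1 e1 s1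
  obtain ⟨f2, m2⟩ := main w2 q1 q2 h1.1 h2.1 hw2 n2 e2 s2
  obtain ⟨f3, m3⟩ := main w3 q2 q3 h2.1 h3.1 hw3 n3 e3 s3
  have off : ∀ w w' a b c : ℝ × ℝ, w ≠ 0 → b ≠ a → c ≠ b → 0 < cr w w' → cr w (b - a) = 0 →
      cr w' (c - b) = 0 → ln a b ≠ ln b c := by
    intro w w' a b c hw hba hcb hc h h' heq
    have hcm : c ∈ ln a b := heq ▸ right_mem_ln b c
    obtain ⟨t, ht⟩ := exists_smul_of_cr_eq_zero hw h
    have ht0 : t ≠ 0 := by rintro rfl; rw [zero_smul, sub_eq_zero] at ht; exact hba ht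
    have hw' : w' ≠ 0 := by rintro rfl; simp [cr] at hc
    obtain ⟨s, hs⟩ := exists_smul_of_cr_eq_zero hw' h'
    have hs0 : s ≠ 0 := by rintro rfl; rw [zero_smul, sub_eq_zero] at hs; exact hcb hs
    rw [mem_ln, show c - a = s • w' + t • w by rw [← ht, ← hs]; abel, ht] at hcm
    have : cr (t • w) (s • w' + t • w) = t * s * cr w w' := by simp [cr]; ring
    rw [this] at hcm
    exact (mul_ne_zero (mul_ne_zero ht0 hs0) hc.ne') hcm
  have d12 := off w1 w2 q0 q1 q2 hw1 n1 n2 c2 e1 e2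
  have d23 := off w2 w3 q1 q2 q3 hw2 n2 n3 c3 e2 e3
  have d13 : ln q0 q1 ≠ ln q2 q3 := fun h => d12 <|
    (isLine_ln n1.symm).eq_of_mem (isLine_ln n2.symm) n2.symm (right_mem_ln _ _)
      (h ▸ left_mem_ln _ _) (left_mem_ln _ _) (right_mem_ln _ _)
  exact Finset.two_lt_card.2 ⟨_, m1, _, m2, _, m3, fun h => d12 (congrArg Prod.fst h),
    fun h => d13 (congrArg Prod.fst h), fun h => d23 (congrArg Prod.fst h)⟩

/-- **Melchior's inequality.** -/
theorem melchior {P : Finset (ℝ × ℝ)} (hP : NC P) :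
    ∑ L ∈ joins P P, ((ptsOn P L).card : ℤ) + 3 ≤ 3 * (joins P P).card := by
  have h1 : ((joins P P).sigma (nonlast P)).card ≤
      (((joins P P) ×ˢ (Finset.univ : Finset Bool)).filter (fun S => ¬ LeftFree P S)).card := by
    refine Finset.card_le_card_of_forall_subsingleton (fun a S => Attached P a.1 a.2 S) ?_ ?_
    · rintro ⟨L, x⟩ h
      rw [Finset.mem_sigma] at h
      obtain ⟨S, hS, hv, hA⟩ := exists_attached hP h.1 h.2
      exact ⟨S, by rw [Finset.mem_filter]; exact ⟨hS, hv⟩, hA⟩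
    · rintro S hS ⟨L, x⟩ h ⟨L', x'⟩ h'
      simp only [Finset.mem_filter, Finset.mem_product] at hS
      have h3 := h.1
      have h3' := h'.1
      rw [Finset.mem_sigma] at h3 h3'
      obtain ⟨rfl, rfl⟩ := Attached.unique (isLine_of_mem_joins hS.1.1) (isLine_of_mem_joins h3.1)
        (isLine_of_mem_joins h3'.1) h.2 h'.2
      rfl
  have h2 := three_le_card_leftFree hP
  have h3 := Finset.card_filter_add_card_filter_not
    (s := (joins P P) ×ˢ (Finset.univ : Finset Bool))
    (LeftFree P)
  rw [Finset.card_product, Finset.card_univ, Fintype.card_bool] at h3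
  rw [Finset.card_sigma] at h1
  have h4 : ∑ L ∈ joins P P, (ptsOn P L).card ≤ ∑ L ∈ joins P P, ((nonlast P L).card + 1) :=
    Finset.sum_le_sum fun L hL => card_ptsOn_le_nonlast P (isLine_of_mem_joins hL)
  rw [Finset.sum_add_distrib, Finset.sum_const, smul_eq_mul, mul_one] at h4
  have h5 : ∑ L ∈ joins P P, (ptsOn P L).card + 3 ≤ 3 * (joins P P).card := by omega
  exact_mod_cast h5

/-- The number of points of `P` on `L`, as an integer. -/
def cnt (P : Finset (ℝ × ℝ)) (L : Set (ℝ × ℝ)) : ℤ := (ptsOn P L).card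

theorem cnt_nonneg (P : Finset (ℝ × ℝ)) (L : Set (ℝ × ℝ)) : 0 ≤ cnt P L := Int.natCast_nonneg _

theorem cnt_pos {P : Finset (ℝ × ℝ)} {L : Set (ℝ × ℝ)} {p : ℝ × ℝ} (hp : p ∈ P) (hL : p ∈ L) :
    1 ≤ cnt P L := by
  have : 0 < (ptsOn P L).card := Finset.card_pos.2 ⟨p, mem_ptsOn.2 ⟨hp, hL⟩⟩
  rw [cnt]; omega

theorem one_le_cnt_iff {P : Finset (ℝ × ℝ)} {L : Set (ℝ × ℝ)} :
    1 ≤ cnt P L ↔ ∃ p ∈ P, p ∈ L := by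
  constructor
  · intro h
    obtain ⟨p, hp⟩ := Finset.card_pos.1 (show 0 < (ptsOn P L).card by rw [cnt] at h; omega)
    exact ⟨p, mem_ptsOn.1 hp⟩
  · rintro ⟨p, hp, hL⟩; exact cnt_pos hp hL

theorem two_le_cnt {P : Finset (ℝ × ℝ)} {L : Set (ℝ × ℝ)} {p q : ℝ × ℝ} (hp : p ∈ P) (hq : q ∈ P)
    (hpq : p ≠ q) (hpL : p ∈ L) (hqL : q ∈ L) : 2 ≤ cnt P L := by
  have : 1 < (ptsOn P L).card :=
    Finset.one_lt_card.2 ⟨p, mem_ptsOn.2 ⟨hp, hpL⟩, q, mem_ptsOn.2 ⟨hq, hqL⟩, hpq⟩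
  rw [cnt]; omega

theorem exists_ne_of_two_le_cnt {P : Finset (ℝ × ℝ)} {L : Set (ℝ × ℝ)} (h : 2 ≤ cnt P L)
    (p : ℝ × ℝ) : ∃ q ∈ P, q ∈ L ∧ q ≠ p := by
  obtain ⟨q, hq, hne⟩ := Finset.exists_mem_ne (show 1 < (ptsOn P L).card by rw [cnt] at h; omega) p
  rw [mem_ptsOn] at hq
  exact ⟨q, hq.1, hq.2, hne⟩

theorem cnt_union {R B : Finset (ℝ × ℝ)} (h : Disjoint R B) (L : Set (ℝ × ℝ)) :
    cnt (R ∪ B) L = cnt R L + cnt B L := by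
  rw [cnt, cnt, cnt, ptsOn, Finset.filter_union, Finset.card_union_of_disjoint
    (Finset.disjoint_filter_filter h)]
  push_cast; rfl

theorem one_le_cnt_left {R B : Finset (ℝ × ℝ)} {L : Set (ℝ × ℝ)} (h : L ∈ joins R B) :
    1 ≤ cnt R L := by
  obtain ⟨-, p, hp, q, hq, -, h1, h2⟩ := mem_joins.1 h
  exact cnt_pos hp h1

theorem one_le_cnt_right {R B : Finset (ℝ × ℝ)} {L : Set (ℝ × ℝ)} (h : L ∈ joins R B) :
    1 ≤ cnt B L := by
  rw [joins_comm] at h; exact one_le_cnt_left h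

theorem mem_joins_iff_cnt {R B : Finset (ℝ × ℝ)} (hRB : Disjoint R B) {L : Set (ℝ × ℝ)}
    (hL : IsLine L) : L ∈ joins R B ↔ 1 ≤ cnt R L ∧ 1 ≤ cnt B L := by
  refine ⟨fun h => ⟨one_le_cnt_left h, one_le_cnt_right h⟩, fun ⟨h1, h2⟩ => ?_⟩
  obtain ⟨p, hp, hpL⟩ := one_le_cnt_iff.1 h1
  obtain ⟨q, hq, hqL⟩ := one_le_cnt_iff.1 h2
  exact mem_joins.2 ⟨hL, p, hp, q, hq, fun h => Finset.disjoint_left.1 hRB hp (h ▸ hq), hpL, hqL⟩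

theorem sum_cnt_mul_cnt {R B X Y : Finset (ℝ × ℝ)} (hRB : Disjoint R B) (hX : X ⊆ R)
    (hY : Y ⊆ B) : ∑ L ∈ joins R B, cnt X L * cnt Y L = X.card * Y.card := by
  have := sum_joins_of_disjoint hRB hX hY
  simp only [cnt]
  exact_mod_cast this

theorem sum_cnt_sq {P X : Finset (ℝ × ℝ)} (hX : X ⊆ P) :
    ∑ L ∈ joins P P, (cnt X L ^ 2 - cnt X L) = (X.card : ℤ) ^ 2 - X.card := by
  have h := sum_joins_self hX
  have key : ∀ a : ℕ, ((a * a - a : ℕ) : ℤ) = (a : ℤ) ^ 2 - a := fun a => by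
    rw [Nat.cast_sub (Nat.le_mul_self a)]; push_cast; ring
  rw [← key, ← h, Nat.cast_sum]
  exact Finset.sum_congr rfl fun L _ => (key _).symm

/-- Melchior's inequality combined with the double counting of monochromatic and bichromatic
pairs. -/
theorem sum_weight_le {R B : Finset (ℝ × ℝ)} (hRB : Disjoint R B) (hNC : NC (R ∪ B)) :
    ∑ L ∈ joins R B, (cnt R L + cnt B L + (cnt R L - cnt B L) ^ 2 - 6) ≤
      ((R.card : ℤ) - B.card) ^ 2 - (R.card + B.card) - 6 := by
  have hsub : joins R B ⊆ joins (R ∪ B) (R ∪ B) :=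
    joins_mono Finset.subset_union_left Finset.subset_union_right
  have h1 := melchior hNC
  have h2 := sum_cnt_sq (P := R ∪ B) (X := R) Finset.subset_union_left
  have h3 := sum_cnt_sq (P := R ∪ B) (X := B) Finset.subset_union_right
  have hz : ∀ L ∈ joins (R ∪ B) (R ∪ B), L ∉ joins R B → cnt R L * cnt B L = 0 := by
    intro L hL hL'
    by_contra h
    rw [mul_eq_zero, not_or] at h
    refine hL' ((mem_joins_iff_cnt hRB (isLine_of_mem_joins hL)).2 ⟨?_, ?_⟩)
    · have := cnt_nonneg R L; omega
    · have := cnt_nonneg B L; omega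
  have h4 := sum_cnt_mul_cnt hRB (Finset.Subset.refl R) (Finset.Subset.refl B)
  rw [Finset.sum_subset hsub hz] at h4
  have h1' : ∑ L ∈ joins (R ∪ B) (R ∪ B), (cnt R L + cnt B L - 3) ≤ -3 := by
    rw [Finset.sum_sub_distrib, Finset.sum_const, nsmul_eq_mul]
    have : ∑ L ∈ joins (R ∪ B) (R ∪ B), (cnt R L + cnt B L) =
        ∑ L ∈ joins (R ∪ B) (R ∪ B), ((ptsOn (R ∪ B) L).card : ℤ) :=
      Finset.sum_congr rfl fun L _ => (cnt_union hRB L).symm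
    rw [this]; linarith
  have h5 : ∑ L ∈ joins R B, (cnt R L + cnt B L + (cnt R L - cnt B L) ^ 2 - 6) ≤
      ∑ L ∈ joins (R ∪ B) (R ∪ B), (cnt R L + cnt B L + (cnt R L - cnt B L) ^ 2 - 6) := by
    refine Finset.sum_le_sum_of_subset_of_nonneg hsub fun L hL hL' => ?_
    have e0 := hz L hL hL'
    have e1 : 2 ≤ cnt R L + cnt B L := by
      obtain ⟨-, p, hp, q, hq, hpq, hpL, hqL⟩ := mem_joins.1 hL
      rw [← cnt_union hRB]
      exact two_le_cnt hp hq hpq hpL hqL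
    nlinarith
  have h6 : ∑ L ∈ joins (R ∪ B) (R ∪ B), (cnt R L + cnt B L + (cnt R L - cnt B L) ^ 2 - 6) =
      ∑ L ∈ joins (R ∪ B) (R ∪ B), (cnt R L ^ 2 - cnt R L) +
      ∑ L ∈ joins (R ∪ B) (R ∪ B), (cnt B L ^ 2 - cnt B L) +
      2 * ∑ L ∈ joins (R ∪ B) (R ∪ B), (cnt R L + cnt B L - 3) -
      2 * ∑ L ∈ joins (R ∪ B) (R ∪ B), cnt R L * cnt B L := by
    simp only [Finset.mul_sum, ← Finset.sum_add_distrib, ← Finset.sum_sub_distrib]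
    exact Finset.sum_congr rfl fun L _ => by ring
  rw [h6, h2, h3, h4] at h5
  nlinarith

/-- The contribution of a line `l` to the double count of pairs relative to the line `L`. -/
def gain (R B : Finset (ℝ × ℝ)) (L l : Set (ℝ × ℝ)) : ℤ :=
  cnt R l * cnt B l - 2 * (cnt (ptsOn R L) l * cnt B l) - 2 * (cnt R l * cnt (ptsOn B L) l)

theorem cnt_ptsOn_self (P : Finset (ℝ × ℝ)) (L : Set (ℝ × ℝ)) : cnt (ptsOn P L) L = cnt P L := by
  rw [cnt, cnt, ptsOn, ptsOn, Finset.filter_filter]; simp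

theorem sum_gain {R B : Finset (ℝ × ℝ)} (hRB : Disjoint R B) {L : Set (ℝ × ℝ)}
    (hL : L ∈ joins R B) :
    ∑ l ∈ (joins R B).erase L, gain R B L l =
      (R.card : ℤ) * B.card - 2 * cnt R L * B.card - 2 * R.card * cnt B L
        + 3 * cnt R L * cnt B L := by
  have h1 := sum_cnt_mul_cnt hRB (Finset.Subset.refl R) (Finset.Subset.refl B)
  have h2 := sum_cnt_mul_cnt hRB (Finset.filter_subset (fun x => x ∈ L) R) (Finset.Subset.refl B)
  have h3 := sum_cnt_mul_cnt hRB (Finset.Subset.refl R) (Finset.filter_subset (fun x => x ∈ L) B)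
  have h4 : ∑ l ∈ joins R B, gain R B L l =
      (R.card : ℤ) * B.card - 2 * cnt R L * B.card - 2 * R.card * cnt B L := by
    simp only [gain, Finset.sum_sub_distrib, ← Finset.mul_sum]
    simp only [ptsOn] at *
    rw [h1, h2, h3]
    simp only [cnt, ptsOn]; ring
  rw [← Finset.add_sum_erase _ _ hL] at h4
  have h5 : gain R B L L = - 3 * (cnt R L * cnt B L) := by
    rw [gain, cnt_ptsOn_self, cnt_ptsOn_self]; ring
  rw [h5] at h4
  linarith

theorem cnt_ptsOn_cases {R B : Finset (ℝ × ℝ)} (hRB : Disjoint R B) {L l : Set (ℝ × ℝ)}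
    (hL : IsLine L) (hl : IsLine l) (h : L ≠ l) :
    (cnt (ptsOn R L) l = 0 ∧ cnt (ptsOn B L) l = 0) ∨
    (cnt (ptsOn R L) l = 1 ∧ cnt (ptsOn B L) l = 0) ∨
    (cnt (ptsOn R L) l = 0 ∧ cnt (ptsOn B L) l = 1) := by
  have h1 := card_ptsOn_ptsOn_le_one (R ∪ B) hL hl h
  have h2 := cnt_union
    (Finset.disjoint_filter_filter (p := fun x => x ∈ L) (q := fun x => x ∈ L) hRB) l
  have h3 : cnt (ptsOn (R ∪ B) L) l ≤ 1 := by rw [cnt]; omega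
  rw [ptsOn, Finset.filter_union] at h3
  rw [h2] at h3
  have h4 := cnt_nonneg (ptsOn R L) l
  have h5 := cnt_nonneg (ptsOn B L) l
  simp only [ptsOn] at *
  omega

/-- If every bichromatic line through `q ∉ L` has two red points, then `L` contains at most half
of the red points. -/
theorem two_mul_cnt_le {R B : Finset (ℝ × ℝ)} (hRB : Disjoint R B) (hB : NC B)
    (h2 : ∀ L ∈ joins R B, 2 ≤ cnt R L) {L : Set (ℝ × ℝ)} (hL : IsLine L) :
    2 * cnt R L ≤ R.card := by
  obtain ⟨q, hq, hqL⟩ := hB L hL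
  have hne : ∀ r ∈ R, q ≠ r := fun r hr h => Finset.disjoint_left.1 hRB hr (h ▸ hq)
  have ex : ∀ r ∈ ptsOn R L, ∃ s ∈ R, s ∈ ln q r ∧ s ≠ r := fun r hr => by
    rw [mem_ptsOn] at hr
    exact exists_ne_of_two_le_cnt (h2 _ (joins_comm R B ▸ ln_mem_joins hq hr.1 (hne r hr.1))) r
  choose! f hf1 hf2 hf3 using ex
  have key : (ptsOn R L).card ≤ (R.filter (fun x => ¬ x ∈ L)).card := by
    refine Finset.card_le_card_of_injOn f ?_ ?_
    · intro r hr
      have hr' := (mem_ptsOn.1 hr)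
      rw [Finset.mem_coe, Finset.mem_filter]
      refine ⟨hf1 r hr, fun h => hqL ?_⟩
      rw [hL.eq_of_mem (isLine_ln (hne r hr'.1)) (hf3 r hr) h hr'.2 (hf2 r hr) (right_mem_ln _ _)]
      exact left_mem_ln _ _
    · intro r hr s hs hrs
      by_contra hne'
      have hr' := (mem_ptsOn.1 hr)
      have hs' := (mem_ptsOn.1 hs)
      have e1 : ln q r = ln q s := (isLine_ln (hne r hr'.1)).eq_of_mem (isLine_ln (hne s hs'.1))
        (hne _ (hf1 r hr)) (left_mem_ln _ _) (hf2 r hr) (left_mem_ln _ _) (hrs ▸ hf2 s hs)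
      have e2 : L = ln q r := hL.eq_of_mem (isLine_ln (hne r hr'.1)) hne' hr'.2 hs'.2
        (right_mem_ln _ _) (e1 ▸ right_mem_ln _ _)
      exact hqL (e2 ▸ left_mem_ln _ _)
  have h3 := Finset.card_filter_add_card_filter_not (s := R) (fun x => x ∈ L)
  rw [cnt]
  rw [ptsOn] at key ⊢
  omega

theorem mem_joins_singleton {r : ℝ × ℝ} {B : Finset (ℝ × ℝ)} {L : Set (ℝ × ℝ)} :
    L ∈ joins {r} B ↔ IsLine L ∧ r ∈ L ∧ ∃ q ∈ B, r ≠ q ∧ q ∈ L := by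
  rw [mem_joins]
  constructor
  · rintro ⟨hL, p, hp, q, hq, hpq, hpL, hqL⟩
    rw [Finset.mem_singleton] at hp
    subst hp
    exact ⟨hL, hpL, q, hq, hpq, hqL⟩
  · rintro ⟨hL, hr, q, hq, hpq, hqL⟩
    exact ⟨hL, r, by simp, q, hq, hpq, hr, hqL⟩

/-- `R` consists of `p` and of at least two points on the line `ℓ`, which misses `p`, and `B` is
disjoint from `R`. -/
structure Pencil (R B : Finset (ℝ × ℝ)) (p : ℝ × ℝ) (ℓ : Set (ℝ × ℝ)) : Prop where
  disj : Disjoint R B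
  ncB : NC B
  line : IsLine ℓ
  mem : p ∈ R
  notMem : p ∉ ℓ
  sub : ∀ r ∈ R.erase p, r ∈ ℓ
  two_le : 2 ≤ (R.erase p).card

/-- The blue points outside the line of a pencil. -/
def offLine (B : Finset (ℝ × ℝ)) (ℓ : Set (ℝ × ℝ)) : Finset (ℝ × ℝ) := B.filter (fun b => b ∉ ℓ)

/-- The lines from `p` to blue points which contain no other red point. -/
def apexLines (R B : Finset (ℝ × ℝ)) (p : ℝ × ℝ) : Finset (Set (ℝ × ℝ)) :=
  (joins {p} B).filter (fun L => ∀ r ∈ R.erase p, r ∉ L)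

namespace Pencil

variable {R B : Finset (ℝ × ℝ)} {p : ℝ × ℝ} {ℓ : Set (ℝ × ℝ)}

theorem ne (h : Pencil R B p ℓ) {r b : ℝ × ℝ} (hr : r ∈ R) (hb : b ∈ B) : r ≠ b :=
  fun e => Finset.disjoint_left.1 h.disj hr (e ▸ hb)

theorem inter_line (h : Pencil R B p ℓ) {L : Set (ℝ × ℝ)} (hL : IsLine L) {q r s : ℝ × ℝ}
    (hq : q ∈ L) (hq' : q ∉ ℓ) (hr : r ∈ L) (hr' : r ∈ ℓ) (hs : s ∈ L) (hs' : s ∈ ℓ) : r = s := by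
  by_contra hrs
  exact hq' (hL.eq_of_mem h.line hrs hr hs hr' hs' ▸ hq)

theorem card_le (h : Pencil R B p ℓ) :
    ∑ r ∈ R.erase p, (joins {r} (offLine B ℓ)).card + (apexLines R B p).card
      + (if ∃ b ∈ B, b ∈ ℓ then 1 else 0) ≤ (joins R B).card := by
  set A := R.erase p with hA
  set Z : Finset (Set (ℝ × ℝ)) := if ∃ b ∈ B, b ∈ ℓ then {ℓ} else ∅ with hZ
  have hZc : Z.card = if ∃ b ∈ B, b ∈ ℓ then 1 else 0 := by rw [hZ]; split_ifs <;> simp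
  obtain ⟨r0, hr0⟩ : A.Nonempty := Finset.card_pos.1 (by have := h.two_le; rw [← hA] at this; omega)
  have h1 : (A.biUnion (fun r => joins {r} (offLine B ℓ))).card =
      ∑ r ∈ A, (joins {r} (offLine B ℓ)).card := by
    refine Finset.card_biUnion fun r hr s hs hrs => Finset.disjoint_left.2 fun L hL hL' => ?_
    obtain ⟨hl, hrL, q, hq, -, hqL⟩ := mem_joins_singleton.1 hL
    obtain ⟨-, hsL, -⟩ := mem_joins_singleton.1 hL'
    exact hrs (h.inter_line hl hqL (Finset.mem_filter.1 hq).2 hrL (h.sub r hr) hsL (h.sub s hs))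
  have h2 : Disjoint (A.biUnion (fun r => joins {r} (offLine B ℓ))) (apexLines R B p) := by
    rw [Finset.disjoint_left]
    intro L hL hL'
    obtain ⟨r, hr, hL⟩ := Finset.mem_biUnion.1 hL
    exact (Finset.mem_filter.1 hL').2 r hr (mem_joins_singleton.1 hL).2.1
  have h3 : Disjoint (A.biUnion (fun r => joins {r} (offLine B ℓ)) ∪ apexLines R B p) Z := by
    rw [Finset.disjoint_right]
    intro L hL hL'
    have : L = ℓ := by
      rw [hZ] at hL; split_ifs at hL <;> simp at hL; exact hL
    subst this
    rcases Finset.mem_union.1 hL' with hL' | hL'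
    · obtain ⟨r, hr, hL'⟩ := Finset.mem_biUnion.1 hL'
      obtain ⟨-, -, q, hq, -, hqL⟩ := mem_joins_singleton.1 hL'
      exact (Finset.mem_filter.1 hq).2 hqL
    · exact (Finset.mem_filter.1 hL').2 r0 hr0 (h.sub r0 hr0)
  rw [← h1, ← hZc, ← Finset.card_union_of_disjoint h2, ← Finset.card_union_of_disjoint h3]
  refine Finset.card_le_card (Finset.union_subset (Finset.union_subset ?_ ?_) ?_)
  · exact Finset.biUnion_subset.2 fun r hr => joins_mono
      (Finset.singleton_subset_iff.2 (Finset.mem_of_mem_erase hr)) (Finset.filter_subset _ _)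
  · exact (Finset.filter_subset _ _).trans
      (joins_mono (Finset.singleton_subset_iff.2 h.mem) (Finset.Subset.refl B))
  · rw [hZ]
    split_ifs with hb
    · obtain ⟨b, hb, hbl⟩ := hb
      rw [Finset.singleton_subset_iff]
      exact mem_joins.2 ⟨h.line, r0, Finset.mem_of_mem_erase hr0, b, hb,
        h.ne (Finset.mem_of_mem_erase hr0) hb, h.sub r0 hr0, hbl⟩
    · exact Finset.empty_subset _

theorem card_onLine_le (h : Pencil R B p ℓ) : (ptsOn B ℓ).card ≤ (apexLines R B p).card := by
  refine Finset.card_le_card_of_injOn (fun b => ln p b) ?_ ?_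
  · intro b hb
    have hb' := mem_ptsOn.1 hb
    have hpb := h.ne h.mem hb'.1
    rw [Finset.mem_coe, apexLines, Finset.mem_filter]
    refine ⟨ln_mem_joins (Finset.mem_singleton_self p) hb'.1 hpb, fun r hr hrL => ?_⟩
    exact h.ne (Finset.mem_of_mem_erase hr) hb'.1 (h.inter_line (isLine_ln hpb) (left_mem_ln _ _)
      h.notMem hrL (h.sub r hr) (right_mem_ln _ _) hb'.2)
  · intro b hb c hc hbc
    have hb' := mem_ptsOn.1 hb
    have hc' := mem_ptsOn.1 hc
    exact h.inter_line (isLine_ln (h.ne h.mem hb'.1)) (left_mem_ln _ _) h.notMem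
      (right_mem_ln _ _) hb'.2 (show c ∈ ln p b from (show ln p b = ln p c from hbc) ▸
        right_mem_ln p c) hc'.2

theorem card_on_add_off (B : Finset (ℝ × ℝ)) (ℓ : Set (ℝ × ℝ)) :
    (ptsOn B ℓ).card + (offLine B ℓ).card = B.card :=
  Finset.card_filter_add_card_filter_not _

theorem two_le_card_joins {Q : Finset (ℝ × ℝ)} (hQ : NC Q) {r : ℝ × ℝ} (hr : r ∉ Q) :
    2 ≤ (joins {r} Q).card := by
  obtain ⟨q, hq⟩ : Q.Nonempty := Finset.card_pos.1 (by have := hQ.three_le_card; omega)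
  have hrq : r ≠ q := fun e => hr (e ▸ hq)
  obtain ⟨q', hq', hq''⟩ := hQ _ (isLine_ln hrq)
  have hrq' : r ≠ q' := fun e => hr (e ▸ hq')
  exact Finset.one_lt_card.2 ⟨ln r q, ln_mem_joins (by simp) hq hrq, ln r q',
    ln_mem_joins (by simp) hq' hrq', fun e => hq'' (e ▸ right_mem_ln _ _)⟩

theorem bound_of_mem (h : Pencil R B p ℓ) (hcard : B.card ≤ R.card + 1)
    (hb : ∃ b ∈ B, b ∈ ℓ) : R.card + B.card ≤ (joins R B).card + 1 := by
  have h1 := h.card_le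
  rw [if_pos hb] at h1
  have h2 := h.card_onLine_le
  have h3 := card_on_add_off B ℓ
  have h4 := Finset.card_erase_add_one h.mem
  have h5 : 1 ≤ (ptsOn B ℓ).card := by
    obtain ⟨b, hb, hbl⟩ := hb
    exact Finset.card_pos.2 ⟨b, mem_ptsOn.2 ⟨hb, hbl⟩⟩
  have hrQ : ∀ r ∈ R.erase p, r ∉ offLine B ℓ := fun r hr hr' =>
    (Finset.mem_filter.1 hr').2 (h.sub r hr)
  have hM := h.two_le
  set Q := offLine B ℓ with hQ
  suffices hs : (R.erase p).card + Q.card ≤ ∑ r ∈ R.erase p, (joins {r} Q).card + 1 by omega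
  by_cases hnc : NC Q
  · have : (R.erase p).card * 2 ≤ ∑ r ∈ R.erase p, (joins {r} Q).card := by
      rw [← smul_eq_mul]
      exact Finset.card_nsmul_le_sum _ _ _ fun r hr => two_le_card_joins hnc (hrQ r hr)
    omega
  · rw [NC] at hnc
    push Not at hnc
    obtain ⟨L, hL, hQL⟩ := hnc
    obtain ⟨q0, hq0, hq0'⟩ := h.ncB ℓ h.line
    have hq0Q : q0 ∈ Q := Finset.mem_filter.2 ⟨hq0, hq0'⟩
    have hQpos : 1 ≤ Q.card := Finset.card_pos.2 ⟨q0, hq0Q⟩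
    have hone : ∀ r ∈ R.erase p, 1 ≤ (joins {r} Q).card := fun r hr =>
      Finset.card_pos.2 ⟨ln r q0, ln_mem_joins (by simp) hq0Q
        (h.ne (Finset.mem_of_mem_erase hr) hq0)⟩
    have hbig : ∀ r ∈ R.erase p, r ∉ L → Q.card ≤ (joins {r} Q).card := by
      intro r hr hrL
      have hne : ∀ q ∈ Q, r ≠ q := fun q hq =>
        h.ne (Finset.mem_of_mem_erase hr) (Finset.mem_filter.1 hq).1
      refine Finset.card_le_card_of_injOn (fun q => ln r q) ?_ ?_
      · exact fun q hq => ln_mem_joins (by simp) hq (hne q hq)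
      · intro a ha b hb hab
        by_contra hab'
        have hab2 : ln r a = ln r b := hab
        apply hrL
        rw [hL.eq_of_mem (isLine_ln (hne a ha)) hab' (hQL a ha) (hQL b hb) (right_mem_ln _ _)
          (hab2 ▸ right_mem_ln _ _)]
        exact left_mem_ln _ _
    have hsum : ∃ s : ℕ, ((R.erase p).card - 1) * Q.card + 1 ≤ s ∧
        s ≤ ∑ r ∈ R.erase p, (joins {r} Q).card := by
      obtain ⟨r1, hr1, hr1'⟩ : ∃ r1 ∈ R.erase p, ∀ r ∈ (R.erase p).erase r1, r ∉ L := by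
        by_cases hex : ∃ r1 ∈ R.erase p, r1 ∈ L
        · obtain ⟨r1, hr1, hr1L⟩ := hex
          refine ⟨r1, hr1, fun r hr hrL => (Finset.mem_erase.1 hr).1 ?_⟩
          exact h.inter_line hL (hQL q0 hq0Q) hq0' hrL (h.sub r (Finset.mem_of_mem_erase hr)) hr1L
            (h.sub r1 hr1)
        · push Not at hex
          obtain ⟨r1, hr1⟩ : (R.erase p).Nonempty := Finset.card_pos.1 (by omega)
          exact ⟨r1, hr1, fun r hr => hex r (Finset.mem_of_mem_erase hr)⟩
      refine ⟨_, ?_, (Finset.add_sum_erase _ _ hr1).le⟩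
      rw [← Finset.card_erase_of_mem hr1, add_comm]
      refine Nat.add_le_add (hone r1 hr1) ?_
      rw [← smul_eq_mul]
      exact Finset.card_nsmul_le_sum _ _ _ fun r hr =>
        hbig r (Finset.mem_of_mem_erase hr) (hr1' r hr)
    obtain ⟨s, hs1, hs2⟩ := hsum
    obtain ⟨m, hm⟩ : ∃ m, (R.erase p).card = m + 2 := ⟨_, (Nat.sub_add_cancel hM).symm⟩
    rw [hm] at hs1 ⊢
    have : m + 2 - 1 = m + 1 := rfl
    rw [this] at hs1
    nlinarith

theorem offLine_eq (hb : ¬ ∃ b ∈ B, b ∈ ℓ) : offLine B ℓ = B :=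
  Finset.filter_true_of_mem fun b hbB hbl => hb ⟨b, hbB, hbl⟩

theorem ln_apex_inter (h : Pencil R B p ℓ) {r s : ℝ × ℝ} (hr : r ∈ R.erase p)
    (hs : s ∈ R.erase p) (hrs : s ∈ ln p r) : r = s :=
  h.inter_line (isLine_ln (Finset.mem_erase.1 hr).1.symm) (left_mem_ln _ _) h.notMem
    (right_mem_ln _ _) (h.sub r hr) hrs (h.sub s hs)

/-- If every line from `p` to a blue point contains another red point and there are more blue
points than red points different from `p`, then some red point sees three blue directions. -/
theorem exists_three_le (h : Pencil R B p ℓ) (hE : (apexLines R B p).card = 0)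
    (hcard : (R.erase p).card < B.card) :
    ∃ r ∈ R.erase p, 3 ≤ (joins {r} B).card := by
  have ex : ∀ b ∈ B, ∃ r ∈ R.erase p, b ∈ ln p r := by
    intro b hb
    by_contra! hc
    have hpb := h.ne h.mem hb
    have : ln p b ∈ apexLines R B p := Finset.mem_filter.2
      ⟨ln_mem_joins (by simp) hb hpb, fun r hr hrL => hc r hr <| by
        rw [← (isLine_ln hpb).eq_ln (left_mem_ln _ _) hrL (Finset.mem_erase.1 hr).1.symm]
        exact right_mem_ln _ _⟩
    rw [Finset.card_eq_zero.1 hE] at this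
    exact absurd this (Finset.notMem_empty _)
  choose! f hf1 hf2 using ex
  obtain ⟨b1, hb1, b2, hb2, hb12, hf⟩ :=
    Finset.exists_ne_map_eq_of_card_lt_of_maps_to hcard (fun b hb => hf1 b hb)
  set r1 := f b1 with hr1
  have hpr1 : p ≠ r1 := (Finset.mem_erase.1 (hf1 b1 hb1)).1.symm
  obtain ⟨b3, hb3, hb3'⟩ := h.ncB _ (isLine_ln hpr1)
  have hr3 : f b3 ≠ r1 := fun e => hb3' (e ▸ hf2 b3 hb3)
  set r3 := f b3
  have hr3A := hf1 b3 hb3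
  have hpr3 : p ≠ r3 := (Finset.mem_erase.1 hr3A).1.symm
  have hne : ∀ b ∈ B, r3 ≠ b := fun b hb => h.ne (Finset.mem_of_mem_erase hr3A) hb
  have hout : r3 ∉ ln p r1 := fun e => hr3 (h.ln_apex_inter (hf1 b1 hb1) hr3A e).symm
  have hl1 : b1 ∈ ln p r1 := hf2 b1 hb1
  have hl2 : b2 ∈ ln p r1 := hf ▸ hf2 b2 hb2
  have hl3 : ln p r3 = ln r3 b3 :=
    (isLine_ln hpr3).eq_ln (right_mem_ln _ _) (hf2 b3 hb3) (hne b3 hb3)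
  have h3b : ∀ b ∈ B, b ∈ ln p r1 → ln r3 b ≠ ln r3 b3 := fun b hb hbl e => hout <| by
    rw [(isLine_ln hpr1).eq_of_mem (isLine_ln hpr3) (h.ne h.mem hb) (left_mem_ln _ _) hbl
      (left_mem_ln _ _) (hl3 ▸ e ▸ right_mem_ln _ _)]
    exact right_mem_ln _ _
  refine ⟨r3, hr3A, Finset.two_lt_card.2 ⟨ln r3 b1, ln_mem_joins (by simp) hb1 (hne b1 hb1),
    ln r3 b2, ln_mem_joins (by simp) hb2 (hne b2 hb2), ln r3 b3,
    ln_mem_joins (by simp) hb3 (hne b3 hb3), fun e => hout ?_, h3b b1 hb1 hl1, h3b b2 hb2 hl2⟩⟩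
  rw [(isLine_ln hpr1).eq_of_mem (isLine_ln (hne b1 hb1)) hb12 hl1 hl2 (right_mem_ln _ _)
    (e ▸ right_mem_ln _ _)]
  exact left_mem_ln _ _

/-- The points of `B` are determined by the lines joining them to two fixed points. -/
theorem card_le_mul (h : Pencil R B p ℓ) (hb : ¬ ∃ b ∈ B, b ∈ ℓ) {r s : ℝ × ℝ}
    (hr : r ∈ R.erase p) (hs : s ∈ R.erase p) (hrs : r ≠ s) :
    B.card ≤ (joins {r} B).card * (joins {s} B).card := by
  have hne : ∀ r ∈ R.erase p, ∀ b ∈ B, r ≠ b := fun r hr b hb =>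
    h.ne (Finset.mem_of_mem_erase hr) hb
  rw [← Finset.card_product]
  refine Finset.card_le_card_of_injOn (fun b => (ln r b, ln s b)) ?_ ?_
  · intro b hb
    simp only [Finset.coe_product, Set.mem_prod, Finset.mem_coe]
    exact ⟨ln_mem_joins (by simp) hb (hne r hr b hb), ln_mem_joins (by simp) hb (hne s hs b hb)⟩
  · intro b hbB c hcB hbc
    by_contra hbc'
    simp only [Prod.mk.injEq] at hbc
    obtain ⟨e1, e2⟩ := hbc
    have e3 : ln r b = ln s b := (isLine_ln (hne r hr b hbB)).eq_of_mem (isLine_ln (hne s hs b hbB))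
      hbc' (right_mem_ln _ _) (e1 ▸ right_mem_ln _ _) (right_mem_ln _ _) (e2 ▸ right_mem_ln _ _)
    exact hrs (h.inter_line (isLine_ln (hne r hr b hbB)) (right_mem_ln _ _)
      (fun hbl => hb ⟨b, hbB, hbl⟩) (left_mem_ln _ _) (h.sub r hr) (e3 ▸ left_mem_ln _ _)
      (h.sub s hs))

/-- In a red triangle, every vertex can serve as apex. -/
theorem triangle (h : Pencil R B p ℓ) {r s : ℝ × ℝ} (hrs : r ≠ s) (hA : R.erase p = {r, s}) :
    Pencil R B s (ln p r) := by
  have hrA : r ∈ R.erase p := by rw [hA]; simp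
  have hsA : s ∈ R.erase p := by rw [hA]; simp
  have hpr := (Finset.mem_erase.1 hrA).1.symm
  have hps := (Finset.mem_erase.1 hsA).1.symm
  have hR : R.erase s = {p, r} := by
    rw [← Finset.insert_erase h.mem, hA]
    ext x
    simp only [Finset.mem_erase, Finset.mem_insert, Finset.mem_singleton]
    constructor
    · tauto
    · rintro (rfl | rfl) <;> tauto
  refine ⟨h.disj, h.ncB, isLine_ln hpr, Finset.mem_of_mem_erase hsA,
    fun e => hrs (h.ln_apex_inter hrA hsA e), fun x hx => ?_, ?_⟩
  · rw [hR, Finset.mem_insert, Finset.mem_singleton] at hx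
    rcases hx with rfl | rfl
    · exact left_mem_ln _ _
    · exact right_mem_ln _ _
  · rw [hR, Finset.card_pair hpr]

theorem bound (h : Pencil R B p ℓ) (hcard : B.card ≤ R.card + 1) :
    R.card + B.card ≤ (joins R B).card + 1 := by
  by_cases hb : ∃ b ∈ B, b ∈ ℓ
  · exact h.bound_of_mem hcard hb
  have h1 := h.card_le
  rw [if_neg hb, offLine_eq hb, add_zero] at h1
  have h4 := Finset.card_erase_add_one h.mem
  have hM := h.two_le
  have hnot : ∀ r ∈ R, r ∉ B := fun r hr hr' => Finset.disjoint_left.1 h.disj hr hr'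
  have htwo : ∀ r ∈ R.erase p, 2 ≤ (joins {r} B).card := fun r hr =>
    two_le_card_joins h.ncB (hnot r (Finset.mem_of_mem_erase hr))
  have h2 : (R.erase p).card * 2 ≤ ∑ r ∈ R.erase p, (joins {r} B).card := by
    rw [← smul_eq_mul]
    exact Finset.card_nsmul_le_sum _ _ _ htwo
  have hdec : ∀ r ∈ R.erase p, (joins {r} B).card + ∑ s ∈ (R.erase p).erase r, (joins {s} B).card =
      ∑ r ∈ R.erase p, (joins {r} B).card := fun r hr =>
    Finset.add_sum_erase _ (fun s => (joins {s} B).card) hr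
  rcases Nat.lt_or_ge (R.erase p).card B.card with hlt | hge
  · rcases Nat.lt_or_ge ((R.erase p).card + 1) B.card with hlt' | hge'
    · have hBc : B.card = (R.erase p).card + 2 := by omega
      rcases Nat.lt_or_ge 2 (R.erase p).card with hM3 | hM2
      · have : ∃ r ∈ R.erase p, ∀ s ∈ (R.erase p).erase r, 3 ≤ (joins {s} B).card := by
          by_cases hex : ∃ r ∈ R.erase p, (joins {r} B).card = 2
          · obtain ⟨r, hr, hr2⟩ := hex
            refine ⟨r, hr, fun s hs => ?_⟩
            have := h.card_le_mul hb hr (Finset.mem_of_mem_erase hs) (Finset.mem_erase.1 hs).1.symm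
            rw [hr2] at this
            omega
          · push Not at hex
            obtain ⟨r, hr⟩ : (R.erase p).Nonempty := Finset.card_pos.1 (by omega)
            refine ⟨r, hr, fun s hs => ?_⟩
            have h5 := hex s (Finset.mem_of_mem_erase hs)
            have h6 := htwo s (Finset.mem_of_mem_erase hs)
            omega
        obtain ⟨r, hr, h3⟩ := this
        have h5 : ((R.erase p).erase r).card * 3 ≤
            ∑ s ∈ (R.erase p).erase r, (joins {s} B).card := by
          rw [← smul_eq_mul]
          exact Finset.card_nsmul_le_sum _ _ _ h3
        have h6 := Finset.card_erase_add_one hr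
        have h7 := hdec r hr
        have h8 := htwo r hr
        omega
      · obtain ⟨r, s, hrs, hA⟩ := Finset.card_eq_two.1 (show (R.erase p).card = 2 by omega)
        by_cases hb1 : ∃ b ∈ B, b ∈ ln p r
        · exact (h.triangle hrs hA).bound_of_mem hcard hb1
        by_cases hb2 : ∃ b ∈ B, b ∈ ln p s
        · exact (h.triangle hrs.symm (by rw [hA, Finset.pair_comm])).bound_of_mem hcard hb2
        have h5 : apexLines R B p = joins {p} B := by
          refine Finset.filter_true_of_mem fun L hL t ht htL => ?_
          obtain ⟨hl, hpL, b, hbB, hpb, hbL⟩ := mem_joins_singleton.1 hL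
          have h6 := hl.eq_ln hpL htL (Finset.mem_erase.1 ht).1.symm
          rw [hA, Finset.mem_insert, Finset.mem_singleton] at ht
          rcases ht with rfl | rfl
          · exact hb1 ⟨b, hbB, h6 ▸ hbL⟩
          · exact hb2 ⟨b, hbB, h6 ▸ hbL⟩
        have h6 := two_le_card_joins h.ncB (hnot p h.mem)
        rw [h5] at h1
        omega
    · rcases Nat.eq_zero_or_pos (apexLines R B p).card with hE | hE
      · obtain ⟨r, hr, h3⟩ := h.exists_three_le hE hlt
        have h5 : ((R.erase p).erase r).card * 2 ≤
            ∑ s ∈ (R.erase p).erase r, (joins {s} B).card := by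
          rw [← smul_eq_mul]
          exact Finset.card_nsmul_le_sum _ _ _ fun s hs => htwo s (Finset.mem_of_mem_erase hs)
        have h6 := Finset.card_erase_add_one hr
        have h7 := hdec r hr
        omega
      · omega
  · omega

end Pencil

/-- If removing a point makes one colour class collinear, the bound holds. -/
theorem bound_of_erase {R B : Finset (ℝ × ℝ)} (hRB : Disjoint R B) (hR : NC R) (hB : NC B)
    (hcard : B.card ≤ R.card + 1) {p : ℝ × ℝ} (hp : p ∈ R) (h : ¬ NC (R.erase p)) :
    R.card + B.card ≤ (joins R B).card + 1 := by
  rw [NC] at h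
  push Not at h
  obtain ⟨L, hL, hs⟩ := h
  have h3 := hR.three_le_card
  have h4 := Finset.card_erase_add_one hp
  refine Pencil.bound (p := p) (ℓ := L) ⟨hRB, hB, hL, hp, fun hpL => ?_, hs, by omega⟩ hcard
  obtain ⟨q, hq, hqL⟩ := hR L hL
  exact hqL (hs q (Finset.mem_erase.2 ⟨fun e => hqL (e ▸ hpL), hq⟩))

/-- The weight of a bichromatic line in Melchior's inequality. -/
def wt (R B : Finset (ℝ × ℝ)) (L : Set (ℝ × ℝ)) : ℤ :=
  cnt R L + cnt B L + (cnt R L - cnt B L) ^ 2 - 4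

theorem sum_wt_le {R B : Finset (ℝ × ℝ)} (hRB : Disjoint R B) (hR : NC R) :
    ∑ L ∈ joins R B, wt R B L ≤
      ((R.card : ℤ) - B.card) ^ 2 - (R.card + B.card) - 6 + 2 * (joins R B).card := by
  have h := sum_weight_le hRB (hR.mono Finset.subset_union_left)
  have : ∑ L ∈ joins R B, wt R B L =
      ∑ L ∈ joins R B, (cnt R L + cnt B L + (cnt R L - cnt B L) ^ 2 - 6) +
        2 * (joins R B).card := by
    rw [mul_comm, ← nsmul_eq_mul, ← Finset.sum_const, ← Finset.sum_add_distrib]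
    exact Finset.sum_congr rfl fun L _ => by rw [wt]; ring
  rw [this]; linarith

theorem sum_sub_four {R B : Finset (ℝ × ℝ)} (hRB : Disjoint R B) :
    ∑ L ∈ joins R B, (cnt R L * cnt B L - 4) = (R.card : ℤ) * B.card - 4 * (joins R B).card := by
  rw [Finset.sum_sub_distrib, sum_cnt_mul_cnt hRB (Finset.Subset.refl R) (Finset.Subset.refl B),
    Finset.sum_const, nsmul_eq_mul, mul_comm (4 : ℤ)]

/-- The properties of a minimal counterexample with `n` points of each colour. -/
structure EqualCase (R B : Finset (ℝ × ℝ)) (n : ℤ) : Prop where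
  disj : Disjoint R B
  ncR : NC R
  ncB : NC B
  cardR : (R.card : ℤ) = n
  cardB : (B.card : ℤ) = n
  cardJ : ((joins R B).card : ℤ) = 2 * n - 2
  twoR : ∀ L ∈ joins R B, 2 ≤ cnt R L
  twoB : ∀ L ∈ joins R B, 2 ≤ cnt B L

namespace EqualCase

variable {R B : Finset (ℝ × ℝ)} {n : ℤ}

theorem symm (h : EqualCase R B n) : EqualCase B R n where
  disj := h.disj.symm
  ncR := h.ncB
  ncB := h.ncR
  cardR := h.cardB
  cardB := h.cardR
  cardJ := by rw [joins_comm]; exact h.cardJ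
  twoR := by rw [joins_comm]; exact h.twoB
  twoB := by rw [joins_comm]; exact h.twoR

theorem sum_wt (h : EqualCase R B n) : ∑ L ∈ joins R B, wt R B L ≤ 2 * n - 10 := by
  have := sum_wt_le h.disj h.ncR
  rw [h.cardR, h.cardB, h.cardJ] at this
  linarith

theorem sum_excess (h : EqualCase R B n) :
    ∑ L ∈ joins R B, (cnt R L * cnt B L - 4) = n ^ 2 - 8 * n + 8 := by
  rw [sum_sub_four h.disj, h.cardR, h.cardB, h.cardJ]; ring

theorem le_half (h : EqualCase R B n) {L : Set (ℝ × ℝ)} (hL : L ∈ joins R B) :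
    2 * cnt R L ≤ n := by
  rw [← h.cardR]; exact two_mul_cnt_le h.disj h.ncB h.twoR (isLine_of_mem_joins hL)

theorem gain_nonneg (h : EqualCase R B n) {L l : Set (ℝ × ℝ)} (hL : L ∈ joins R B)
    (hl : l ∈ joins R B) (hne : L ≠ l) : 0 ≤ gain R B L l := by
  have h1 := h.twoR l hl
  have h2 := h.twoB l hl
  rcases cnt_ptsOn_cases h.disj (isLine_of_mem_joins hL) (isLine_of_mem_joins hl) hne with
    ⟨e1, e2⟩ | ⟨e1, e2⟩ | ⟨e1, e2⟩ <;> rw [gain, e1, e2] <;> nlinarith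

theorem gain_le (h : EqualCase R B n) {L l : Set (ℝ × ℝ)} (hL : L ∈ joins R B)
    (hl : l ∈ joins R B) (hne : L ≠ l) :
    gain R B L l ≤ n ^ 2 - 2 * cnt R L * n - 2 * n * cnt B L + 3 * cnt R L * cnt B L := by
  have h1 := sum_gain h.disj hL
  rw [h.cardR, h.cardB, ← sq] at h1
  rw [← h1]
  refine Finset.single_le_sum (f := gain R B L) (fun x hx => ?_)
    (Finset.mem_erase.2 ⟨hne.symm, hl⟩)
  exact h.gain_nonneg hL (Finset.mem_of_mem_erase hx) (Finset.mem_erase.1 hx).1.symm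

theorem delta_nonneg (h : EqualCase R B n) {L : Set (ℝ × ℝ)} (hL : L ∈ joins R B) :
    0 ≤ n ^ 2 - 2 * cnt R L * n - 2 * n * cnt B L + 3 * cnt R L * cnt B L := by
  have h1 := sum_gain h.disj hL
  rw [h.cardR, h.cardB, ← sq] at h1
  rw [← h1]
  exact Finset.sum_nonneg fun x hx =>
    h.gain_nonneg hL (Finset.mem_of_mem_erase hx) (Finset.mem_erase.1 hx).1.symm

theorem ratio (h : EqualCase R B n) {a b : ℤ} (hb : 0 ≤ b)
    (H : ∀ L ∈ joins R B, a * (cnt R L * cnt B L - 4) ≤ b * wt R B L) :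
    a * (n ^ 2 - 8 * n + 8) ≤ b * (2 * n - 10) := by
  have h1 := Finset.sum_le_sum H
  rw [← Finset.mul_sum, ← Finset.mul_sum, h.sum_excess] at h1
  exact h1.trans (mul_le_mul_of_nonneg_left h.sum_wt hb)

theorem not_large (h : EqualCase R B n) (hn : 12 ≤ n) : False := by
  have key : ∀ L ∈ joins R B, 4 * (cnt R L * cnt B L - 4) ≤ (n + 3) * wt R B L := by
    intro L hL
    have h1 := h.twoR L hL
    have h2 := h.twoB L hL
    have h3 := h.le_half hL
    have h4 := h.symm.le_half (joins_comm R B ▸ hL)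
    have h5 := h.delta_nonneg hL
    rw [wt]
    generalize cnt R L = i at *
    generalize cnt B L = j at *
    have hs : i + j ≤ n - 1 := by
      by_contra! hc
      have : j = n - i := by omega
      subst this
      nlinarith [sq_nonneg (n - 2 * i)]
    have hw : 0 ≤ i + j + (i - j) ^ 2 - 4 := by nlinarith [sq_nonneg (i - j)]
    have h6 : 4 * (i * j - 4) ≤ (i + j + 4) * (i + j + (i - j) ^ 2 - 4) := by
      nlinarith [mul_nonneg (by omega : 0 ≤ i + j + 3) (sq_nonneg (i - j))]
    nlinarith
  have := h.ratio (by omega) key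
  nlinarith

theorem not_small (h : EqualCase R B n) (hn : n < 12) : False := by
  have h0 : 0 ≤ n ^ 2 - 8 * n + 8 := by
    rw [← h.sum_excess]
    refine Finset.sum_nonneg fun L hL => ?_
    nlinarith [h.twoR L hL, h.twoB L hL]
  have h0' : 0 ≤ 2 * n - 10 := by
    refine le_trans (Finset.sum_nonneg fun L hL => ?_) h.sum_wt
    rw [wt]
    nlinarith [h.twoR L hL, h.twoB L hL, sq_nonneg (cnt R L - cnt B L)]
  have hn7 : 7 ≤ n := by nlinarith
  have pt : ∀ L ∈ joins R B, ∃ i j : ℤ, cnt R L = i ∧ cnt B L = j ∧ 2 ≤ i ∧ 2 ≤ j ∧ 2 * i ≤ n ∧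
      2 * j ≤ n ∧ 0 ≤ n ^ 2 - 2 * i * n - 2 * n * j + 3 * i * j := fun L hL =>
    ⟨_, _, rfl, rfl, h.twoR L hL, h.twoB L hL, h.le_half hL,
      h.symm.le_half (joins_comm R B ▸ hL), h.delta_nonneg hL⟩
  have main : ∀ a b : ℤ, 0 ≤ b → (∀ i j : ℤ, 2 ≤ i → 2 ≤ j → 2 * i ≤ n → 2 * j ≤ n →
      0 ≤ n ^ 2 - 2 * i * n - 2 * n * j + 3 * i * j →
      a * (i * j - 4) ≤ b * (i + j + (i - j) ^ 2 - 4)) →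
      a * (n ^ 2 - 8 * n + 8) ≤ b * (2 * n - 10) := by
    intro a b hb H
    refine h.ratio hb fun L hL => ?_
    rw [wt]
    exact H _ _ (h.twoR L hL) (h.twoB L hL) (h.le_half hL)
      (h.symm.le_half (joins_comm R B ▸ hL)) (h.delta_nonneg hL)
  rcases (by omega : n = 7 ∨ n = 8 ∨ n = 9 ∨ n = 10 ∨ n = 11) with rfl | rfl | rfl | rfl | rfl
  · have := main 1 0 le_rfl fun i j h1 h2 h3 h4 h5 => by
      have h3' : i ≤ 3 := by omega
      have h4' : j ≤ 3 := by omega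
      interval_cases i <;> interval_cases j <;> omega
    norm_num at this
  · have := main 1 1 (by norm_num) fun i j h1 h2 h3 h4 h5 => by
      have h3' : i ≤ 4 := by omega
      have h4' : j ≤ 4 := by omega
      interval_cases i <;> interval_cases j <;> omega
    norm_num at this
  · have type : ∀ L ∈ joins R B, (cnt R L = 3 ∧ cnt B L = 3) ∨
        cnt R L * cnt B L - 4 ≤ wt R B L := by
      intro L hL
      obtain ⟨i, j, e1, e2, h1, h2, h3, h4, h5⟩ := pt L hL
      rw [wt, e1, e2]
      have h3' : i ≤ 4 := by omega
      have h4' : j ≤ 4 := by omega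
      interval_cases i <;> interval_cases j <;> omega
    have h33 : ((joins R B).filter (fun L => cnt R L = 3 ∧ cnt B L = 3)).card ≤ 1 := by
      rw [Finset.card_le_one]
      intro L hL l hl
      rw [Finset.mem_filter] at hL hl
      obtain ⟨hL, hL1, hL2⟩ := hL
      obtain ⟨hl, hl1, hl2⟩ := hl
      by_contra hne
      have := h.gain_le hL hl hne
      rw [hL1, hL2, gain, hl1, hl2] at this
      rcases cnt_ptsOn_cases h.disj (isLine_of_mem_joins hL) (isLine_of_mem_joins hl) hne with
        ⟨e1, e2⟩ | ⟨e1, e2⟩ | ⟨e1, e2⟩ <;> rw [e1, e2] at this <;> norm_num at this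
    have h6 : ∑ L ∈ joins R B, (cnt R L * cnt B L - 4) ≤
        ∑ L ∈ joins R B, (wt R B L + if cnt R L = 3 ∧ cnt B L = 3 then 3 else 0) := by
      refine Finset.sum_le_sum fun L hL => ?_
      split_ifs with hc
      · rw [wt, hc.1, hc.2]; norm_num
      · have := (type L hL).resolve_left hc
        omega
    rw [h.sum_excess, Finset.sum_add_distrib, ← Finset.sum_filter, Finset.sum_const,
      nsmul_eq_mul] at h6
    have := h.sum_wt
    norm_num at h6 this
    omega
  · have := main 2 5 (by norm_num) fun i j h1 h2 h3 h4 h5 => by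
      have h3' : i ≤ 5 := by omega
      have h4' : j ≤ 5 := by omega
      interval_cases i <;> interval_cases j <;> omega
    norm_num at this
  · have := main 2 5 (by norm_num) fun i j h1 h2 h3 h4 h5 => by
      have h3' : i ≤ 5 := by omega
      have h4' : j ≤ 5 := by omega
      interval_cases i <;> interval_cases j <;> omega
    norm_num at this

theorem false (h : EqualCase R B n) : False :=
  (lt_or_ge n 12).elim h.not_small h.not_large

end EqualCase

theorem card_le_sum_cnt {P : Finset (ℝ × ℝ)} {X : Finset (Set (ℝ × ℝ))}
    (h : ∀ p ∈ P, ∃ L ∈ X, p ∈ L) : (P.card : ℤ) ≤ ∑ L ∈ X, cnt P L := by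
  have h1 : P ⊆ X.biUnion (ptsOn P) := fun p hp => by
    obtain ⟨L, hL, hpL⟩ := h p hp
    exact Finset.mem_biUnion.2 ⟨L, hL, mem_ptsOn.2 ⟨hp, hpL⟩⟩
  have h2 := (Finset.card_le_card h1).trans Finset.card_biUnion_le
  simp only [cnt]
  exact_mod_cast h2

theorem cnt_singleton (p : ℝ × ℝ) (L : Set (ℝ × ℝ)) : cnt {p} L = if p ∈ L then 1 else 0 := by
  rw [cnt, ptsOn, Finset.filter_singleton]
  split_ifs <;> simp

theorem sum_cnt_left_through {R B : Finset (ℝ × ℝ)} (hRB : Disjoint R B) {b : ℝ × ℝ}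
    (hb : b ∈ B) : ∑ L ∈ (joins R B).filter (fun L => b ∈ L), cnt R L = R.card := by
  have h := sum_cnt_mul_cnt hRB (Finset.Subset.refl R) (Finset.singleton_subset_iff.2 hb)
  simpa [cnt_singleton, Finset.sum_filter] using h

theorem sum_cnt_right_through {R B : Finset (ℝ × ℝ)} (hRB : Disjoint R B) {r : ℝ × ℝ}
    (hr : r ∈ R) : ∑ L ∈ (joins R B).filter (fun L => r ∈ L), cnt B L = B.card := by
  have h := sum_cnt_left_through hRB.symm hr
  rwa [joins_comm] at h

/-- The properties of a minimal counterexample with `n` red and `n - 1` blue points. -/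
structure UnequalCase (R B : Finset (ℝ × ℝ)) (n : ℤ) : Prop where
  disj : Disjoint R B
  ncR : NC R
  ncB : NC B
  cardR : (R.card : ℤ) = n
  cardB : (B.card : ℤ) = n - 1
  cardJ : ((joins R B).card : ℤ) = 2 * n - 3
  twoR : ∀ L ∈ joins R B, 2 ≤ cnt R L
  special : ∀ L ∈ joins R B, ∀ l ∈ joins R B, cnt B L = 1 → cnt B l = 1 →
    ∀ q ∈ B, q ∈ L → q ∈ l → L = l

/-- The bichromatic lines with exactly one blue point. -/
def specials (R B : Finset (ℝ × ℝ)) : Finset (Set (ℝ × ℝ)) :=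
  (joins R B).filter (fun L => cnt B L = 1)

theorem mem_specials {R B : Finset (ℝ × ℝ)} {L : Set (ℝ × ℝ)} :
    L ∈ specials R B ↔ L ∈ joins R B ∧ cnt B L = 1 := Finset.mem_filter

/-- The correction of `gain` accounting for the lines with exactly one blue point. -/
def corr (R B : Finset (ℝ × ℝ)) (L l : Set (ℝ × ℝ)) : ℤ :=
  if cnt B l = 1 then cnt (ptsOn B L) l * cnt R l else 0

theorem sum_corr (R B : Finset (ℝ × ℝ)) (L : Set (ℝ × ℝ)) :
    ∑ l ∈ (joins R B).erase L, corr R B L l =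
      ∑ l ∈ (specials R B).erase L, cnt (ptsOn B L) l * cnt R l := by
  rw [specials, ← Finset.filter_erase, Finset.sum_filter]
  rfl

namespace UnequalCase

variable {R B : Finset (ℝ × ℝ)} {n : ℤ}

theorem sum_wt (h : UnequalCase R B n) : ∑ L ∈ joins R B, wt R B L ≤ 2 * n - 10 := by
  have := sum_wt_le h.disj h.ncR
  rw [h.cardR, h.cardB, h.cardJ] at this
  linarith

theorem sum_excess (h : UnequalCase R B n) :
    ∑ L ∈ joins R B, (cnt R L * cnt B L - 4) = n ^ 2 - 9 * n + 12 := by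
  rw [sum_sub_four h.disj, h.cardR, h.cardB, h.cardJ]; ring

theorem le_half (h : UnequalCase R B n) {L : Set (ℝ × ℝ)} (hL : L ∈ joins R B) :
    2 * cnt R L ≤ n := by
  rw [← h.cardR]; exact two_mul_cnt_le h.disj h.ncB h.twoR (isLine_of_mem_joins hL)

theorem wt_nonneg (h : UnequalCase R B n) {L : Set (ℝ × ℝ)} (hL : L ∈ joins R B) :
    0 ≤ wt R B L := by
  have h1 := h.twoR L hL
  have h2 := one_le_cnt_right hL
  rw [wt]
  rcases eq_or_lt_of_le h2 with h3 | h3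
  · rw [← h3]; nlinarith
  · nlinarith [sq_nonneg (cnt R L - cnt B L)]

theorem le_wt_of_special (h : UnequalCase R B n) {L : Set (ℝ × ℝ)} (hL : L ∈ specials R B) :
    4 * (cnt R L - 2) ≤ wt R B L := by
  rw [mem_specials] at hL
  have h1 := h.twoR L hL.1
  rw [wt, hL.2]
  rcases eq_or_lt_of_le h1 with h3 | h3
  · rw [← h3]; norm_num
  · nlinarith

theorem sum_wt_of_subset (h : UnequalCase R B n) {s : Finset (Set (ℝ × ℝ))}
    (hs : s ⊆ joins R B) : ∑ L ∈ s, wt R B L ≤ 2 * n - 10 :=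
  (Finset.sum_le_sum_of_subset_of_nonneg hs fun _ hL _ => h.wt_nonneg hL).trans h.sum_wt

theorem wt_le (h : UnequalCase R B n) {L : Set (ℝ × ℝ)} (hL : L ∈ joins R B) :
    wt R B L ≤ 2 * n - 10 := by
  simpa using h.sum_wt_of_subset (Finset.singleton_subset_iff.2 hL)

theorem sum_specials_wt (h : UnequalCase R B n) :
    4 * (∑ L ∈ specials R B, cnt R L - 2 * (specials R B).card) ≤
      ∑ L ∈ specials R B, wt R B L := by
  have := Finset.sum_le_sum fun L hL => h.le_wt_of_special (L := L) hL
  rw [← Finset.mul_sum, Finset.sum_sub_distrib, Finset.sum_const, nsmul_eq_mul] at this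
  linarith

theorem wt_add_sum_specials (h : UnequalCase R B n) {L : Set (ℝ × ℝ)} (hL : L ∈ joins R B)
    (hL2 : cnt B L ≠ 1) : wt R B L + ∑ l ∈ specials R B, wt R B l ≤ 2 * n - 10 := by
  have hn : L ∉ specials R B := fun hc => hL2 (mem_specials.1 hc).2
  rw [← Finset.sum_insert hn]
  exact h.sum_wt_of_subset (Finset.insert_subset hL (Finset.filter_subset _ _))

theorem gain_add_corr_nonneg (h : UnequalCase R B n) {L l : Set (ℝ × ℝ)} (hL : L ∈ joins R B)
    (hl : l ∈ joins R B) (hne : L ≠ l) : 0 ≤ gain R B L l + corr R B L l := by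
  have h1 := h.twoR l hl
  have h2 := one_le_cnt_right hl
  rw [gain, corr]
  rcases cnt_ptsOn_cases h.disj (isLine_of_mem_joins hL) (isLine_of_mem_joins hl) hne with
    ⟨e1, e2⟩ | ⟨e1, e2⟩ | ⟨e1, e2⟩ <;> rw [e1, e2] <;> split_ifs with h3
  all_goals try rw [h3]
  all_goals try nlinarith
  have : 2 ≤ cnt B l := by omega
  nlinarith

/-- The sum of the corrections over all lines other than `L`. -/
abbrev total (R B : Finset (ℝ × ℝ)) (L : Set (ℝ × ℝ)) : ℤ :=
  ∑ l ∈ (joins R B).erase L, corr R B L l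

theorem sum_gain_le (h : UnequalCase R B n) {L : Set (ℝ × ℝ)} (hL : L ∈ joins R B)
    {s : Finset (Set (ℝ × ℝ))} (hs : s ⊆ (joins R B).erase L) :
    ∑ l ∈ s, (gain R B L l + corr R B L l) ≤
      n * (n - 1) - 2 * cnt R L * (n - 1) - 2 * n * cnt B L + 3 * cnt R L * cnt B L
        + total R B L := by
  have h1 := sum_gain h.disj hL
  rw [h.cardR, h.cardB] at h1
  rw [← h1, total, ← Finset.sum_add_distrib]
  exact Finset.sum_le_sum_of_subset_of_nonneg hs fun l hl _ =>
    h.gain_add_corr_nonneg hL (Finset.mem_of_mem_erase hl) (Finset.mem_erase.1 hl).1.symm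

theorem delta_nonneg (h : UnequalCase R B n) {L : Set (ℝ × ℝ)} (hL : L ∈ joins R B) :
    0 ≤ n * (n - 1) - 2 * cnt R L * (n - 1) - 2 * n * cnt B L + 3 * cnt R L * cnt B L
        + total R B L := by
  simpa using h.sum_gain_le hL (Finset.empty_subset _)

theorem cnt_ptsOn_le (h : UnequalCase R B n) {L l : Set (ℝ × ℝ)} (hL : L ∈ joins R B)
    (hl : l ∈ joins R B) (hne : L ≠ l) : cnt (ptsOn B L) l ≤ 1 := by
  rcases cnt_ptsOn_cases h.disj (isLine_of_mem_joins hL) (isLine_of_mem_joins hl) hne with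
    ⟨-, e⟩ | ⟨-, e⟩ | ⟨-, e⟩ <;> rw [e] <;> norm_num

theorem total_le_sum (h : UnequalCase R B n) {L : Set (ℝ × ℝ)} (hL : L ∈ joins R B) :
    total R B L ≤ ∑ l ∈ specials R B, cnt R l := by
  rw [total, sum_corr]
  refine (Finset.sum_le_sum (g := fun l => cnt R l) fun l hl => ?_).trans
    (Finset.sum_le_sum_of_subset_of_nonneg (Finset.erase_subset _ _) fun l _ _ => cnt_nonneg R l)
  rw [Finset.mem_erase, mem_specials] at hl
  have := h.cnt_ptsOn_le hL hl.2.1 hl.1.symm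
  nlinarith [cnt_nonneg R l]

theorem sum_specials_cnt_le (h : UnequalCase R B n) (L : Set (ℝ × ℝ)) :
    ∑ l ∈ specials R B, cnt (ptsOn B L) l ≤ cnt B L := by
  have e : ∀ l, cnt (ptsOn B L) l = ∑ b ∈ ptsOn B L, if b ∈ l then 1 else 0 := fun l => by
    rw [cnt, ptsOn, Finset.card_filter]; push_cast; rfl
  have e2 : cnt B L = ∑ b ∈ ptsOn B L, 1 := by rw [cnt]; simp
  rw [e2, Finset.sum_congr rfl fun l _ => e l, Finset.sum_comm]
  refine Finset.sum_le_sum fun b hb => ?_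
  rw [← Finset.sum_filter, Finset.sum_const, nsmul_eq_mul, mul_one]
  have : ((specials R B).filter (fun l => b ∈ l)).card ≤ 1 := by
    rw [Finset.card_le_one]
    intro l hl m hm
    rw [Finset.mem_filter, mem_specials] at hl hm
    exact h.special l hl.1.1 m hm.1.1 hl.1.2 hm.1.2 b (mem_ptsOn.1 hb).1 hl.2 hm.2
  exact_mod_cast this

theorem total_le (h : UnequalCase R B n) {L : Set (ℝ × ℝ)} (hL : L ∈ joins R B) :
    total R B L ≤ 2 * cnt B L + (∑ l ∈ specials R B, cnt R l - 2 * (specials R B).card) := by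
  have h1 := h.sum_specials_cnt_le L
  rw [total, sum_corr]
  have h2 : ∑ l ∈ (specials R B).erase L, cnt (ptsOn B L) l * cnt R l ≤
      ∑ l ∈ (specials R B).erase L, (2 * cnt (ptsOn B L) l + (cnt R l - 2)) := by
    refine Finset.sum_le_sum fun l hl => ?_
    rw [Finset.mem_erase, mem_specials] at hl
    have h3 := h.cnt_ptsOn_le hL hl.2.1 hl.1.symm
    have h4 := h.twoR l hl.2.1
    nlinarith
  have h3 : ∑ l ∈ (specials R B).erase L, (2 * cnt (ptsOn B L) l + (cnt R l - 2)) ≤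
      ∑ l ∈ specials R B, (2 * cnt (ptsOn B L) l + (cnt R l - 2)) :=
    Finset.sum_le_sum_of_subset_of_nonneg (Finset.erase_subset _ _) fun l hl _ => by
      have h4 := h.twoR l (mem_specials.1 hl).1
      have h5 := cnt_nonneg (ptsOn B L) l
      linarith
  rw [Finset.sum_add_distrib (s := specials R B), ← Finset.mul_sum, Finset.sum_sub_distrib,
    Finset.sum_const, nsmul_eq_mul] at h3
  linarith

theorem point_bound (h : UnequalCase R B n) {L : Set (ℝ × ℝ)} (hL : L ∈ joins R B)
    (hL2 : cnt B L ≠ 1) :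
    0 ≤ 4 * (n * (n - 1) - 2 * cnt R L * (n - 1) - 2 * n * cnt B L + 3 * cnt R L * cnt B L)
      + 8 * cnt B L + (2 * n - 10) - wt R B L := by
  have h1 := h.delta_nonneg hL
  have h2 := h.total_le hL
  have h3 := h.sum_specials_wt
  have h4 := h.wt_add_sum_specials hL hL2
  linarith

theorem weighted (h : UnequalCase R B n) {a b : ℤ} (hb : 0 ≤ b) (g : Set (ℝ × ℝ) → ℤ)
    (H : ∀ L ∈ joins R B, a * (cnt R L * cnt B L - 4) ≤ b * wt R B L + g L) :
    a * (n ^ 2 - 9 * n + 12) ≤ b * (2 * n - 10) + ∑ L ∈ joins R B, g L := by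
  have h1 := Finset.sum_le_sum H
  rw [Finset.sum_add_distrib, ← Finset.mul_sum, ← Finset.mul_sum, h.sum_excess] at h1
  have := mul_le_mul_of_nonneg_left h.sum_wt hb
  linarith

theorem weighted_zero (h : UnequalCase R B n) {a b : ℤ} (hb : 0 ≤ b)
    (H : ∀ L ∈ joins R B, a * (cnt R L * cnt B L - 4) ≤ b * wt R B L) :
    a * (n ^ 2 - 9 * n + 12) ≤ b * (2 * n - 10) := by
  simpa using h.weighted hb (fun _ => 0) (by simpa using H)

theorem not_fourteen_le (h : UnequalCase R B n) (hn : 14 ≤ n) : False := by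
  have key : ∀ L ∈ joins R B, 4 * (cnt R L * cnt B L - 4) ≤ (n + 3) * wt R B L := by
    intro L hL
    have h1 := h.twoR L hL
    have h2 := one_le_cnt_right hL
    have h3 := h.le_half hL
    have h5 := h.point_bound hL
    have hw := h.wt_nonneg hL
    rw [wt] at *
    generalize cnt R L = i at *
    generalize cnt B L = j at *
    have hs : i + j ≤ n - 1 := by
      by_contra! hc
      have h5 := h5 (by omega)
      obtain ⟨t, ht⟩ : ∃ t, j = n - i + t := ⟨j - n + i, by ring⟩
      have ht0 : 0 ≤ t := by omega
      subst ht
      nlinarith [sq_nonneg (n - 2 * i), mul_nonneg ht0 (by linarith : 0 ≤ n - 2 * i),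
        mul_nonneg ht0 (by linarith : 0 ≤ n)]
    have h6 : 4 * (i * j - 4) ≤ (i + j + 4) * (i + j + (i - j) ^ 2 - 4) := by
      nlinarith [mul_nonneg (by omega : 0 ≤ i + j + 3) (sq_nonneg (i - j))]
    nlinarith
  have := h.weighted_zero (by omega) key
  nlinarith

/-- Numerical constraints on the numbers of red and blue points of a bichromatic line. -/
structure Adm (n i j : ℤ) : Prop where
  two_le : 2 ≤ i
  one_le : 1 ≤ j
  half : 2 * i ≤ n
  weight : i + j + (i - j) ^ 2 - 4 ≤ 2 * n - 10
  bound : j ≠ 1 → 0 ≤ 4 * (n * (n - 1) - 2 * i * (n - 1) - 2 * n * j + 3 * i * j)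
      + 8 * j + (2 * n - 10) - (i + j + (i - j) ^ 2 - 4)

theorem adm (h : UnequalCase R B n) {L : Set (ℝ × ℝ)} (hL : L ∈ joins R B) :
    Adm n (cnt R L) (cnt B L) :=
  ⟨h.twoR L hL, one_le_cnt_right hL, h.le_half hL, h.wt_le hL, h.point_bound hL⟩

theorem Adm.le {i j : ℤ} (h : Adm n i j) (hn : n ≤ 13) : i ≤ 6 ∧ j ≤ 10 := by
  have h1 := h.half
  have h2 := h.weight
  have h3 := h.two_le
  refine ⟨by omega, ?_⟩
  by_contra! hc
  nlinarith

theorem eq_of_blue_of_red (h : UnequalCase R B n) {L l : Set (ℝ × ℝ)} (hL : L ∈ joins R B)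
    (hl : l ∈ joins R B) {b r : ℝ × ℝ} (hb : b ∈ B) (hr : r ∈ R) (hbL : b ∈ L) (hbl : b ∈ l)
    (hrL : r ∈ L) (hrl : r ∈ l) : L = l :=
  (isLine_of_mem_joins hL).eq_of_mem (isLine_of_mem_joins hl)
    (fun e : b = r => Finset.disjoint_left.1 h.disj hr (e ▸ hb)) hbL hrL hbl hrl

end UnequalCase

namespace UnequalCase

variable {R B : Finset (ℝ × ℝ)} {n : ℤ}

theorem not_thirteen (h : UnequalCase R B 13) : False := by
  have key : ∀ i j : ℤ, Adm 13 i j → 2 * (i * j - 4) ≤ 7 * (i + j + (i - j) ^ 2 - 4) := by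
    intro i j ha
    obtain ⟨hi, hj⟩ := ha.le (by norm_num)
    obtain ⟨h1, h2, h3, h4, h5⟩ := ha
    interval_cases i <;> interval_cases j <;> omega
  have := h.weighted_zero (by norm_num) fun L hL => key _ _ (h.adm hL)
  norm_num at this

theorem not_twelve (h : UnequalCase R B 12) : False := by
  have key : ∀ i j : ℤ, Adm 12 i j → 1 * (i * j - 4) ≤ 3 * (i + j + (i - j) ^ 2 - 4) := by
    intro i j ha
    obtain ⟨hi, hj⟩ := ha.le (by norm_num)
    obtain ⟨h1, h2, h3, h4, h5⟩ := ha
    interval_cases i <;> interval_cases j <;> omega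
  have := h.weighted_zero (by norm_num) fun L hL => key _ _ (h.adm hL)
  norm_num at this

theorem not_eleven (h : UnequalCase R B 11) : False := by
  by_cases h44 : ∃ L ∈ joins R B, cnt R L = 4 ∧ cnt B L = 4
  · obtain ⟨L, hL, hi, hj⟩ := h44
    have h1 := h.delta_nonneg hL
    have h2 := h.total_le hL
    have h3 := h.sum_specials_wt
    rw [hi, hj] at h1
    rw [hj] at h2
    have key : ∀ i j : ℤ, Adm 11 i j → 4 * (i * j - 4) ≤ 12 * (i + j + (i - j) ^ 2 - 4) +
        (if j = 1 then - 11 * (i + j + (i - j) ^ 2 - 4) else 0) := by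
      intro i j ha
      obtain ⟨hi, hj⟩ := ha.le (by norm_num)
      obtain ⟨h1, h2, h3, h4, h5⟩ := ha
      interval_cases i <;> interval_cases j <;> norm_num at *
    have h4 := h.weighted (by norm_num) _ fun L hL => key _ _ (h.adm hL)
    rw [← Finset.sum_filter, ← Finset.mul_sum] at h4
    change _ ≤ _ + -11 * ∑ L ∈ specials R B, wt R B L at h4
    norm_num at h1 h4
    linarith
  · have key : ∀ i j : ℤ, Adm 11 i j → ¬ (i = 4 ∧ j = 4) →
        2 * (i * j - 4) ≤ 5 * (i + j + (i - j) ^ 2 - 4) := by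
      intro i j ha
      obtain ⟨hi, hj⟩ := ha.le (by norm_num)
      obtain ⟨h1, h2, h3, h4, h5⟩ := ha
      interval_cases i <;> interval_cases j <;> omega
    have := h.weighted_zero (by norm_num) fun L hL =>
      key _ _ (h.adm hL) fun hc => h44 ⟨L, hL, hc⟩
    norm_num at this

theorem card_three_three_le (h : UnequalCase R B n) {L : Set (ℝ × ℝ)} (hL : L ∈ joins R B)
    (hL1 : cnt R L = 3) (hL2 : cnt B L = 3) :
    3 * (((joins R B).filter (fun l => cnt R l = 3 ∧ cnt B l = 3)).card : ℤ) ≤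
      n * (n - 1) - 12 * n + 36 + ∑ l ∈ specials R B, cnt R l := by
  have h1 := h.sum_gain_le hL
    (s := ((joins R B).filter (fun l => cnt R l = 3 ∧ cnt B l = 3)).erase L)
    (Finset.erase_subset_erase _ (Finset.filter_subset _ _))
  have h2 := h.total_le_sum hL
  have h3 : ∑ l ∈ ((joins R B).filter (fun l => cnt R l = 3 ∧ cnt B l = 3)).erase L, (3 : ℤ) ≤
      ∑ l ∈ ((joins R B).filter (fun l => cnt R l = 3 ∧ cnt B l = 3)).erase L,
        (gain R B L l + corr R B L l) := by
    refine Finset.sum_le_sum fun l hl => ?_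
    rw [Finset.mem_erase, Finset.mem_filter] at hl
    obtain ⟨hne, hl, hl1, hl2⟩ := hl
    rw [gain, corr, hl1, hl2]
    rcases cnt_ptsOn_cases h.disj (isLine_of_mem_joins hL) (isLine_of_mem_joins hl) hne.symm with
      ⟨e1, e2⟩ | ⟨e1, e2⟩ | ⟨e1, e2⟩ <;> rw [e1, e2] <;> norm_num
  rw [Finset.sum_const, nsmul_eq_mul, Finset.cast_card_erase_of_mem
    (Finset.mem_filter.2 ⟨hL, hL1, hL2⟩)] at h3
  rw [hL1, hL2] at h1
  linarith

theorem not_ten (h : UnequalCase R B 10) : False := by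
  have key : ∀ i j : ℤ, Adm 10 i j → 2 * (i * j - 4) ≤ 5 * (i + j + (i - j) ^ 2 - 4) +
      (if j = 1 then - 2 * i else 0) := by
    intro i j ha
    obtain ⟨hi, hj⟩ := ha.le (by norm_num)
    obtain ⟨h1, h2, h3, h4, h5⟩ := ha
    interval_cases i <;> interval_cases j <;> norm_num at *
  have h1 := h.weighted (by norm_num) _ fun L hL => key _ _ (h.adm hL)
  rw [← Finset.sum_filter, ← Finset.mul_sum] at h1
  change _ ≤ _ + -2 * ∑ L ∈ specials R B, cnt R L at h1
  have key2 : ∀ i j : ℤ, Adm 10 i j → - 3 ≤ 90 - 18 * i - 20 * j + 3 * i * j →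
      1 * (i * j - 4) ≤ 1 * (i + j + (i - j) ^ 2 - 4) + (if i = 3 ∧ j = 3 then 3 else 0) := by
    intro i j ha hd
    obtain ⟨hi, hj⟩ := ha.le (by norm_num)
    obtain ⟨h1, h2, h3, h4, h5⟩ := ha
    interval_cases i <;> interval_cases j <;> norm_num at *
  have h2 := h.weighted (by norm_num) _ fun L hL => key2 _ _ (h.adm hL) (by
    have h3 := h.delta_nonneg hL
    have h4 := h.total_le_sum hL
    linarith)
  rw [← Finset.sum_filter, Finset.sum_const, nsmul_eq_mul] at h2
  by_cases h33 : ∃ L ∈ joins R B, cnt R L = 3 ∧ cnt B L = 3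
  · obtain ⟨L, hL, hi, hj⟩ := h33
    have h3 := h.card_three_three_le hL hi hj
    norm_num at h1 h2 h3
    omega
  · rw [Finset.filter_false_of_mem fun L hL hc => h33 ⟨L, hL, hc⟩] at h2
    norm_num at h2

theorem not_nine (h : UnequalCase R B 9) : False := by
  have key : ∀ i j : ℤ, Adm 9 i j → 2 * (i * j - 4) ≤ 5 * (i + j + (i - j) ^ 2 - 4) +
      (if j = 1 then - 2 * i else 0) := by
    intro i j ha
    obtain ⟨hi, hj⟩ := ha.le (by norm_num)
    obtain ⟨h1, h2, h3, h4, h5⟩ := ha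
    interval_cases i <;> interval_cases j <;> norm_num at *
  have h1 := h.weighted (by norm_num) _ fun L hL => key _ _ (h.adm hL)
  rw [← Finset.sum_filter, ← Finset.mul_sum] at h1
  change _ ≤ _ + -2 * ∑ L ∈ specials R B, cnt R L at h1
  have key2 : ∀ i j : ℤ, Adm 9 i j → 1 * (i * j - 4) ≤ 1 * (i + j + (i - j) ^ 2 - 4) +
      ((if i = 3 ∧ j = 3 then 3 else 0) + (if j = 1 then - 1 * i else 0)) := by
    intro i j ha
    obtain ⟨hi, hj⟩ := ha.le (by norm_num)
    obtain ⟨h1, h2, h3, h4, h5⟩ := ha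
    interval_cases i <;> interval_cases j <;> norm_num at *
  have h2 := h.weighted (by norm_num) _ fun L hL => key2 _ _ (h.adm hL)
  rw [Finset.sum_add_distrib, ← Finset.sum_filter, ← Finset.sum_filter, ← Finset.mul_sum,
    Finset.sum_const, nsmul_eq_mul] at h2
  change _ ≤ _ + (_ + -1 * ∑ L ∈ specials R B, cnt R L) at h2
  by_cases h33 : ∃ L ∈ joins R B, cnt R L = 3 ∧ cnt B L = 3
  · obtain ⟨L, hL, hi, hj⟩ := h33
    have h3 := h.card_three_three_le hL hi hj
    have h4 := h.delta_nonneg hL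
    have h5 := h.total_le_sum hL
    rw [hi, hj] at h4
    norm_num at h1 h2 h3 h4
    omega
  · rw [Finset.filter_false_of_mem fun L hL hc => h33 ⟨L, hL, hc⟩] at h2
    have h5 : 0 ≤ ∑ L ∈ specials R B, cnt R L := Finset.sum_nonneg fun L _ => cnt_nonneg R L
    norm_num at h2
    linarith

theorem exists_odd_right (h : UnequalCase R B 8) {r : ℝ × ℝ} (hr : r ∈ R) :
    ∃ L ∈ joins R B, r ∈ L ∧ ¬ (2 ∣ cnt B L) := by
  by_contra! hc
  have h1 := sum_cnt_right_through h.disj hr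
  have h2 : (2 : ℤ) ∣ ∑ L ∈ (joins R B).filter (fun L => r ∈ L), cnt B L :=
    Finset.dvd_sum fun L hL => hc L (Finset.mem_filter.1 hL).1 (Finset.mem_filter.1 hL).2
  rw [h1, h.cardB] at h2
  norm_num at h2

theorem not_three_three_eight (h : UnequalCase R B 8) {L : Set (ℝ × ℝ)} (hL : L ∈ joins R B)
    (hi : cnt R L = 3) (hj : cnt B L = 3) : False := by
  have key : ∀ i j : ℤ, Adm 8 i j → 2 * (i * j - 4) ≤ 5 * (i + j + (i - j) ^ 2 - 4) +
      (if j = 1 then 2 * i - 8 - 5 * (i + j + (i - j) ^ 2 - 4) else 0) := by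
    intro i j ha
    obtain ⟨hi, hj⟩ := ha.le (by norm_num)
    obtain ⟨h1, h2, h3, h4, h5⟩ := ha
    interval_cases i <;> interval_cases j <;> norm_num at *
  have h1 := h.weighted (by norm_num) _ fun L hL => key _ _ (h.adm hL)
  rw [← Finset.sum_filter, Finset.sum_sub_distrib, Finset.sum_sub_distrib, ← Finset.mul_sum,
    ← Finset.mul_sum, Finset.sum_const, nsmul_eq_mul] at h1
  change _ ≤ _ + (2 * ∑ L ∈ specials R B, cnt R L - (specials R B).card * 8 -
    5 * ∑ L ∈ specials R B, wt R B L) at h1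
  have h2 := h.delta_nonneg hL
  have h3 := h.total_le_sum hL
  have h4 := h.total_le hL
  have h5 := h.sum_specials_wt
  rw [hi, hj] at h2
  rw [hj] at h4
  norm_num at h1 h2
  linarith

theorem not_eight (h : UnequalCase R B 8) : False := by
  have key : ∀ i j : ℤ, Adm 8 i j → ¬ (i = 3 ∧ j = 3) →
      1 * (i * j - 4) ≤ 1 * (i + j + (i - j) ^ 2 - 4) +
      ((if j = 1 then - 2 else 0) + (if i = 3 ∧ j = 1 then - 3 else 0)) := by
    intro i j ha hn
    obtain ⟨hi, hj⟩ := ha.le (by norm_num)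
    obtain ⟨h1, h2, h3, h4, h5⟩ := ha
    interval_cases i <;> interval_cases j <;> norm_num at *
  have h1 := h.weighted (by norm_num) _ fun L hL => key _ _ (h.adm hL)
    fun hc => h.not_three_three_eight hL hc.1 hc.2
  rw [Finset.sum_add_distrib, ← Finset.sum_filter, ← Finset.sum_filter, Finset.sum_const,
    Finset.sum_const, nsmul_eq_mul, nsmul_eq_mul] at h1
  change _ ≤ _ + (((specials R B).card : ℤ) * -2 + _) at h1
  have h31 : ∀ L ∈ joins R B, ¬ (cnt R L = 3 ∧ cnt B L = 1) := by
    intro L hL hc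
    have e1 : 1 ≤ (specials R B).card := Finset.card_pos.2 ⟨L, mem_specials.2 ⟨hL, hc.2⟩⟩
    have e2 : 1 ≤ ((joins R B).filter (fun l => cnt R l = 3 ∧ cnt B l = 1)).card :=
      Finset.card_pos.2 ⟨L, Finset.mem_filter.2 ⟨hL, hc⟩⟩
    norm_num at h1
    omega
  have hs : (specials R B).card ≤ 1 := by
    norm_num at h1
    omega
  have odd : ∀ i j : ℤ, Adm 8 i j → ¬ (i = 3 ∧ j = 3) → ¬ (i = 3 ∧ j = 1) → ¬ 2 ∣ j →
      i = 2 ∧ (j = 1 ∨ j = 3) := by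
    intro i j ha hn hn' h2
    obtain ⟨hi, hj⟩ := ha.le (by norm_num)
    obtain ⟨h1, h2, h3, h4, h5⟩ := ha
    interval_cases i <;> interval_cases j <;> omega
  have odd' : ∀ L ∈ joins R B, ¬ 2 ∣ cnt B L → cnt R L = 2 ∧ (cnt B L = 1 ∨ cnt B L = 3) :=
    fun L hL => odd _ _ (h.adm hL) (fun hc => h.not_three_three_eight hL hc.1 hc.2) (h31 L hL)
  set X := (joins R B).filter (fun L => cnt R L = 2 ∧ cnt B L = 3)
  have hX : ∀ L ∈ X, L ∈ joins R B ∧ cnt R L = 2 ∧ cnt B L = 3 := fun L hL =>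
    Finset.mem_filter.1 hL
  have hcover := card_le_sum_cnt (P := R) (X := specials R B ∪ X) fun r hr => by
    obtain ⟨L, hL, hrL, ho⟩ := h.exists_odd_right hr
    obtain ⟨e1, e2⟩ := odd' L hL ho
    refine ⟨L, Finset.mem_union.2 ?_, hrL⟩
    exact e2.imp (fun e => mem_specials.2 ⟨hL, e⟩) fun e => Finset.mem_filter.2 ⟨hL, e1, e⟩
  rw [h.cardR, Finset.sum_congr rfl (g := fun _ => 2) fun L hL => by
    rcases Finset.mem_union.1 hL with hL | hL
    · rw [mem_specials] at hL
      exact (odd' L hL.1 (by rw [hL.2]; norm_num)).1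
    · exact (hX L hL).2.1, Finset.sum_const, nsmul_eq_mul] at hcover
  have hX3 : 1 < X.card := by
    have := Finset.card_union_le (specials R B) X
    omega
  have hrho : ∑ L ∈ specials R B, cnt R L = 2 * (specials R B).card := by
    rw [Finset.sum_congr rfl (g := fun _ => 2) fun L hL => by
      rw [mem_specials] at hL
      exact (odd' L hL.1 (by rw [hL.2]; norm_num)).1, Finset.sum_const, nsmul_eq_mul, mul_comm]
  obtain ⟨L, hL, l, hl, hne⟩ := Finset.one_lt_card.1 hX3
  have tot : ∀ L ∈ X, 2 ≤ total R B L ∧ total R B L ≤ 2 := fun L hL => by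
    have h2 := h.delta_nonneg (hX L hL).1
    have h3 := h.total_le_sum (hX L hL).1
    rw [(hX L hL).2.1, (hX L hL).2.2] at h2
    refine ⟨by linarith, ?_⟩
    omega
  have hblue : ∃ m ∈ specials R B, ∀ L ∈ X, ∃ b ∈ B, b ∈ L ∧ b ∈ m := by
    have ex : ∀ L ∈ X, ∃ m ∈ specials R B, ∃ b ∈ B, b ∈ L ∧ b ∈ m := fun L hL => by
      by_contra! hc
      have h1 := (tot L hL).1
      rw [total, sum_corr, Finset.sum_eq_zero] at h1
      · norm_num at h1
      · intro m hm
        have : ¬ 1 ≤ cnt (ptsOn B L) m := fun h1 => by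
          obtain ⟨b, hb, hbm⟩ := one_le_cnt_iff.1 h1
          rw [mem_ptsOn] at hb
          exact hc m (Finset.mem_of_mem_erase hm) b hb.1 hb.2 hbm
        have h0 := cnt_nonneg (ptsOn B L) m
        rw [show cnt (ptsOn B L) m = 0 by omega, zero_mul]
    obtain ⟨m, hm, -⟩ := ex L hL
    refine ⟨m, hm, fun L' hL' => ?_⟩
    obtain ⟨m', hm', hb⟩ := ex L' hL'
    rwa [Finset.card_le_one.1 hs m hm m' hm']
  obtain ⟨m, hm, hb⟩ := hblue
  obtain ⟨b, hbB, hbL, hbm⟩ := hb L hL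
  obtain ⟨b', hbB', hbl, hbm'⟩ := hb l hl
  obtain rfl : b = b' := by
    by_contra hbb
    have := two_le_cnt hbB hbB' hbb hbm hbm'
    rw [(mem_specials.1 hm).2] at this
    norm_num at this
  have h5 := h.sum_gain_le (hX L hL).1 (s := {l})
    (Finset.singleton_subset_iff.2 (Finset.mem_erase.2 ⟨hne.symm, (hX l hl).1⟩))
  have h6 := (tot L hL).2
  rw [Finset.sum_singleton, gain, corr, (hX l hl).2.1, (hX l hl).2.2, (hX L hL).2.1,
    (hX L hL).2.2] at h5
  rcases cnt_ptsOn_cases h.disj (isLine_of_mem_joins (hX L hL).1)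
    (isLine_of_mem_joins (hX l hl).1) hne with ⟨e1, e2⟩ | ⟨e1, e2⟩ | ⟨e1, e2⟩
  · rw [e1, e2] at h5; norm_num at h5; linarith
  · obtain ⟨r, hr, hrl⟩ := one_le_cnt_iff.1 e1.ge
    rw [mem_ptsOn] at hr
    exact hne (h.eq_of_blue_of_red (hX L hL).1 (hX l hl).1 hbB hr.1 hbL hbl hr.2 hrl)
  · rw [e1, e2] at h5; norm_num at h5; linarith

theorem not_seven (h : UnequalCase R B 7) : False := by
  have key : ∀ i j : ℤ, Adm 7 i j → i = 3 → j ≤ i + j + (i - j) ^ 2 - 4 := by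
    intro i j ha hi
    obtain ⟨-, hj⟩ := ha.le (by norm_num)
    obtain ⟨h1, h2, h3, h4, h5⟩ := ha
    subst hi
    interval_cases j <;> omega
  have h1 := card_le_sum_cnt (P := B) (X := (joins R B).filter (fun L => cnt R L = 3))
    fun b hb => by
      by_contra! hc
      have h1 := sum_cnt_left_through h.disj hb
      have h2 : (2 : ℤ) ∣ ∑ L ∈ (joins R B).filter (fun L => b ∈ L), cnt R L := by
        refine Finset.dvd_sum fun L hL => ?_
        rw [Finset.mem_filter] at hL
        have h3 := h.le_half hL.1
        have h4 := h.twoR L hL.1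
        have h5 : cnt R L ≠ 3 := fun e => hc L (Finset.mem_filter.2 ⟨hL.1, e⟩) hL.2
        omega
      rw [h1, h.cardR] at h2
      norm_num at h2
  have h2 := h.sum_wt_of_subset (Finset.filter_subset (fun L => cnt R L = 3) (joins R B))
  have h3 := Finset.sum_le_sum (s := (joins R B).filter (fun L => cnt R L = 3))
    (f := fun L => cnt B L) (g := fun L => wt R B L) fun L hL => by
      rw [Finset.mem_filter] at hL
      exact key _ _ (h.adm hL.1) hL.2
  rw [h.cardB] at h1
  linarith

theorem not_le_five (h : UnequalCase R B n) (hn : n ≤ 5) : False := by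
  have h0 : 0 ≤ 2 * n - 10 := (Finset.sum_nonneg fun L hL => h.wt_nonneg hL).trans h.sum_wt
  obtain rfl : n = 5 := by omega
  have h1 := h.cardB
  obtain ⟨b, hb⟩ : B.Nonempty := Finset.card_pos.1 (by omega)
  have h1 := sum_cnt_left_through h.disj hb
  have h2 : (2 : ℤ) ∣ ∑ L ∈ (joins R B).filter (fun L => b ∈ L), cnt R L := by
    refine Finset.dvd_sum fun L hL => ?_
    rw [Finset.mem_filter] at hL
    have h3 := h.le_half hL.1
    have h4 := h.twoR L hL.1
    omega
  rw [h1, h.cardR] at h2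
  norm_num at h2

end UnequalCase

/-- Twice the signed area of a triangle. -/
def area (p q r : ℝ × ℝ) : ℝ := cr (q - p) (r - p)

theorem mem_ln_iff_area {p q r : ℝ × ℝ} : r ∈ ln p q ↔ area p q r = 0 := Iff.rfl

theorem area_mul_sub (u v w p q : ℝ × ℝ) :
    area u w p * area u v q - area u w q * area u v p = area u w v * area u p q := by
  simp only [area, cr, Prod.fst_sub, Prod.snd_sub]; ring

theorem projected_collinear {u v p q r : ℝ × ℝ} (w : ℝ × ℝ) (hp : area u v p ≠ 0)
    (hq : area u v q ≠ 0) (hr : area u v r ≠ 0) (h : area p q r = 0) :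
    (area u w q / area u v q - area u w p / area u v p) *
      (area v w r / area u v r - area v w p / area u v p) =
    (area u w r / area u v r - area u w p / area u v p) *
      (area v w q / area u v q - area v w p / area u v p) := by
  have key : area u w p * (area v w q * area u v r - area v w r * area u v q)
      - area u w q * (area v w p * area u v r - area v w r * area u v p)
      + area u w r * (area v w p * area u v q - area v w q * area u v p) =
      area u v w ^ 2 * area p q r := by
    simp only [area, cr, Prod.fst_sub, Prod.snd_sub]; ring
  rw [h, mul_zero] at key
  field_simp
  linear_combination area u v p * key

theorem false_of_products {x₁ x₂ x₃ y₁ y₂ y₃ : ℝ} (hx : x₁ ≠ x₂) (hy : y₁ ≠ y₂)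
    (h₁ : (x₁ - x₂) * (y₁ - y₂) = (x₂ - x₃) * (y₂ - y₃))
    (h₂ : (x₁ - x₂) * (y₁ - y₂) = (x₁ - x₃) * (y₁ - y₃)) : False := by
  obtain ⟨a, ha⟩ : ∃ a, a = x₁ - x₂ := ⟨_, rfl⟩
  obtain ⟨b, hb⟩ : ∃ b, b = x₂ - x₃ := ⟨_, rfl⟩
  obtain ⟨c, hc⟩ : ∃ c, c = y₁ - y₂ := ⟨_, rfl⟩
  obtain ⟨d, hd⟩ : ∃ d, d = y₂ - y₃ := ⟨_, rfl⟩
  have ha0 : a ≠ 0 := ha ▸ sub_ne_zero.2 hx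
  have hc0 : c ≠ 0 := hc ▸ sub_ne_zero.2 hy
  rw [← ha, ← hb, ← hc, ← hd] at h₁
  rw [← ha, ← hc, show x₁ - x₃ = a + b by rw [ha, hb]; ring,
    show y₁ - y₃ = c + d by rw [hc, hd]; ring] at h₂
  have h : c * (a ^ 2 + a * b + b ^ 2) = 0 := by linear_combination (-b) * h₂ + (a + b) * h₁
  have h' : a ^ 2 + a * b + b ^ 2 = 0 := (mul_eq_zero.1 h).resolve_left hc0
  have : 0 < a ^ 2 := by positivity
  nlinarith [sq_nonneg (a + 2 * b)]

/-- The six points cut out by the lines joining `u` and `v` to three points `s k` do not satisfy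
the three collinearities suggested by the symmetry of the configuration. -/
theorem false_of_configuration {u v : ℝ × ℝ} {s : Fin 3 → ℝ × ℝ} {r : Fin 3 → Fin 3 → ℝ × ℝ}
    (hs : ∀ k, s k ∉ ln u v) (hr : ∀ i j, i ≠ j → r i j ∉ ln u v)
    (hu : ∀ i j, i ≠ j → r i j ∈ ln u (s i)) (hv : ∀ i j, i ≠ j → r i j ∈ ln v (s j))
    (hus : ∀ i j, i ≠ j → s j ∉ ln u (s i)) (hvs : ∀ i j, i ≠ j → s j ∉ ln v (s i))
    (hk : ∀ i j k, i ≠ j → i ≠ k → j ≠ k → r j i ∈ ln (s k) (r i j)) : False := by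
  simp only [mem_ln_iff_area] at *
  set w := s 0 with hw
  set X : ℝ × ℝ → ℝ := fun p => area u w p / area u v p with hX
  set Y : ℝ × ℝ → ℝ := fun p => area v w p / area u v p with hY
  have swap : ∀ p q r, area p q r = - area p r q ∧ area p q r = - area q p r := fun p q r => by
    simp only [area, cr, Prod.fst_sub, Prod.snd_sub]; constructor <;> ring
  have huw : area u w v ≠ 0 := by rw [(swap _ _ _).1]; exact neg_ne_zero.2 (hs 0)
  have hvw : area v w u ≠ 0 := by
    rw [(swap _ _ _).1, (swap _ _ _).2, neg_neg]; exact hs 0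
  have eqX : ∀ i j, i ≠ j → X (r i j) = X (s i) := fun i j hij => by
    have h := area_mul_sub u v w (s i) (r i j)
    rw [hu i j hij, mul_zero] at h
    have h1 := hs i
    have h2 := hr i j hij
    rw [hX]; field_simp; linarith
  have eqY : ∀ i j, i ≠ j → Y (r i j) = Y (s j) := fun i j hij => by
    have h := area_mul_sub v u w (s j) (r i j)
    rw [hv i j hij, mul_zero, (swap v u _).2, (swap v u (s j)).2] at h
    have h1 := hs j
    have h2 := hr i j hij
    rw [hY]; field_simp; linarith
  have neX : ∀ i j, i ≠ j → X (s i) ≠ X (s j) := fun i j hij he => by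
    have h := area_mul_sub u v w (s i) (s j)
    have h1 := hs i
    have h2 := hs j
    simp only [hX] at he
    field_simp at he
    rw [show area u w (s i) * area u v (s j) - area u w (s j) * area u v (s i) = 0 by linarith] at h
    exact mul_ne_zero huw (hus i j hij) h.symm
  have neY : ∀ i j, i ≠ j → Y (s i) ≠ Y (s j) := fun i j hij he => by
    have h := area_mul_sub v u w (s i) (s j)
    have h1 := hs i
    have h2 := hs j
    simp only [hY] at he
    field_simp at he
    rw [(swap v u _).2, (swap v u (s i)).2,
      show area v w (s i) * -area u v (s j) - area v w (s j) * -area u v (s i) = 0 by linarith] at h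
    exact mul_ne_zero hvw (hvs i j hij) h.symm
  have prod : ∀ i j k, i ≠ j → i ≠ k → j ≠ k →
      (X (s i) - X (s k)) * (Y (s i) - Y (s k)) = (X (s j) - X (s k)) * (Y (s j) - Y (s k)) := by
    intro i j k hij hik hjk
    have h := projected_collinear w (hs k) (hr i j hij) (hr j i hij.symm) (hk i j k hij hik hjk)
    change (X (r i j) - X (s k)) * (Y (r j i) - Y (s k)) =
      (X (r j i) - X (s k)) * (Y (r i j) - Y (s k)) at h
    rwa [eqX i j hij, eqX j i hij.symm, eqY i j hij, eqY j i hij.symm] at h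
  have p1 := prod 0 2 1 (by decide) (by decide) (by decide)
  have p2 := prod 1 2 0 (by decide) (by decide) (by decide)
  exact false_of_products (x₃ := X (s 2)) (y₃ := Y (s 2)) (neX 0 1 (by decide))
    (neY 0 1 (by decide))
    (by linear_combination p1) (by linear_combination p2)

namespace UnequalCase

variable {R B : Finset (ℝ × ℝ)}

theorem cnt_left_eq_two (h : UnequalCase R B 6) {L : Set (ℝ × ℝ)} (hL : L ∈ joins R B) :
    cnt R L = 2 := by
  by_contra hne
  have three : ∀ l ∈ joins R B, cnt R l ≠ 2 → cnt R l = 3 ∧ 2 ≤ wt R B l := fun l hl hl2 => by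
    have h1 := h.le_half hl
    have h2 := h.twoR l hl
    have h3 : cnt R l = 3 := by omega
    have h4 := one_le_cnt_right hl
    refine ⟨h3, ?_⟩
    rw [wt, h3]
    rcases (by omega : cnt B l = 1 ∨ cnt B l = 2 ∨ 3 ≤ cnt B l) with e | e | e
    · rw [e]; norm_num
    · rw [e]; norm_num
    · nlinarith [sq_nonneg (3 - cnt B l)]
  obtain ⟨b, hb, hbL⟩ := one_le_cnt_iff.1 (one_le_cnt_right hL)
  have h1 := sum_cnt_left_through h.disj hb
  have hmem : L ∈ (joins R B).filter (fun L => b ∈ L) := Finset.mem_filter.2 ⟨hL, hbL⟩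
  rw [← Finset.add_sum_erase _ _ hmem, h.cardR, (three L hL hne).1] at h1
  obtain ⟨l, hl, hlL, hl2⟩ : ∃ l ∈ joins R B, l ≠ L ∧ cnt R l ≠ 2 := by
    by_contra! hc
    have h2 : (2 : ℤ) ∣ ∑ l ∈ ((joins R B).filter (fun L => b ∈ L)).erase L, cnt R l :=
      Finset.dvd_sum fun l hl => by
        rw [Finset.mem_erase, Finset.mem_filter] at hl
        rw [hc l hl.2.1 hl.1]
    omega
  have h2 := h.sum_wt_of_subset (s := {L, l}) (Finset.insert_subset hL
    (Finset.singleton_subset_iff.2 hl))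
  rw [Finset.sum_pair hlL.symm] at h2
  have h3 := (three L hL hne).2
  have h4 := (three l hl hl2).2
  linarith

theorem cnt_right_le_two (h : UnequalCase R B 6) {L : Set (ℝ × ℝ)} (hL : L ∈ joins R B) :
    cnt B L ≤ 2 := by
  have h1 := h.cnt_left_eq_two hL
  have h2 := h.adm hL
  rw [h1] at h2
  have h3 := h2.bound
  have h4 := h2.weight
  by_contra! hc
  have h5 : cnt B L = 3 := by nlinarith
  rw [h5] at h3
  norm_num at h3

theorem card_specials (h : UnequalCase R B 6) : (specials R B).card = 3 := by
  have h1 := h.sum_excess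
  have h2 : ∑ L ∈ joins R B, (cnt R L * cnt B L - 4) =
      ∑ L ∈ joins R B, if cnt B L = 1 then -2 else 0 :=
    Finset.sum_congr rfl fun L hL => by
      have h3 := h.cnt_right_le_two hL
      have h4 := one_le_cnt_right hL
      rw [h.cnt_left_eq_two hL]
      split_ifs <;> omega
  rw [h2, ← Finset.sum_filter, Finset.sum_const, nsmul_eq_mul] at h1
  change ((specials R B).card : ℤ) * -2 = _ at h1
  omega

theorem exists_special_mem (h : UnequalCase R B 6) {L : Set (ℝ × ℝ)} (hL : L ∈ joins R B) :
    ∃ l ∈ specials R B, ∃ b ∈ B, b ∈ l ∧ b ∈ L := by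
  by_cases h1 : cnt B L = 1
  · obtain ⟨b, hb, hbL⟩ := one_le_cnt_iff.1 h1.ge
    exact ⟨L, mem_specials.2 ⟨hL, h1⟩, b, hb, hbL, hbL⟩
  · have h2 : cnt B L = 2 := by
      have h3 := h.cnt_right_le_two hL
      have h4 := one_le_cnt_right hL
      omega
    by_contra! hc
    have h3 := h.delta_nonneg hL
    rw [h2, h.cnt_left_eq_two hL, total, sum_corr, Finset.sum_eq_zero] at h3
    · norm_num at h3
    · intro m hm
      have : ¬ 1 ≤ cnt (ptsOn B L) m := fun h1 => by
        obtain ⟨b, hb, hbm⟩ := one_le_cnt_iff.1 h1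
        rw [mem_ptsOn] at hb
        exact hc m (Finset.mem_of_mem_erase hm) b hb.1 hbm hb.2
      have h0 := cnt_nonneg (ptsOn B L) m
      rw [show cnt (ptsOn B L) m = 0 by omega, zero_mul]

theorem not_three_blue (h : UnequalCase R B 6) {L : Set (ℝ × ℝ)} (hL : L ∈ joins R B)
    {x y z : ℝ × ℝ} (hx : x ∈ B) (hy : y ∈ B) (hz : z ∈ B) (hxy : x ≠ y) (hxz : x ≠ z)
    (hyz : y ≠ z) (hxL : x ∈ L) (hyL : y ∈ L) (hzL : z ∈ L) : False := by
  have h1 := h.cnt_right_le_two hL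
  have h2 : 2 < (ptsOn B L).card := Finset.two_lt_card.2 ⟨x, mem_ptsOn.2 ⟨hx, hxL⟩, y,
    mem_ptsOn.2 ⟨hy, hyL⟩, z, mem_ptsOn.2 ⟨hz, hzL⟩, hxy, hxz, hyz⟩
  rw [cnt] at h1
  omega

/-- The blue points of the special lines, together with the two other blue points. -/
theorem exists_labels (h : UnequalCase R B 6) : ∃ s : Fin 3 → ℝ × ℝ, ∃ u ∈ B, ∃ v ∈ B,
    (∀ i, s i ∈ B) ∧ Function.Injective s ∧ u ≠ v ∧ (∀ i, s i ≠ u) ∧ (∀ i, s i ≠ v) ∧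
    ∀ L ∈ joins R B, ∃ i, s i ∈ L := by
  let e := ((specials R B).equivFinOfCardEq h.card_specials).symm
  have hex : ∀ l ∈ specials R B, ∃ b ∈ B, b ∈ l := fun l hl =>
    one_le_cnt_iff.1 (mem_specials.1 hl).2.ge
  choose! f hfB hfl using hex
  have inj : Function.Injective fun i => f (e i) := fun i j hij => by
    have hi := (e i).2
    have hj := (e j).2
    have hij : f (e i) = f (e j) := hij
    exact e.injective (Subtype.ext (h.special _ (mem_specials.1 hi).1 _ (mem_specials.1 hj).1
      (mem_specials.1 hi).2 (mem_specials.1 hj).2 (f (e i)) (hfB _ hi) (hfl _ hi)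
      (hij ▸ hfl _ hj)))
  have hcard : 1 < (B \ Finset.univ.image fun i => f (e i)).card := by
    rw [Finset.card_sdiff_of_subset, Finset.card_image_of_injective _ inj]
    · have := h.cardB
      simp
      omega
    · intro b hb
      obtain ⟨i, -, rfl⟩ := Finset.mem_image.1 hb
      exact hfB _ (e i).2
  obtain ⟨u, hu, v, hv, huv⟩ := Finset.one_lt_card.1 hcard
  rw [Finset.mem_sdiff] at hu hv
  refine ⟨fun i => f (e i), u, hu.1, v, hv.1, fun i => hfB _ (e i).2, inj, huv,
    fun i hi => hu.2 (Finset.mem_image.2 ⟨i, Finset.mem_univ i, hi⟩),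
    fun i hi => hv.2 (Finset.mem_image.2 ⟨i, Finset.mem_univ i, hi⟩), fun L hL => ?_⟩
  obtain ⟨l, hl, b, hb, hbl, hbL⟩ := h.exists_special_mem hL
  refine ⟨e.symm ⟨l, hl⟩, ?_⟩
  change f (e (e.symm ⟨l, hl⟩)) ∈ L
  rw [Equiv.apply_symm_apply]
  have : f l = b := by
    by_contra hne
    have := two_le_cnt (hfB l hl) hb hne (hfl l hl) hbl
    rw [(mem_specials.1 hl).2] at this
    norm_num at this
  rwa [this]

theorem not_six (h : UnequalCase R B 6) : False := by
  obtain ⟨s, u, hu, v, hv, hs, inj, huv, hsu, hsv, hmem⟩ := h.exists_labels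
  have hne : ∀ r ∈ R, ∀ b ∈ B, r ≠ b := fun r hr b hb e =>
    Finset.disjoint_left.1 h.disj hr (e ▸ hb)
  have hJ : ∀ r ∈ R, ∀ b ∈ B, ln b r ∈ joins R B := fun r hr b hb => by
    rw [joins_comm]; exact ln_mem_joins hb hr (hne r hr b hb).symm
  have three : ∀ L ∈ joins R B, ∀ x ∈ B, ∀ y ∈ B, ∀ z ∈ B, x ≠ y → x ≠ z → y ≠ z →
      x ∈ L → y ∈ L → z ∈ L → False := fun L hL x hx y hy z hz h1 h2 h3 =>
    h.not_three_blue hL hx hy hz h1 h2 h3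
  choose! a ha using fun r (hr : r ∈ R) => hmem _ (hJ r hr u hu)
  choose! c hc using fun r (hr : r ∈ R) => hmem _ (hJ r hr v hv)
  have same : ∀ L ∈ joins R B, ∀ l ∈ joins R B, ∀ b ∈ B, ∀ r ∈ R, b ∈ L → b ∈ l → r ∈ L →
      r ∈ l → L = l := fun L hL l hl b hb r hr => h.eq_of_blue_of_red hL hl hb hr
  have hac : ∀ r ∈ R, a r ≠ c r := fun r hr e => by
    have e1 : ln u r = ln v r := same _ (hJ r hr u hu) _ (hJ r hr v hv) (s (a r)) (hs _) r hr
      (ha r hr) (e ▸ hc r hr) (right_mem_ln _ _) (right_mem_ln _ _)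
    exact three _ (hJ r hr u hu) u hu v hv _ (hs (a r)) huv (hsu _).symm (hsv _).symm
      (left_mem_ln _ _) (e1 ▸ left_mem_ln _ _) (ha r hr)
  have bb : ∀ x ∈ B, ∀ y ∈ B, x ≠ y → ∀ L ∈ joins R B, x ∈ L → y ∈ L → L = ln x y :=
    fun x _ y _ hxy L hL hx hy => (isLine_of_mem_joins hL).eq_ln hx hy hxy
  have hua : ∀ r ∈ R, ln u r = ln u (s (a r)) := fun r hr =>
    bb u hu _ (hs _) (hsu _).symm _ (hJ r hr u hu) (left_mem_ln _ _) (ha r hr)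
  have hvc : ∀ r ∈ R, ln v r = ln v (s (c r)) := fun r hr =>
    bb v hv _ (hs _) (hsv _).symm _ (hJ r hr v hv) (left_mem_ln _ _) (hc r hr)
  have inj2 : ∀ r ∈ R, ∀ r' ∈ R, a r = a r' → c r = c r' → r = r' := by
    intro r hr r' hr' h1 h2
    by_contra hrr
    have e1 : ln u r = ln u r' := by rw [hua r hr, hua r' hr', h1]
    have e2 : ln v r = ln v r' := by rw [hvc r hr, hvc r' hr', h2]
    have e3 : ln u r = ln v r := (isLine_of_mem_joins (hJ r hr u hu)).eq_of_mem
      (isLine_of_mem_joins (hJ r hr v hv)) hrr (right_mem_ln _ _) (e1 ▸ right_mem_ln _ _)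
      (right_mem_ln _ _) (e2 ▸ right_mem_ln _ _)
    exact three _ (hJ r hr u hu) u hu v hv _ (hs (a r)) huv (hsu _).symm (hsv _).symm
      (left_mem_ln _ _) (e3 ▸ left_mem_ln _ _) (ha r hr)
  have surj : ∀ i j : Fin 3, i ≠ j → ∃ r ∈ R, a r = i ∧ c r = j := by
    have himg : R.image (fun r => (a r, c r)) = (Finset.univ : Finset (Fin 3)).offDiag := by
      refine Finset.eq_of_subset_of_card_le (fun p hp => ?_) ?_
      · obtain ⟨r, hr, rfl⟩ := Finset.mem_image.1 hp
        exact Finset.mem_offDiag.2 ⟨Finset.mem_univ _, Finset.mem_univ _, hac r hr⟩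
      · rw [Finset.card_image_of_injOn fun r hr r' hr' e => inj2 r hr r' hr' (Prod.ext_iff.1 e).1
          (Prod.ext_iff.1 e).2]
        have h1 := h.cardR
        rw [Finset.offDiag_card, Finset.card_univ, Fintype.card_fin]
        omega
    intro i j hij
    have : (i, j) ∈ R.image (fun r => (a r, c r)) := by
      rw [himg]; exact Finset.mem_offDiag.2 ⟨Finset.mem_univ _, Finset.mem_univ _, hij⟩
    obtain ⟨r, hr, e⟩ := Finset.mem_image.1 this
    exact ⟨r, hr, (Prod.ext_iff.1 e).1, (Prod.ext_iff.1 e).2⟩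
  choose! r hr hra hrc using surj
  have hus : ∀ i j, i ≠ j → ln u (s i) ∈ joins R B ∧ r i j ∈ ln u (s i) := fun i j hij => by
    have e := hua _ (hr i j hij)
    rw [hra i j hij] at e
    rw [← e]
    exact ⟨hJ _ (hr i j hij) u hu, right_mem_ln _ _⟩
  have hvs : ∀ i j, i ≠ j → ln v (s j) ∈ joins R B ∧ r i j ∈ ln v (s j) := fun i j hij => by
    have e := hvc _ (hr i j hij)
    rw [hrc i j hij] at e
    rw [← e]
    exact ⟨hJ _ (hr i j hij) v hv, right_mem_ln _ _⟩
  have other : ∀ k : Fin 3, ∃ j, k ≠ j := by decide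
  have huJ : ∀ k, ln u (s k) ∈ joins R B := fun k => by
    obtain ⟨j, hj⟩ := other k
    exact (hus k j hj).1
  have hvJ : ∀ k, ln v (s k) ∈ joins R B := fun k => by
    obtain ⟨j, hj⟩ := other k
    exact (hvs j k hj.symm).1
  have hus' : ∀ i j, i ≠ j → s j ∉ ln u (s i) := fun i j hij hmem =>
    three _ (huJ i) u hu _ (hs i) _ (hs j) (hsu i).symm (hsu j).symm (inj.ne hij)
      (left_mem_ln _ _) (right_mem_ln _ _) hmem
  have hvs' : ∀ i j, i ≠ j → s j ∉ ln v (s i) := fun i j hij hmem =>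
    three _ (hvJ i) v hv _ (hs i) _ (hs j) (hsv i).symm (hsv j).symm (inj.ne hij)
      (left_mem_ln _ _) (right_mem_ln _ _) hmem
  have hsuv : ∀ k, s k ∉ ln u v := fun k hk => by
    have e := (isLine_ln huv).eq_ln (left_mem_ln _ _) hk (hsu k).symm
    exact three _ (huJ k) u hu v hv _ (hs k) huv (hsu k).symm (hsv k).symm
      (left_mem_ln _ _) (e ▸ right_mem_ln _ _) (right_mem_ln _ _)
  refine false_of_configuration (s := s) (r := r) hsuv (fun i j hij hk => ?_)
    (fun i j hij => (hus i j hij).2) (fun i j hij => (hvs i j hij).2) hus' hvs'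
    fun i j k hij hik hjk => ?_
  · have hrR := hr i j hij
    have e := (isLine_ln huv).eq_ln (left_mem_ln _ _) hk (hne _ hrR u hu).symm
    rw [hua _ hrR] at e
    exact hsuv (a (r i j)) (by rw [e]; exact right_mem_ln _ _)
  · have hrR := hr i j hij
    have hL := hJ _ hrR _ (hs k)
    obtain ⟨q, hq, hqL, hqr⟩ := exists_ne_of_two_le_cnt (h.twoR _ hL) (r i j)
    have haq : a q ≠ k := fun e => by
      have e1 : ln (s k) (r i j) = ln u (s k) := same _ hL _ (huJ k) (s k) (hs k) q hq
        (left_mem_ln _ _) (right_mem_ln _ _) hqL (by rw [← e, ← hua q hq]; exact right_mem_ln _ _)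
      have e2 : ln u (s i) = ln u (s k) := same _ (huJ i) _ (huJ k) u hu _ hrR (left_mem_ln _ _)
        (left_mem_ln _ _) (hus i j hij).2 (e1 ▸ right_mem_ln _ _)
      exact hus' i k hik (e2 ▸ right_mem_ln _ _)
    have hcq : c q ≠ k := fun e => by
      have e1 : ln (s k) (r i j) = ln v (s k) := same _ hL _ (hvJ k) (s k) (hs k) q hq
        (left_mem_ln _ _) (right_mem_ln _ _) hqL (by rw [← e, ← hvc q hq]; exact right_mem_ln _ _)
      have e2 : ln v (s j) = ln v (s k) := same _ (hvJ j) _ (hvJ k) v hv _ hrR (left_mem_ln _ _)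
        (left_mem_ln _ _) (hvs i j hij).2 (e1 ▸ right_mem_ln _ _)
      exact hvs' j k hjk (e2 ▸ right_mem_ln _ _)
    have hor : ∀ i j k x y : Fin 3, i ≠ j → i ≠ k → j ≠ k → x ≠ y → x ≠ k → y ≠ k →
        (x = i ∧ y = j) ∨ (x = j ∧ y = i) := by decide
    rcases hor i j k _ _ hij hik hjk (hac q hq) haq hcq with ⟨h1, h2⟩ | ⟨h1, h2⟩
    · exact absurd (inj2 q hq _ hrR (h1.trans (hra i j hij).symm) (h2.trans (hrc i j hij).symm)) hqr
    · rwa [← inj2 q hq _ (hr j i hij.symm) (h1.trans (hra j i hij.symm).symm)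
        (h2.trans (hrc j i hij.symm).symm)]

theorem false {n : ℤ} (h : UnequalCase R B n) : False := by
  rcases (by omega : n ≤ 5 ∨ n = 6 ∨ n = 7 ∨ n = 8 ∨ n = 9 ∨ n = 10 ∨ n = 11 ∨ n = 12 ∨ n = 13 ∨
    14 ≤ n) with hn | rfl | rfl | rfl | rfl | rfl | rfl | rfl | rfl | hn
  exacts [h.not_le_five hn, h.not_six, h.not_seven, h.not_eight, h.not_nine, h.not_ten,
    h.not_eleven, h.not_twelve, h.not_thirteen, h.not_fourteen_le hn]

end UnequalCase

/-- Removing a point from one colour class of a minimal counterexample does not change the set of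
bichromatic lines. -/
theorem joins_erase_of_minimal {R B : Finset (ℝ × ℝ)} (hRB : Disjoint R B) (hR : NC R) (hB : NC B)
    (hle : B.card ≤ R.card + 1) (hlt : (joins R B).card + 1 < R.card + B.card) {p : ℝ × ℝ}
    (hp : p ∈ R)
    (ih : NC (R.erase p) → (R.erase p).card + B.card ≤ (joins (R.erase p) B).card + 1) :
    NC (R.erase p) ∧ joins (R.erase p) B = joins R B ∧
      (joins R B).card + 2 = R.card + B.card := by
  have h1 : NC (R.erase p) := by
    by_contra h
    exact absurd (bound_of_erase hRB hR hB hle hp h) (by omega)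
  have h2 := ih h1
  have h3 := Finset.card_erase_add_one hp
  have h4 : joins (R.erase p) B ⊆ joins R B :=
    joins_mono (Finset.erase_subset _ _) (Finset.Subset.refl _)
  have h5 := Finset.card_le_card h4
  exact ⟨h1, Finset.eq_of_subset_of_card_le h4 (by omega), by omega⟩

theorem two_le_cnt_of_joins_erase {R B : Finset (ℝ × ℝ)}
    (h : ∀ p ∈ R, joins (R.erase p) B = joins R B) {L : Set (ℝ × ℝ)} (hL : L ∈ joins R B) :
    2 ≤ cnt R L := by
  obtain ⟨p, hp, hpL⟩ := one_le_cnt_iff.1 (one_le_cnt_left hL)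
  rw [← h p hp] at hL
  obtain ⟨q, hq, hqL⟩ := one_le_cnt_iff.1 (one_le_cnt_left hL)
  rw [Finset.mem_erase] at hq
  exact two_le_cnt hp hq.2 hq.1.symm hpL hqL

theorem card_le_card_joins (N : ℕ) : ∀ R B : Finset (ℝ × ℝ), R.card + B.card = N → Disjoint R B →
    NC R → NC B → R.card ≤ B.card + 1 → B.card ≤ R.card + 1 → N ≤ (joins R B).card + 1 := by
  induction N using Nat.strong_induction_on with
  | _ N IH =>
  have main : ∀ R B : Finset (ℝ × ℝ), R.card + B.card = N → Disjoint R B → NC R → NC B →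
      R.card ≤ B.card + 1 → B.card ≤ R.card → N ≤ (joins R B).card + 1 := by
    intro R B hN hRB hR hB h1 h2
    by_contra! hlt
    have ih : ∀ R' ⊆ R, ∀ B' ⊆ B, R'.card + B'.card < N → R'.card ≤ B'.card + 1 →
        B'.card ≤ R'.card + 1 → NC R' → NC B' → R'.card + B'.card ≤ (joins R' B').card + 1 :=
      fun R' hR' B' hB' hlt' h3 h4 hR'' hB'' =>
        IH _ hlt' R' B' rfl (Finset.disjoint_of_subset_left hR' (Finset.disjoint_of_subset_right
          hB' hRB)) hR'' hB'' h3 h4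
    have key := fun p (hp : p ∈ R) => joins_erase_of_minimal hRB hR hB (by omega) (by omega) hp
      fun h => by
        have := Finset.card_erase_add_one hp
        exact ih _ (Finset.erase_subset _ _) B (Finset.Subset.refl _) (by omega) (by omega)
          (by omega) h hB
    obtain ⟨p₀, hp₀⟩ : R.Nonempty := Finset.card_pos.1 (by have := hR.three_le_card; omega)
    have hcard := (key p₀ hp₀).2.2
    have twoR : ∀ L ∈ joins R B, 2 ≤ cnt R L := fun L hL =>
      two_le_cnt_of_joins_erase (fun p hp => (key p hp).2.1) hL
    rcases eq_or_lt_of_le h2 with h3 | h3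
    · refine EqualCase.false (R := R) (B := B) (n := R.card)
        ⟨hRB, hR, hB, rfl, by rw [h3], by omega, twoR, fun L hL => ?_⟩
      rw [joins_comm] at hL
      refine two_le_cnt_of_joins_erase (fun q hq => ?_) hL
      refine (joins_erase_of_minimal hRB.symm hB hR (by omega) (by rw [joins_comm]; omega) hq
        fun h => ?_).2.1
      have := Finset.card_erase_add_one hq
      rw [joins_comm, add_comm]
      exact ih R (Finset.Subset.refl _) _ (Finset.erase_subset _ _) (by omega) (by omega)
        (by omega) hR h
    · refine UnequalCase.false (R := R) (B := B) (n := R.card)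
        ⟨hRB, hR, hB, rfl, by omega, by omega, twoR, fun L hL l hl hL1 hl1 q hq hqL hql => ?_⟩
      by_contra hne
      have hBq : NC (B.erase q) := by
        by_contra h
        have := bound_of_erase hRB.symm hB hR (by omega) hq h
        rw [joins_comm] at this
        omega
      have e1 := Finset.card_erase_add_one hp₀
      have e2 := Finset.card_erase_add_one hq
      have h4 := ih (R.erase p₀) (Finset.erase_subset _ _) (B.erase q) (Finset.erase_subset _ _)
        (by omega) (by omega) (by omega) (key p₀ hp₀).1 hBq
      have avoid : ∀ m ∈ joins (R.erase p₀) (B.erase q), cnt B m = 1 → q ∉ m := fun m hm h hqm => by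
        obtain ⟨b, hb, hbm⟩ := one_le_cnt_iff.1 (one_le_cnt_right hm)
        rw [Finset.mem_erase] at hb
        have := two_le_cnt hb.2 hq hb.1 hbm hqm
        omega
      have h5 : joins (R.erase p₀) (B.erase q) ⊆ ((joins R B).erase L).erase l := fun m hm =>
        Finset.mem_erase.2 ⟨fun e => avoid m hm (e ▸ hl1) (e ▸ hql),
          Finset.mem_erase.2 ⟨fun e => avoid m hm (e ▸ hL1) (e ▸ hqL),
            joins_mono (Finset.erase_subset _ _) (Finset.erase_subset _ _) hm⟩⟩
      have h6 := Finset.card_le_card h5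
      have e3 := Finset.card_erase_add_one hL
      have e4 := Finset.card_erase_add_one (Finset.mem_erase.2 ⟨fun e => hne e.symm, hl⟩)
      omega
  intro R B hN hRB hR hB h1 h2
  rcases le_total B.card R.card with h | h
  · exact main R B hN hRB hR hB h1 h
  · rw [joins_comm]
    exact main B R (by omega) hRB.symm hB hR h2 h

/-- **Kleitman–Pinchasi conjecture.** If `|R| = n`, `|B| ∈ {n, n-1}` and neither
colour class is collinear, then `R ∪ B` determines at least `|P| - 1` bichromatic lines. -/
theorem kleitman_pinchasi
    (n : ℕ) (hn : 1 ≤ n) (R B : Finset (ℝ × ℝ)) (hRB : Disjoint R B)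
    (hR : R.card = n) (hB : B.card = n ∨ B.card = n - 1)
    (hRcol : ¬ Collinear ℝ (R : Set (ℝ × ℝ)))
    (hBcol : ¬ Collinear ℝ (B : Set (ℝ × ℝ))) :
    (R ∪ B).card - 1 ≤ nBichromatic R B := by
  rw [nBichromatic_eq hRB, Finset.card_union_of_disjoint hRB]
  have := card_le_card_joins _ R B rfl hRB (NC.of_not_collinear hRcol) (NC.of_not_collinear hBcol)
    (by omega) (by omega)
  omega
end
end

section
/- For every integer n ≥ 3 there exist disjoint sets R and B of points in the plane with |R| = |B| = n, such that neither R nor B is collinear and R ∪ B determines exactly 2n - 1 bichromatic lines. (Namely, n - 1 red and n - 1 blue points on a line L, together with one red and one blue point off L that are collinear with a common point of L.) -/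
open scoped Classical

noncomputable section

lemma mem_affineSpan_pair_iff_cross {p q : ℝ × ℝ} (h : p ≠ q) (z : ℝ × ℝ) :
    z ∈ affineSpan ℝ ({p, q} : Set (ℝ × ℝ)) ↔
      (q.1 - p.1) * (z.2 - p.2) = (q.2 - p.2) * (z.1 - p.1) := by
  rw [mem_affineSpan_pair_iff_exists_lineMap_eq]
  constructor
  · rintro ⟨t, rfl⟩
    simp [AffineMap.lineMap_apply]
    ring
  · intro e
    by_cases h1 : q.1 - p.1 = 0
    · have h2 : q.2 - p.2 ≠ 0 := fun h2 =>
        h (Prod.ext (by linarith) (by linarith))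
      have h3 : z.1 - p.1 = 0 := by
        rw [h1, zero_mul] at e
        exact (mul_eq_zero.1 e.symm).resolve_left h2
      refine ⟨(z.2 - p.2) / (q.2 - p.2), Prod.ext ?_ ?_⟩
      · simp [AffineMap.lineMap_apply, h1]
        linarith
      · simp [AffineMap.lineMap_apply]
        field_simp
        ring
    · refine ⟨(z.1 - p.1) / (q.1 - p.1), Prod.ext ?_ ?_⟩
      · simp [AffineMap.lineMap_apply]
        field_simp
        ring
      · simp [AffineMap.lineMap_apply]
        field_simp
        linarith

lemma IsLine.eq_affineSpan {L : Set (ℝ × ℝ)} (hL : IsLine L) {p q : ℝ × ℝ} (hpq : p ≠ q)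
    (hp : p ∈ L) (hq : q ∈ L) : L = (affineSpan ℝ ({p, q} : Set (ℝ × ℝ)) : Set (ℝ × ℝ)) := by
  obtain ⟨a, b, -, rfl⟩ := hL
  rw [affineSpan_pair_eq_of_mem_of_mem_of_ne hp hq hpq]

lemma bichromaticLine_iff {R B : Finset (ℝ × ℝ)} (h : Disjoint R B) (L : Set (ℝ × ℝ)) :
    BichromaticLine R B L ↔
      ∃ p ∈ R, ∃ q ∈ B, L = (affineSpan ℝ ({p, q} : Set (ℝ × ℝ)) : Set (ℝ × ℝ)) := by
  constructor
  · rintro ⟨⟨hL, -⟩, ⟨p, hpR, hp⟩, q, hqB, hq⟩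
    exact ⟨p, hpR, q, hqB, hL.eq_affineSpan (Finset.disjoint_iff_ne.1 h p hpR q hqB) hp hq⟩
  · rintro ⟨p, hpR, q, hqB, rfl⟩
    have hpq := Finset.disjoint_iff_ne.1 h p hpR q hqB
    have hp := left_mem_affineSpan_pair ℝ p q
    have hq := right_mem_affineSpan_pair ℝ p q
    refine ⟨⟨⟨p, q, hpq, rfl⟩, Finset.one_lt_card.2 ⟨p, ?_, q, ?_, hpq⟩⟩,
      ⟨p, hpR, hp⟩, q, hqB, hq⟩
    · exact Finset.mem_filter.2 ⟨Finset.mem_union_left _ hpR, hp⟩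
    · exact Finset.mem_filter.2 ⟨Finset.mem_union_right _ hqB, hq⟩

/-- The points `(k, 0)` with `a ≤ k < b`, together with the point `(0, h)`. -/
def axisPointsAndApex (a b : ℤ) (h : ℝ) : Finset (ℝ × ℝ) :=
  insert (0, h) ((Finset.Ico a b).image fun k : ℤ => ((k : ℝ), (0 : ℝ)))

lemma mem_axisPointsAndApex {a b : ℤ} {h : ℝ} {p : ℝ × ℝ} :
    p ∈ axisPointsAndApex a b h ↔
      p = (0, h) ∨ ∃ k : ℤ, (a ≤ k ∧ k < b) ∧ ((k : ℝ), (0 : ℝ)) = p := by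
  simp [axisPointsAndApex]

lemma card_axisPointsAndApex (a b : ℤ) {h : ℝ} (hh : h ≠ 0) :
    (axisPointsAndApex a b h).card = (b - a).toNat + 1 := by
  rw [axisPointsAndApex, Finset.card_insert_of_notMem, Finset.card_image_of_injective, Int.card_Ico]
  · intro x y hxy
    simpa using hxy
  · simp [hh.symm]

lemma not_collinear_axisPointsAndApex {a b : ℤ} {h : ℝ} (hh : h ≠ 0) (hab : a + 2 ≤ b) :
    ¬ Collinear ℝ (axisPointsAndApex a b h : Set (ℝ × ℝ)) := by
  intro hc
  have hne : ((a : ℝ), (0 : ℝ)) ≠ (((a + 1 : ℤ) : ℝ), (0 : ℝ)) := by simp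
  have hm := hc.mem_affineSpan_of_mem_of_ne (p₁ := ((a : ℝ), (0 : ℝ)))
    (p₂ := (((a + 1 : ℤ) : ℝ), (0 : ℝ))) (p₃ := (0, h))
    (mem_axisPointsAndApex.2 (Or.inr ⟨a, ⟨le_rfl, by omega⟩, rfl⟩))
    (mem_axisPointsAndApex.2 (Or.inr ⟨a + 1, ⟨by omega, by omega⟩, rfl⟩))
    (mem_axisPointsAndApex.2 (Or.inl rfl)) hne
  rw [mem_affineSpan_pair_iff_cross hne] at hm
  simp [hh] at hm

/-- The line through `(k, 0)` and `(0, 2)` if `0 ≤ k`, through `(k, 0)` and `(0, 1)` if `k < 0`. -/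
def apexLine (k : ℤ) : Set (ℝ × ℝ) :=
  {z | (if 0 ≤ k then 2 else 1 : ℝ) * (z.1 - k) + k * z.2 = 0}

lemma axis_mem_apexLine_iff (x : ℝ) (k : ℤ) : (x, 0) ∈ apexLine k ↔ x = k := by
  unfold apexLine
  split_ifs <;> simp [sub_eq_zero]

lemma apexLine_injective : Function.Injective apexLine := by
  intro j k hjk
  have h : ((j : ℝ), (0 : ℝ)) ∈ apexLine k := hjk ▸ (axis_mem_apexLine_iff _ _).2 rfl
  exact_mod_cast (axis_mem_apexLine_iff _ _).1 h

lemma setOf_bichromaticLine_axisPointsAndApex {m : ℤ} (hm : 0 < m)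
    (hd : Disjoint (axisPointsAndApex 0 m 1) (axisPointsAndApex (-m) 0 2)) :
    {L | BichromaticLine (axisPointsAndApex 0 m 1) (axisPointsAndApex (-m) 0 2) L} =
      insert {z : ℝ × ℝ | z.2 = 0} (apexLine '' (Finset.Ico (-m) m : Set ℤ)) := by
  have axis (i k : ℤ) (hi : 0 ≤ i) (hk : k < 0) :
      (affineSpan ℝ {((i : ℝ), (0 : ℝ)), ((k : ℝ), (0 : ℝ))} : Set (ℝ × ℝ)) =
        {z | z.2 = 0} := by
    have hki : (k : ℝ) - i ≠ 0 := by
      rw [sub_ne_zero]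
      exact_mod_cast (by omega : k ≠ i)
    have hne : ((i : ℝ), (0 : ℝ)) ≠ ((k : ℝ), (0 : ℝ)) := fun e =>
      hki (by simpa [sub_eq_zero] using (congrArg Prod.fst e).symm)
    ext z
    simp [mem_affineSpan_pair_iff_cross hne, hki]
  have redApex (k : ℤ) (hk : k < 0) :
      (affineSpan ℝ {((0 : ℝ), (1 : ℝ)), ((k : ℝ), (0 : ℝ))} : Set (ℝ × ℝ)) = apexLine k := by
    ext z
    rw [SetLike.mem_coe, mem_affineSpan_pair_iff_cross (by simp)]
    simp only [apexLine, not_le.2 hk, if_false, Set.mem_ofPred_eq]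
    constructor <;> intro e <;> linarith
  have blueApex (k : ℤ) (hk : 0 ≤ k) :
      (affineSpan ℝ {((k : ℝ), (0 : ℝ)), ((0 : ℝ), (2 : ℝ))} : Set (ℝ × ℝ)) = apexLine k := by
    ext z
    rw [SetLike.mem_coe, mem_affineSpan_pair_iff_cross (by simp)]
    simp only [apexLine, hk, if_true, Set.mem_ofPred_eq]
    constructor <;> intro e <;> linarith
  have apexes :
      (affineSpan ℝ {((0 : ℝ), (1 : ℝ)), ((0 : ℝ), (2 : ℝ))} : Set (ℝ × ℝ)) = apexLine 0 := by
    ext z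
    rw [SetLike.mem_coe, mem_affineSpan_pair_iff_cross (by simp)]
    norm_num [apexLine, eq_comm]
  ext L
  simp only [Set.mem_ofPred_eq, bichromaticLine_iff hd, mem_axisPointsAndApex, Set.mem_insert_iff,
    Set.mem_image, Finset.coe_Ico, Set.mem_Ico]
  constructor
  · rintro ⟨p, rfl | ⟨i, hi, rfl⟩, q, rfl | ⟨k, hk, rfl⟩, rfl⟩
    · exact Or.inr ⟨0, by omega, apexes.symm⟩
    · exact Or.inr ⟨k, by omega, (redApex k hk.2).symm⟩
    · exact Or.inr ⟨i, by omega, (blueApex i hi.1).symm⟩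
    · exact Or.inl (axis i k hi.1 hk.2)
  · rintro (rfl | ⟨k, hk, rfl⟩)
    · exact ⟨_, Or.inr ⟨0, by omega, rfl⟩, _, Or.inr ⟨-1, by omega, rfl⟩,
        (axis 0 (-1) (by omega) (by omega)).symm⟩
    · rcases lt_or_ge k 0 with h | h
      · exact ⟨_, Or.inl rfl, _, Or.inr ⟨k, by omega, rfl⟩, (redApex k h).symm⟩
      · exact ⟨_, Or.inr ⟨k, by omega, rfl⟩, _, Or.inl rfl, (blueApex k h).symm⟩

/-- **Tightness of the Kleitman–Pinchasi conjecture.** For every `n ≥ 3` there are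
disjoint sets of `n` red and `n` blue points, neither colour class collinear,
determining exactly `2n - 1` bichromatic lines. -/
theorem kleitman_pinchasi_tight (n : ℕ) (hn : 3 ≤ n) :
    ∃ R B : Finset (ℝ × ℝ), Disjoint R B ∧ R.card = n ∧ B.card = n ∧
      ¬ Collinear ℝ (R : Set (ℝ × ℝ)) ∧ ¬ Collinear ℝ (B : Set (ℝ × ℝ)) ∧
      nBichromatic R B = 2 * n - 1 := by
  have hd : Disjoint (axisPointsAndApex 0 (n - 1) 1) (axisPointsAndApex (-(n - 1)) 0 2) := by
    rw [Finset.disjoint_iff_ne]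
    intro p hp q hq
    rw [mem_axisPointsAndApex] at hp hq
    rcases hp with rfl | ⟨i, hi, rfl⟩ <;> rcases hq with rfl | ⟨k, hk, rfl⟩
    · simp
    · simp
    · simp
    · intro e
      have hik : i = k := by simpa using e
      omega
  refine ⟨_, _, hd, ?_, ?_, ?_, ?_, ?_⟩
  · rw [card_axisPointsAndApex _ _ one_ne_zero]
    omega
  · rw [card_axisPointsAndApex _ _ two_ne_zero]
    omega
  · exact not_collinear_axisPointsAndApex one_ne_zero (by omega)
  · exact not_collinear_axisPointsAndApex two_ne_zero (by omega)
  · have hnot : {z : ℝ × ℝ | z.2 = 0} ∉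
        apexLine '' (Finset.Ico (-(n - 1) : ℤ) (n - 1) : Set ℤ) := by
      rintro ⟨k, -, hk⟩
      have h : ((k : ℝ) + 1, (0 : ℝ)) ∈ apexLine k := hk ▸ rfl
      simp [axis_mem_apexLine_iff] at h
    rw [nBichromatic, setOf_bichromaticLine_axisPointsAndApex (by omega) hd,
      Set.ncard_insert_of_notMem hnot ((Finset.finite_toSet _).image _),
      Set.ncard_image_of_injective _ apexLine_injective, Set.ncard_coe_finset, Int.card_Ico]
    omega
end
end

section
/- Let R and B be disjoint finite sets of points in the plane with |R| = n and |B| = n or |B| = n - 1, where n ≥ 1, and suppose that at least one of R and B is collinear. If the set P = R ∪ B is neither collinear nor a near-pencil, then P determines at least |P| - 1 bichromatic lines. -/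
open scoped Classical

noncomputable section

/-- The line through `p` and `q` (a single point when `p = q`), as a set of points. -/
def lineThrough (p q : ℝ × ℝ) : Set (ℝ × ℝ) :=
  (affineSpan ℝ ({p, q} : Set (ℝ × ℝ)) : Set (ℝ × ℝ))

lemma left_mem_lineThrough (p q : ℝ × ℝ) : p ∈ lineThrough p q :=
  left_mem_affineSpan_pair ℝ p q

lemma right_mem_lineThrough (p q : ℝ × ℝ) : q ∈ lineThrough p q :=
  right_mem_affineSpan_pair ℝ p q

lemma isLine_lineThrough {p q : ℝ × ℝ} (h : p ≠ q) : IsLine (lineThrough p q) :=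
  ⟨p, q, h, rfl⟩

lemma IsLine.eq_lineThrough {L : Set (ℝ × ℝ)} (hL : IsLine L) {p q : ℝ × ℝ} (hp : p ∈ L)
    (hq : q ∈ L) (h : p ≠ q) : L = lineThrough p q := by
  obtain ⟨a, b, -, rfl⟩ := hL
  exact congrArg _ (affineSpan_pair_eq_of_mem_of_mem_of_ne hp hq h).symm

lemma IsLine.eq_of_mem_s5 {L M : Set (ℝ × ℝ)} (hL : IsLine L) (hM : IsLine M) {p q : ℝ × ℝ}
    (hpL : p ∈ L) (hqL : q ∈ L) (hpM : p ∈ M) (hqM : q ∈ M) (h : p ≠ q) : L = M :=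
  (hL.eq_lineThrough hpL hqL h).trans (hM.eq_lineThrough hpM hqM h).symm

lemma collinear_of_subset_isLine {S L : Set (ℝ × ℝ)} (hL : IsLine L) (h : S ⊆ L) :
    Collinear ℝ S := by
  obtain ⟨a, b, -, rfl⟩ := hL
  refine Collinear.subset h ?_
  rw [Collinear, ← direction_affineSpan, AffineSubspace.affineSpan_coe, direction_affineSpan]
  exact collinear_pair ℝ a b

/-- A line misses at least two points of `P`, unless `P` is collinear or a
near-pencil. -/
lemma card_ptsOn_add_two_le {P : Finset (ℝ × ℝ)} (hcol : ¬ Collinear ℝ (P : Set (ℝ × ℝ)))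
    (hnp : ¬ NearPencil P) {L : Set (ℝ × ℝ)} (hL : IsLine L) :
    (ptsOn P L).card + 2 ≤ P.card := by
  have hle : (ptsOn P L).card ≤ P.card := Finset.card_filter_le _ _
  have hne : (ptsOn P L).card ≠ P.card := fun h => hcol <|
    collinear_of_subset_isLine hL fun x hx =>
      Finset.filter_card_eq h x hx
  have hne' : (ptsOn P L).card ≠ P.card - 1 := fun h => hnp ⟨L, hL, h⟩
  omega

/-- The lines joining `x` to the points of `D`. -/
def linesTo (D : Finset (ℝ × ℝ)) (x : ℝ × ℝ) : Finset (Set (ℝ × ℝ)) :=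
  D.image (lineThrough x)

lemma bichromaticLine_lineThrough {R B : Finset (ℝ × ℝ)} (hRB : Disjoint R B) {p q : ℝ × ℝ}
    (hp : p ∈ R) (hq : q ∈ B) : BichromaticLine R B (lineThrough p q) := by
  have hne : p ≠ q := Finset.disjoint_iff_ne.1 hRB p hp q hq
  refine ⟨⟨isLine_lineThrough hne, ?_⟩, ⟨p, hp, left_mem_lineThrough p q⟩,
    ⟨q, hq, right_mem_lineThrough p q⟩⟩
  refine Finset.one_lt_card.2 ⟨p, ?_, q, ?_, hne⟩ <;>
    simp [ptsOn, hp, hq, left_mem_lineThrough, right_mem_lineThrough]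

lemma finite_bichromaticLine {R B : Finset (ℝ × ℝ)} (hRB : Disjoint R B) :
    {L : Set (ℝ × ℝ) | BichromaticLine R B L}.Finite := by
  refine ((R ×ˢ B).image fun x => lineThrough x.1 x.2).finite_toSet.subset ?_
  rintro L ⟨⟨hL, -⟩, ⟨p, hp, hpL⟩, q, hq, hqL⟩
  rw [Finset.mem_coe, Finset.mem_image]
  exact ⟨(p, q), Finset.mk_mem_product hp hq,
    (hL.eq_lineThrough hpL hqL (Finset.disjoint_iff_ne.1 hRB p hp q hq)).symm⟩

lemma bichromaticLine_comm {R B : Finset (ℝ × ℝ)} {L : Set (ℝ × ℝ)} :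
    BichromaticLine R B L ↔ BichromaticLine B R L := by
  rw [BichromaticLine, BichromaticLine, Finset.union_comm]
  tauto

lemma nBichromatic_comm (R B : Finset (ℝ × ℝ)) : nBichromatic R B = nBichromatic B R := by
  simp only [nBichromatic, bichromaticLine_comm (R := R)]

section Pencils

variable {C D : Finset (ℝ × ℝ)} {l : Set (ℝ × ℝ)}

lemma pairwiseDisjoint_linesTo (hl : IsLine l) (hC : ∀ x ∈ C, x ∈ l) (hD : ∀ y ∈ D, y ∉ l) :
    (C : Set (ℝ × ℝ)).PairwiseDisjoint (linesTo D) := by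
  intro x hx x' hx' hne
  refine Finset.disjoint_left.2 fun L hL hL' => ?_
  obtain ⟨y, hy, rfl⟩ := Finset.mem_image.1 hL
  obtain ⟨z, hz, h⟩ := Finset.mem_image.1 hL'
  have hxy : x ≠ y := fun h => hD y hy (h ▸ hC x hx)
  have hmem : x' ∈ lineThrough x y := h ▸ left_mem_lineThrough x' z
  refine hD y hy ?_
  rw [hl.eq_of_mem_s5 (isLine_lineThrough hxy) (hC x hx) (hC x' hx') (left_mem_lineThrough x y)
    hmem hne]
  exact right_mem_lineThrough x y

lemma sum_card_linesTo_le (hCD : Disjoint C D) (hl : IsLine l) (hC : ∀ x ∈ C, x ∈ l) :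
    ∑ x ∈ C, (linesTo (D.filter (· ∉ l)) x).card +
      (if C.Nonempty ∧ ∃ y ∈ D, y ∈ l then 1 else 0) ≤ nBichromatic C D := by
  set E := D.filter (· ∉ l)
  have hEl : ∀ y ∈ E, y ∉ l := fun y hy => (Finset.mem_filter.1 hy).2
  rw [← Finset.card_biUnion (pairwiseDisjoint_linesTo hl hC hEl), nBichromatic]
  have hsub : ∀ L ∈ C.biUnion (linesTo E), BichromaticLine C D L := by
    intro L hL
    obtain ⟨x, hx, hL⟩ := Finset.mem_biUnion.1 hL
    obtain ⟨y, hy, rfl⟩ := Finset.mem_image.1 hL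
    exact bichromaticLine_lineThrough hCD hx (Finset.mem_filter.1 hy).1
  split_ifs with h
  · obtain ⟨⟨x, hx⟩, y, hy, hyl⟩ := h
    have hnot : l ∉ C.biUnion (linesTo E) := by
      intro hmem
      obtain ⟨a, ha, hL⟩ := Finset.mem_biUnion.1 hmem
      obtain ⟨b, hb, h⟩ := Finset.mem_image.1 hL
      exact hEl b hb (h ▸ right_mem_lineThrough a b)
    rw [← Finset.card_insert_of_notMem hnot, ← Set.ncard_coe_finset]
    refine Set.ncard_le_ncard (fun L hL => ?_) (finite_bichromaticLine hCD)
    rcases Finset.mem_insert.1 (Finset.mem_coe.1 hL) with rfl | hL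
    · rw [hl.eq_lineThrough (hC x hx) hyl (Finset.disjoint_iff_ne.1 hCD x hx y hy)]
      exact bichromaticLine_lineThrough hCD hx hy
    · exact hsub L hL
  · rw [add_zero, ← Set.ncard_coe_finset]
    exact Set.ncard_le_ncard hsub (finite_bichromaticLine hCD)

/-- If the points of `D` all lie on one line through `x ∈ l`, they lie on distinct lines through
any other point of `l`. -/
lemma card_linesTo_eq_of_card_le_one (hl : IsLine l) (hD : ∀ y ∈ D, y ∉ l) {x x' : ℝ × ℝ}
    (hx : x ∈ l) (hx' : x' ∈ l) (hne : x ≠ x') (h : (linesTo D x).card ≤ 1) :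
    (linesTo D x').card = D.card := by
  refine Finset.card_image_of_injOn fun y hy z hz hyz => ?_
  by_contra hyne
  have hxy : x ≠ y := fun h => hD y hy (h ▸ hx)
  have hxy' : x' ≠ y := fun h => hD y hy (h ▸ hx')
  have h₁ : lineThrough x y = lineThrough x z :=
    Finset.card_le_one.1 h _ (Finset.mem_image_of_mem _ hy) _ (Finset.mem_image_of_mem _ hz)
  have h₂ : lineThrough x y = lineThrough x' y :=
    (isLine_lineThrough hxy).eq_of_mem_s5 (isLine_lineThrough hxy') (right_mem_lineThrough x y)
      (h₁ ▸ right_mem_lineThrough x z) (right_mem_lineThrough x' y)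
      (show z ∈ lineThrough x' y from hyz ▸ right_mem_lineThrough x' z) hyne
  refine hD y hy ?_
  rw [hl.eq_of_mem_s5 (isLine_lineThrough hxy) hx hx' (left_mem_lineThrough x y)
    (h₂ ▸ left_mem_lineThrough x' y) hne]
  exact right_mem_lineThrough x y

end Pencils

/-- The bound when the colour class `C` is collinear and the sizes differ by at most one. -/
lemma card_union_sub_one_le_nBichromatic_of_collinear {C D : Finset (ℝ × ℝ)}
    (hCD : Disjoint C D) (h₁ : D.card ≤ C.card + 1) (h₂ : C.card ≤ D.card + 1)
    (hC : Collinear ℝ (C : Set (ℝ × ℝ)))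
    (hcol : ¬ Collinear ℝ ((C ∪ D : Finset (ℝ × ℝ)) : Set (ℝ × ℝ)))
    (hnp : ¬ NearPencil (C ∪ D)) :
    (C ∪ D).card - 1 ≤ nBichromatic C D := by
  have hcard : (C ∪ D).card = C.card + D.card := Finset.card_union_of_disjoint hCD
  have hfour : 4 ≤ (C ∪ D).card := by
    have hnt : 1 < (C ∪ D).card := by
      by_contra! h
      have hs : ((C ∪ D : Finset (ℝ × ℝ)) : Set (ℝ × ℝ)).Subsingleton :=
        Finset.card_le_one_iff_subsingleton.1 h
      rcases hs.eq_empty_or_singleton with h | ⟨a, h⟩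
      · exact hcol (h ▸ collinear_empty ℝ _)
      · exact hcol (h ▸ collinear_singleton ℝ a)
    obtain ⟨p, hp, q, hq, hpq⟩ := Finset.one_lt_card.1 hnt
    have htwo : 1 < (ptsOn (C ∪ D) (lineThrough p q)).card :=
      Finset.one_lt_card.2 ⟨p, Finset.mem_filter.2 ⟨hp, left_mem_lineThrough p q⟩, q,
        Finset.mem_filter.2 ⟨hq, right_mem_lineThrough p q⟩, hpq⟩
    have := card_ptsOn_add_two_le hcol hnp (isLine_lineThrough hpq)
    omega
  have hc : 1 < C.card := by omega
  obtain ⟨p, hp, q, hq, hpq⟩ := Finset.one_lt_card.1 hc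
  obtain ⟨l, hl, hCl⟩ : ∃ l, IsLine l ∧ ∀ x ∈ C, x ∈ l :=
    ⟨lineThrough p q, isLine_lineThrough hpq, fun x hx =>
      hC.mem_affineSpan_of_mem_of_ne (Finset.mem_coe.2 hp) (Finset.mem_coe.2 hq)
        (Finset.mem_coe.2 hx) hpq⟩
  have hsum := sum_card_linesTo_le hCD hl hCl
  set E := D.filter (· ∉ l)
  have hEl : ∀ y ∈ E, y ∉ l := fun y hy => (Finset.mem_filter.1 hy).2
  have hsplit : (D.filter (· ∈ l)).card + E.card = D.card :=
    Finset.card_filter_add_card_filter_not _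
  have hEtwo : 2 ≤ E.card := by
    have h := card_ptsOn_add_two_le hcol hnp hl
    rw [ptsOn, Finset.filter_union, Finset.filter_true_of_mem hCl, Finset.card_union_of_disjoint
      (hCD.mono_right (Finset.filter_subset _ _))] at h
    omega
  by_cases hall : ∀ x ∈ C, 2 ≤ (linesTo E x).card
  · have := Finset.card_nsmul_le_sum C _ 2 hall
    rw [smul_eq_mul] at this
    omega
  · push Not at hall
    obtain ⟨x, hx, hxE⟩ := hall
    have hpos : 1 ≤ (linesTo E x).card :=
      Finset.card_pos.2 ((Finset.card_pos.1 (by omega)).image _)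
    have hrest : ∑ y ∈ C.erase x, (linesTo E y).card = (C.card - 1) * E.card := by
      rw [Finset.sum_congr rfl fun y hy => card_linesTo_eq_of_card_le_one hl hEl (hCl x hx)
        (hCl y (Finset.mem_of_mem_erase hy)) (Finset.ne_of_mem_erase hy).symm (by omega),
        Finset.sum_const, smul_eq_mul, Finset.card_erase_of_mem hx]
    have hdecomp := Finset.add_sum_erase C (fun y => (linesTo E y).card) hx
    have hD0 : (D.filter (· ∈ l)).card ≤
        (if C.Nonempty ∧ ∃ y ∈ D, y ∈ l then 1 else 0) + (C.card - 2) := by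
      split_ifs with h
      · omega
      · have : D.filter (· ∈ l) = ∅ := Finset.filter_eq_empty_iff.2 fun y hy hyl =>
          h ⟨⟨x, hx⟩, y, hy, hyl⟩
        simp [this]
    obtain ⟨c, hc'⟩ : ∃ c, C.card = c + 2 := ⟨C.card - 2, by omega⟩
    obtain ⟨e, he⟩ : ∃ e, E.card = e + 2 := ⟨E.card - 2, by omega⟩
    have hmul : (C.card - 1) * E.card = c * e + 2 * c + e + 2 := by
      rw [hc', he, show c + 2 - 1 = c + 1 by omega]
      ring
    omega

/-- **Proposition 2.2.** There is no counterexample to the main theorem with one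
colour class collinear: if `|R| = n`, `|B| ∈ {n, n-1}`, one of `R`, `B` is collinear,
and `R ∪ B` is neither collinear nor a near-pencil, then there are at least
`|P| - 1` bichromatic lines. -/
theorem bichromatic_lines_of_monochromatic_collinear
    (n : ℕ) (hn : 1 ≤ n) (R B : Finset (ℝ × ℝ)) (hRB : Disjoint R B)
    (hR : R.card = n) (hB : B.card = n ∨ B.card = n - 1)
    (hmono : Collinear ℝ (R : Set (ℝ × ℝ)) ∨ Collinear ℝ (B : Set (ℝ × ℝ)))
    (hcol : ¬ Collinear ℝ ((R ∪ B : Finset (ℝ × ℝ)) : Set (ℝ × ℝ)))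
    (hnp : ¬ NearPencil (R ∪ B)) :
    (R ∪ B).card - 1 ≤ nBichromatic R B := by
  rcases hmono with h | h
  · exact card_union_sub_one_le_nBichromatic_of_collinear hRB (by omega) (by omega) h hcol hnp
  · rw [Finset.union_comm] at hcol hnp ⊢
    rw [nBichromatic_comm]
    exact card_union_sub_one_le_nBichromatic_of_collinear hRB.symm (by omega) (by omega) h hcol hnp
end
end
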